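/- For every constant C₀ > 0 there is a constant K > 0 (depending only on C₀) such that the following holds for every odd prime p and every θ ∈ (0,1]: if f : 𝔽_p → [0,1] satisfies 𝔼(f) ≥ θ and Λ(f) ≤ M + C₀/p, where M is the infimum of Λ(g) over all g : 𝔽_p → [0,1] with 𝔼(g) ≥ θ, then Σ_{n ∈ 𝔽_p} |f(n) − C(n)| ≤ K·p·(log p)^{−2/3}, where C(n) := 1 if f(n) ≥ 1/2 and C(n) := 0 otherwise. -/

import Mathlib

noncomputable def Lam (p : ℕ) [NeZero p] (f : ZMod p → ℝ) : ℝ :=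
  ((p : ℝ) ^ 2)⁻¹ * ∑ n : ZMod p, ∑ d : ZMod p, f n * f (n + d) * f (n + 2 * d)

noncomputable def Ex (p : ℕ) [NeZero p] (f : ZMod p → ℝ) : ℝ :=
  (p : ℝ)⁻¹ * ∑ n : ZMod p, f n



namespace RothAP
open Finset

noncomputable def ch {p : ℕ} [Fact p.Prime] (r x : ZMod p) : ℂ := ZMod.stdAddChar (r * x)

section
variable {p : ℕ} [Fact p.Prime]

lemma ch_add (r x y : ZMod p) : ch r (x + y) = ch r x * ch r y := by
  simp [ch, mul_add, AddChar.map_add_eq_mul]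

lemma ch_add_left (r s x : ZMod p) : ch (r + s) x = ch r x * ch s x := by
  simp [ch, add_mul, AddChar.map_add_eq_mul]

lemma norm_ch (r x : ZMod p) : ‖ch r x‖ = 1 := by
  rw [ch, ZMod.stdAddChar_apply]; exact Circle.norm_coe _

lemma ch_zero (r : ZMod p) : ch r 0 = 1 := by simp [ch]

lemma ch_zero_left (x : ZMod p) : ch 0 x = 1 := by simp [ch]

lemma ch_comm (r x : ZMod p) : ch r x = ch x r := by simp [ch, mul_comm]

lemma ch_neg (r x : ZMod p) : ch r (-x) = (starRingEnd ℂ) (ch r x) := by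
  have h : ch r x * ch r (-x) = 1 := by rw [← ch_add]; simp [ch_zero]
  have h2 : ch r x * (starRingEnd ℂ) (ch r x) = 1 := by
    rw [Complex.mul_conj, Complex.normSq_eq_norm_sq, norm_ch]; simp
  have h3 : ch r x ≠ 0 := by
    intro h0; have := norm_ch r x; rw [h0] at this; simp at this
  exact mul_left_cancel₀ h3 (h.trans h2.symm)

lemma ch_neg_left (r x : ZMod p) : ch (-r) x = (starRingEnd ℂ) (ch r x) := by
  rw [ch_comm, ch_neg, ch_comm]

lemma ch_mul_half (r x : ZMod p) (a : ZMod p) : ch (r * a) x = ch r (a * x) := by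
  simp [ch, mul_assoc]

lemma sum_ch (r : ZMod p) : ∑ x, ch r x = if r = 0 then (p : ℂ) else 0 := by
  split_ifs with h
  · subst h; simp [ch_zero_left, ZMod.card]
  · have hp := ZMod.isPrimitive_stdAddChar p
    have := AddChar.sum_eq_zero_of_ne_one (hp h)
    simpa [ch, AddChar.mulShift_apply] using this

open Classical in
noncomputable def Bohr (Γ : Finset (ZMod p)) (ρ : ℝ) : Finset (ZMod p) :=
  univ.filter fun x => ∀ r ∈ Γ, ‖ch r x - 1‖ ≤ ρ

lemma mem_Bohr {Γ : Finset (ZMod p)} {ρ : ℝ} {x : ZMod p} :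
    x ∈ Bohr Γ ρ ↔ ∀ r ∈ Γ, ‖ch r x - 1‖ ≤ ρ := by
  simp [Bohr]

lemma ch_sub_norm (r x y : ZMod p) : ‖ch r (x - y) - 1‖ = ‖ch r x - ch r y‖ := by
  have : ch r x - ch r y = ch r y * (ch r (x - y) - 1) := by
    rw [mul_sub, ← ch_add]; simp
  rw [this, norm_mul, norm_ch, one_mul]

lemma zero_mem_Bohr {Γ : Finset (ZMod p)} {ρ : ℝ} (h : 0 ≤ ρ) : (0 : ZMod p) ∈ Bohr Γ ρ := by
  rw [mem_Bohr]; intro r _; simpa [ch_zero] using h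

lemma Bohr_card_pos {Γ : Finset (ZMod p)} {ρ : ℝ} (h : 0 ≤ ρ) : 0 < (Bohr Γ ρ).card :=
  card_pos.mpr ⟨0, zero_mem_Bohr h⟩

lemma neg_mem_Bohr {Γ : Finset (ZMod p)} {ρ : ℝ} {x : ZMod p} (h : x ∈ Bohr Γ ρ) :
    -x ∈ Bohr Γ ρ := by
  rw [mem_Bohr] at *
  intro r hr
  have := h r hr
  have h2 := ch_sub_norm r 0 x
  rw [zero_sub, ch_zero, norm_sub_rev 1] at h2
  rwa [h2]

lemma norm_ch_add_sub_one (r x y : ZMod p) :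
    ‖ch r (x + y) - 1‖ ≤ ‖ch r x - 1‖ + ‖ch r y - 1‖ := by
  have : ch r (x + y) - 1 = ch r x * (ch r y - 1) + (ch r x - 1) := by rw [ch_add]; ring
  rw [this]
  refine (norm_add_le _ _).trans ?_
  rw [norm_mul, norm_ch, one_mul, add_comm]

lemma add_mem_Bohr {Γ : Finset (ZMod p)} {ρ σ : ℝ} {x y : ZMod p} (hx : x ∈ Bohr Γ ρ)
    (hy : y ∈ Bohr Γ σ) : x + y ∈ Bohr Γ (ρ + σ) := by
  rw [mem_Bohr] at *
  intro r hr
  exact (norm_ch_add_sub_one r x y).trans (add_le_add (hx r hr) (hy r hr))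

lemma sub_mem_Bohr {Γ : Finset (ZMod p)} {ρ σ : ℝ} {x y : ZMod p} (hx : x ∈ Bohr Γ ρ)
    (hy : y ∈ Bohr Γ σ) : x - y ∈ Bohr Γ (ρ + σ) := by
  rw [sub_eq_add_neg]; exact add_mem_Bohr hx (neg_mem_Bohr hy)

lemma Bohr_mono {Γ : Finset (ZMod p)} {ρ σ : ℝ} (h : ρ ≤ σ) : Bohr Γ ρ ⊆ Bohr Γ σ := by
  intro x hx
  rw [mem_Bohr] at *
  exact fun r hr => (hx r hr).trans h

lemma Bohr_anti {Γ Γ' : Finset (ZMod p)} {ρ : ℝ} (h : Γ ⊆ Γ') : Bohr Γ' ρ ⊆ Bohr Γ ρ := by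
  intro x hx
  rw [mem_Bohr] at *
  exact fun r hr => hx r (h hr)

lemma card_le_Bohr (X Γ : Finset (ZMod p)) (η : ℝ) (hη : 0 < η) (N : ℕ)
    (h : ∀ x ∈ X, ∀ r ∈ Γ, ‖ch r x - 1‖ ≤ N * (η / 2)) :
    X.card ≤ (Bohr Γ η).card * ((2 * N + 1) ^ 2) ^ Γ.card := by
  classical
  let F : ZMod p → (Γ → ℤ × ℤ) := fun x r =>
    (⌊(ch r.1 x - 1).re / (η / 2)⌋, ⌊(ch r.1 x - 1).im / (η / 2)⌋)
  have hη2 : 0 < η / 2 := by positivity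
  have key : ∀ t : ℝ, |t| ≤ N * (η / 2) → ⌊t / (η / 2)⌋ ∈ Finset.Icc (-(N : ℤ)) N := by
    intro t ht
    rw [abs_le] at ht
    rw [Finset.mem_Icc]
    constructor
    · rw [Int.le_floor, le_div_iff₀ hη2]; push_cast; linarith
    · have : t / (η / 2) ≤ N := by rw [div_le_iff₀ hη2]; exact ht.2
      have h3 := Int.floor_le (t / (η / 2))
      exact_mod_cast h3.trans this
  have hc := Finset.card_le_mul_card_image_of_maps_to (s := X)
    (t := Fintype.piFinset (fun _ : Γ => Finset.Icc (-(N : ℤ)) N ×ˢ Finset.Icc (-(N : ℤ)) N))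
    (f := F) (by
      intro x hx
      rw [Fintype.mem_piFinset]
      intro r
      rw [Finset.mem_product]
      have := h x hx r.1 r.2
      exact ⟨key _ ((Complex.abs_re_le_norm _).trans this),
        key _ ((Complex.abs_im_le_norm _).trans this)⟩) (Bohr Γ η).card (by
      intro b _
      rcases (X.filter fun a => F a = b).eq_empty_or_nonempty with h0 | ⟨x0, hx0⟩
      · rw [h0]; simp
      · apply Finset.card_le_card_of_injOn (fun x => x - x0)
        · intro x hx
          simp only [Finset.coe_filter, Set.mem_ofPred_eq] at hx
          simp only [Finset.mem_filter] at hx0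
          have hFF : F x = F x0 := hx.2.trans hx0.2.symm
          show x - x0 ∈ Bohr Γ η
          rw [mem_Bohr]
          intro r hr
          rw [ch_sub_norm]
          have e := congrFun hFF ⟨r, hr⟩
          simp only [F, Prod.mk.injEq] at e
          have fl : ∀ s t : ℝ, ⌊s / (η / 2)⌋ = ⌊t / (η / 2)⌋ → |s - t| ≤ η / 2 := by
            intro s t hst
            have := Int.abs_sub_lt_one_of_floor_eq_floor hst
            rw [← sub_div, abs_div, abs_of_pos hη2, div_lt_one hη2] at this
            exact this.le
          have e1 := fl _ _ e.1
          have e2 := fl _ _ e.2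
          have hn := Complex.norm_le_abs_re_add_abs_im (ch r x - ch r x0)
          have r1 : (ch r x - ch r x0).re = (ch r x - 1).re - (ch r x0 - 1).re := by
            simp
          have r2 : (ch r x - ch r x0).im = (ch r x - 1).im - (ch r x0 - 1).im := by
            simp
          rw [r1, r2] at hn
          linarith
        · intro x _ y _ hxy
          simpa using hxy)
  refine hc.trans ?_
  apply Nat.mul_le_mul_left
  rw [Fintype.card_piFinset]
  simp only [Finset.card_product, Int.card_Icc, prod_const, card_univ, Fintype.card_coe]
  apply Nat.pow_le_pow_left
  have : ((N : ℤ) + 1 - -(N : ℤ)).toNat = 2 * N + 1 := by omega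
  rw [this, sq]

lemma Bohr_double (Γ : Finset (ZMod p)) (ρ : ℝ) (hρ : 0 < ρ) :
    (Bohr Γ ρ).card ≤ (Bohr Γ (ρ / 2)).card * 81 ^ Γ.card := by
  have := card_le_Bohr (Bohr Γ ρ) Γ (ρ / 2) (by positivity) 4 (by
    intro x hx r hr
    have := mem_Bohr.1 hx r hr
    push_cast; linarith)
  simpa using this

lemma Bohr_size (Γ : Finset (ZMod p)) (ρ : ℝ) (hρ : 0 < ρ) (h1 : ρ ≤ 1) (d : ℕ) (hd : Γ.card ≤ d) :
    (p : ℝ) * (ρ ^ 2 / 121) ^ d ≤ (Bohr Γ ρ).card := by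
  have := card_le_Bohr univ Γ ρ hρ ⌈4 / ρ⌉₊ (by
    intro x _ r _
    have h2 : ‖ch r x - 1‖ ≤ 2 := by
      refine (norm_sub_le _ _).trans ?_
      rw [norm_ch]; norm_num
    have h3 : 4 / ρ ≤ (⌈4 / ρ⌉₊ : ℝ) := Nat.le_ceil _
    have h4 : 4 / ρ * (ρ / 2) ≤ ⌈4 / ρ⌉₊ * (ρ / 2) := by gcongr
    have h5 : 4 / ρ * (ρ / 2) = 2 := by field_simp; norm_num
    linarith)
  rw [card_univ, ZMod.card] at this
  have hh : (((2 * ⌈4 / ρ⌉₊ + 1) ^ 2 : ℕ) : ℝ) ≤ 121 / ρ ^ 2 := by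
    have h3 : (⌈4 / ρ⌉₊ : ℝ) < 4 / ρ + 1 := Nat.ceil_lt_add_one (by positivity)
    have h4 : 1 ≤ 1 / ρ := by rw [le_div_iff₀ hρ]; linarith
    have h5 : (2 * (⌈4 / ρ⌉₊ : ℝ) + 1) ≤ 11 / ρ := by
      have : (4 : ℝ) / ρ = 4 * (1 / ρ) := by ring
      have : (11 : ℝ) / ρ = 11 * (1 / ρ) := by ring
      linarith
    push_cast
    calc (2 * (⌈4 / ρ⌉₊ : ℝ) + 1) ^ 2 ≤ (11 / ρ) ^ 2 := by gcongr
      _ = 121 / ρ ^ 2 := by rw [div_pow]; norm_num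
  have h6 : (p : ℝ) ≤ (Bohr Γ ρ).card * (121 / ρ ^ 2) ^ d := by
    have h7 : (p : ℝ) ≤ (Bohr Γ ρ).card * (((2 * ⌈4 / ρ⌉₊ + 1) ^ 2 : ℕ) : ℝ) ^ Γ.card := by
      exact_mod_cast this
    refine h7.trans ?_
    gcongr
    calc (((2 * ⌈4 / ρ⌉₊ + 1) ^ 2 : ℕ) : ℝ) ^ Γ.card ≤ (121 / ρ ^ 2) ^ Γ.card := by gcongr
      _ ≤ (121 / ρ ^ 2) ^ d := by
        apply pow_le_pow_right₀ _ hd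
        rw [le_div_iff₀ (by positivity)]
        nlinarith
  calc (p : ℝ) * (ρ ^ 2 / 121) ^ d
      ≤ ((Bohr Γ ρ).card * (121 / ρ ^ 2) ^ d) * (ρ ^ 2 / 121) ^ d := by gcongr
    _ = ((Bohr Γ ρ).card : ℝ) := by
      rw [mul_assoc, ← mul_pow]
      have : (121 / ρ ^ 2) * (ρ ^ 2 / 121) = 1 := by field_simp
      rw [this]; simp

lemma Bohr_regular (Γ : Finset (ZMod p)) (ρ c : ℝ) (hρ : 0 < ρ) (hc : 0 < c) (hc1 : c ≤ 1)
    (d : ℕ) (hd : Γ.card ≤ d) (hd1 : 1 ≤ d) :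
    ∃ σ : ℝ, ρ / 2 ≤ σ ∧ σ ≤ ρ ∧
      ((Bohr Γ (σ * (1 + c / (40 * d)))).card : ℝ) ≤ (1 + c) * (Bohr Γ σ).card := by
  by_contra hcon
  push Not at hcon
  have hd0 : (1 : ℝ) ≤ d := by exact_mod_cast hd1
  set κ := c / (40 * d) with hκ
  have hκ0 : 0 < κ := by positivity
  set J := ⌊20 * d / c⌋₊ with hJ
  have hJle : (J : ℝ) ≤ 20 * d / c := Nat.floor_le (by positivity)
  have hJge : 20 * d / c - 1 < J := Nat.sub_one_lt_floor _
  have hpow : ∀ j ≤ J, (1 + κ) ^ j ≤ 2 := by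
    intro j hj
    have : (1 + κ) ^ j ≤ Real.exp (κ * J) := by
      calc (1 + κ) ^ j ≤ (Real.exp κ) ^ j := by
            gcongr
            linarith [Real.add_one_le_exp κ]
        _ = Real.exp (κ * j) := by rw [← Real.exp_nat_mul]; ring_nf
        _ ≤ Real.exp (κ * J) := by gcongr
    have h2 : κ * J ≤ 1 / 2 := by
      calc κ * J ≤ κ * (20 * d / c) := by gcongr
        _ = 1 / 2 := by rw [hκ]; field_simp; norm_num
    have h3 : Real.exp (1 / 2) ≤ 2 := by
      have h4 := Real.exp_one_lt_d9
      have h5 : Real.exp (1 / 2) ^ 2 = Real.exp 1 := by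
        rw [← Real.exp_nat_mul]; norm_num
      nlinarith [Real.exp_pos (1 / 2 : ℝ)]
    exact this.trans ((Real.exp_le_exp.2 h2).trans h3)
  have hind : ∀ j ≤ J, (1 + c) ^ j * ((Bohr Γ (ρ / 2)).card : ℝ)
      ≤ (Bohr Γ (ρ / 2 * (1 + κ) ^ j)).card := by
    intro j
    induction j with
    | zero => intro _; simp
    | succ j ih =>
      intro hj
      have h1 := ih (by omega)
      have h2 := hcon (ρ / 2 * (1 + κ) ^ j) (by
        have : 1 ≤ (1 + κ) ^ j := one_le_pow₀ (by linarith)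
        nlinarith) (by
        have := hpow j (by omega)
        nlinarith)
      rw [pow_succ, pow_succ, ← mul_assoc]
      calc (1 + c) ^ j * (1 + c) * ((Bohr Γ (ρ / 2)).card : ℝ)
          = (1 + c) * ((1 + c) ^ j * ((Bohr Γ (ρ / 2)).card : ℝ)) := by ring
        _ ≤ (1 + c) * (Bohr Γ (ρ / 2 * (1 + κ) ^ j)).card := by gcongr
        _ ≤ _ := h2.le
  have h1 := hind J le_rfl
  have h2 : ((Bohr Γ (ρ / 2 * (1 + κ) ^ J)).card : ℝ) ≤ (Bohr Γ ρ).card := by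
    have := hpow J le_rfl
    exact_mod_cast card_le_card (Bohr_mono (by nlinarith))
  have h3 : ((Bohr Γ ρ).card : ℝ) ≤ (Bohr Γ (ρ / 2)).card * 81 ^ d := by
    have : ((Bohr Γ ρ).card : ℝ) ≤ (Bohr Γ (ρ / 2)).card * 81 ^ Γ.card := by
      exact_mod_cast Bohr_double Γ ρ hρ
    refine this.trans ?_
    gcongr
    norm_num
  have hpos : (0 : ℝ) < (Bohr Γ (ρ / 2)).card := by
    exact_mod_cast Bohr_card_pos (by positivity)
  have h4 : (1 + c) ^ J ≤ (81 : ℝ) ^ d := by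
    have : (1 + c) ^ J * ((Bohr Γ (ρ / 2)).card : ℝ) ≤ 81 ^ d * (Bohr Γ (ρ / 2)).card := by
      linarith
    exact le_of_mul_le_mul_right this hpos
  have h5 : Real.exp (c / 2) ≤ 1 + c := by
    rw [← Real.le_log_iff_exp_le (by linarith)]
    have := Real.one_sub_inv_le_log_of_pos (show (0:ℝ) < 1 + c by linarith)
    have h6 : c / 2 ≤ 1 - (1 + c)⁻¹ := by
      have : 1 - (1 + c)⁻¹ = c / (1 + c) := by field_simp; ring
      rw [this]
      gcongr; linarith
    linarith
  have h6 : Real.exp (19 / 2 * d) ≤ (1 + c) ^ J := by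
    calc Real.exp (19 / 2 * d) ≤ Real.exp (J * (c / 2)) := by
          apply Real.exp_le_exp.2
          have : (20 * d / c - 1) * (c / 2) ≤ J * (c / 2) := by gcongr
          have h7 : (20 * d / c - 1) * (c / 2) = 10 * d - c / 2 := by field_simp; ring
          nlinarith
      _ = Real.exp (c / 2) ^ J := by rw [← Real.exp_nat_mul]
      _ ≤ _ := by gcongr
  have h7 : (81 : ℝ) ^ d < Real.exp (19 / 2 * d) := by
    have : Real.exp (19 / 2 * d) = Real.exp (19 / 2) ^ d := by
      rw [← Real.exp_nat_mul]; ring_nf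
    rw [this]
    apply pow_lt_pow_left₀ _ (by norm_num) (by omega)
    have h8 : (2:ℝ) ^ 9 < Real.exp (19 / 2) := by
      calc (2:ℝ)^9 ≤ (Real.exp 1)^9 := by
            gcongr
            linarith [Real.exp_one_gt_d9]
        _ = Real.exp 9 := by rw [← Real.exp_nat_mul]; norm_num
        _ < _ := by apply Real.exp_lt_exp.2; norm_num
    norm_num at h8 ⊢
    linarith
  linarith

end
end RothAP


namespace RothAP
open Finset

lemma mgf_bound {G : Type*} (D : Finset G) (hD : D.Nonempty) (φ : G → ℝ)
    (h0 : ∀ y, 0 ≤ φ y) (h1 : ∀ y, φ y ≤ 1) (s : ℝ) (hs : |s| ≤ 1) (u : ℝ)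
    (hu : u = (∑ y ∈ D, φ y) / D.card) :
    ∑ y ∈ D, Real.exp (s * (φ y - u)) ≤ D.card * Real.exp (u * s ^ 2) := by
  have hDc : (0 : ℝ) < D.card := by exact_mod_cast card_pos.2 hD
  have hsum : ∑ y ∈ D, φ y = u * D.card := by rw [hu]; field_simp
  have hpt : ∀ y, Real.exp (s * φ y) ≤ 1 + φ y * (s + s ^ 2) := by
    intro y
    have hy : |s * φ y| ≤ 1 := by
      rw [abs_mul, abs_of_nonneg (h0 y)]
      nlinarith [h0 y, h1 y, abs_nonneg s]
    have := (abs_le.1 (Real.abs_exp_sub_one_sub_id_le hy)).2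
    have h2 : (s * φ y) ^ 2 ≤ s ^ 2 * φ y := by
      rw [mul_pow]
      have : φ y ^ 2 ≤ φ y := by nlinarith [h0 y, h1 y]
      exact mul_le_mul_of_nonneg_left this (sq_nonneg s)
    linarith
  calc ∑ y ∈ D, Real.exp (s * (φ y - u)) = ∑ y ∈ D, Real.exp (-(s * u)) * Real.exp (s * φ y) := by
        apply sum_congr rfl; intro y _; rw [← Real.exp_add]; ring_nf
    _ ≤ ∑ y ∈ D, Real.exp (-(s * u)) * (1 + φ y * (s + s ^ 2)) := by
        apply sum_le_sum; intro y _
        exact mul_le_mul_of_nonneg_left (hpt y) (Real.exp_pos _).le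
    _ = Real.exp (-(s * u)) * (D.card * (1 + u * (s + s ^ 2))) := by
        rw [← mul_sum, sum_add_distrib, ← sum_mul, hsum]; simp; ring
    _ ≤ Real.exp (-(s * u)) * (D.card * Real.exp (u * (s + s ^ 2))) := by
        gcongr
        linarith [Real.add_one_le_exp (u * (s + s ^ 2))]
    _ = D.card * (Real.exp (-(s * u)) * Real.exp (u * (s + s ^ 2))) := by ring
    _ = D.card * Real.exp (u * s ^ 2) := by rw [← Real.exp_add]; ring_nf

lemma moment_bound {G : Type*} (D : Finset G) (hD : D.Nonempty) (φ : G → ℝ)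
    (h0 : ∀ y, 0 ≤ φ y) (h1 : ∀ y, φ y ≤ 1) (k m : ℕ) (hk : 1 ≤ k) (hm : 1 ≤ m) (u : ℝ)
    (hu : u = (∑ y ∈ D, φ y) / D.card) :
    ∑ y ∈ Fintype.piFinset (fun _ : Fin k => D), ((∑ i, φ (y i)) / k - u) ^ (2 * m)
      ≤ (D.card : ℝ) ^ k * (22 * (m / k) * (u + m / k)) ^ m := by
  classical
  have hu0 : 0 ≤ u := by rw [hu]; exact div_nonneg (sum_nonneg fun y _ => h0 y) (by positivity)
  have hk0 : (1 : ℝ) ≤ k := by exact_mod_cast hk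
  have hm0 : (1 : ℝ) ≤ m := by exact_mod_cast hm
  have hq : 0 < (k * u + m : ℝ) := by positivity
  set s := Real.sqrt (m / (k * u + m)) with hs
  have hs2 : s ^ 2 = m / (k * u + m) := Real.sq_sqrt (by positivity)
  have hspos : 0 < s := Real.sqrt_pos.2 (by positivity)
  have hs1 : s ≤ 1 := by
    have h : s ^ 2 ≤ 1 := by rw [hs2, div_le_one hq]; nlinarith
    nlinarith
  -- exponential sums
  have hexp : ∀ s' : ℝ, |s'| ≤ 1 → s' ^ 2 = s ^ 2 →
      ∑ y ∈ Fintype.piFinset (fun _ : Fin k => D), Real.exp (s' * ∑ i, (φ (y i) - u))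
        ≤ (D.card : ℝ) ^ k * Real.exp m := by
    intro s' hs' hss
    have e1 : ∑ y ∈ Fintype.piFinset (fun _ : Fin k => D), Real.exp (s' * ∑ i, (φ (y i) - u))
        = (∑ y ∈ D, Real.exp (s' * (φ y - u))) ^ k := by
      have := Finset.prod_univ_sum (fun _ : Fin k => D) (fun _ y => Real.exp (s' * (φ y - u)))
      rw [Finset.prod_const, card_univ, Fintype.card_fin] at this
      rw [this]
      apply sum_congr rfl
      intro y _
      rw [← Real.exp_sum, mul_sum]
    rw [e1]
    calc (∑ y ∈ D, Real.exp (s' * (φ y - u))) ^ k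
        ≤ (D.card * Real.exp (u * s' ^ 2)) ^ k := by
          gcongr
          exact mgf_bound D hD φ h0 h1 s' hs' u hu
      _ = (D.card : ℝ) ^ k * Real.exp (k * (u * s' ^ 2)) := by
          rw [mul_pow, ← Real.exp_nat_mul]
      _ ≤ _ := by
          gcongr
          rw [hss, hs2]
          have : (k : ℝ) * (u * (m / (k * u + m))) = m * ((k * u) / (k * u + m)) := by
            field_simp
          rw [this]
          have : (k * u) / (k * u + m) ≤ (1 : ℝ) := by
            rw [div_le_one hq]; linarith
          nlinarith
  have hp1 := hexp s (by rw [abs_of_pos hspos]; exact hs1) rfl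
  have hp2 := hexp (-s) (by rw [abs_neg, abs_of_pos hspos]; exact hs1) (by ring)
  have hpt : ∀ Y : ℝ, (s * Y) ^ (2 * m)
      ≤ ((2 * m).factorial : ℝ) * (Real.exp (s * Y) + Real.exp (-s * Y)) := by
    intro Y
    have h := Real.pow_div_factorial_le_exp (|s * Y|) (abs_nonneg _) (2 * m)
    have hf : (0 : ℝ) < (2 * m).factorial := by exact_mod_cast Nat.factorial_pos _
    rw [div_le_iff₀ hf, pow_mul, sq_abs, ← pow_mul] at h
    refine h.trans ?_
    rw [mul_comm]
    gcongr
    rcases abs_cases (s * Y) with ⟨h, _⟩ | ⟨h, _⟩ <;> rw [h]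
    · linarith [Real.exp_pos (-s * Y)]
    · rw [neg_mul]; linarith [Real.exp_pos (s * Y)]
  have hfac : ((2 * m).factorial : ℝ) ≤ (4 * m ^ 2 : ℝ) ^ m := by
    have : ((2 * m).factorial : ℝ) ≤ ((2 * m : ℕ) : ℝ) ^ (2 * m) := by
      exact_mod_cast Nat.factorial_le_pow _
    refine this.trans (le_of_eq ?_)
    rw [pow_mul]; push_cast; congr 1; ring
  have hsumY : (s ^ 2) ^ m * ∑ y ∈ Fintype.piFinset (fun _ : Fin k => D),
      (∑ i, (φ (y i) - u)) ^ (2 * m) ≤ (4 * m ^ 2 : ℝ) ^ m * (2 * ((D.card : ℝ) ^ k * Real.exp m)) := by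
    calc _ = ∑ y ∈ Fintype.piFinset (fun _ : Fin k => D), (s * ∑ i, (φ (y i) - u)) ^ (2 * m) := by
          rw [mul_sum]; apply sum_congr rfl; intro y _
          rw [mul_pow, ← pow_mul]
      _ ≤ ∑ y ∈ Fintype.piFinset (fun _ : Fin k => D), ((2 * m).factorial : ℝ) *
          (Real.exp (s * ∑ i, (φ (y i) - u)) + Real.exp (-s * ∑ i, (φ (y i) - u))) :=
          sum_le_sum fun y _ => hpt _
      _ = ((2 * m).factorial : ℝ) * (∑ y ∈ Fintype.piFinset (fun _ : Fin k => D),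
          Real.exp (s * ∑ i, (φ (y i) - u)) + ∑ y ∈ Fintype.piFinset (fun _ : Fin k => D),
          Real.exp (-s * ∑ i, (φ (y i) - u))) := by rw [← mul_sum, sum_add_distrib]
      _ ≤ (4 * m ^ 2 : ℝ) ^ m * (2 * ((D.card : ℝ) ^ k * Real.exp m)) := by
          apply mul_le_mul hfac (by linarith) _ (by positivity)
          exact add_nonneg (sum_nonneg fun y _ => (Real.exp_pos _).le)
            (sum_nonneg fun y _ => (Real.exp_pos _).le)
  have hZ : ∀ y : Fin k → G, (∑ i, φ (y i)) / k - u = (∑ i, (φ (y i) - u)) / k := by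
    intro y
    rw [sum_sub_distrib]; simp; field_simp
  simp_rw [hZ, div_pow]
  rw [← sum_div]
  set S := ∑ y ∈ Fintype.piFinset (fun _ : Fin k => D), (∑ i, (φ (y i) - u)) ^ (2 * m) with hS
  have hSb : S ≤ (D.card : ℝ) ^ k * (22 * m * (k * u + m)) ^ m := by
    have hs2m : 0 < (s ^ 2) ^ m := by positivity
    rw [← mul_le_mul_iff_right₀ hs2m]
    refine hsumY.trans ?_
    have : (s ^ 2) ^ m * ((D.card : ℝ) ^ k * (22 * m * (k * u + m)) ^ m)
        = (D.card : ℝ) ^ k * (22 * m ^ 2) ^ m := by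
      rw [mul_left_comm, ← mul_pow, hs2]; congr 2; field_simp
    rw [this]
    have h2 : (2 : ℝ) ≤ 2 ^ m := by
      calc (2 : ℝ) = 2 ^ 1 := by norm_num
        _ ≤ 2 ^ m := pow_le_pow_right₀ (by norm_num) hm
    have he : Real.exp m = Real.exp 1 ^ m := by rw [← Real.exp_nat_mul]; simp
    calc (4 * m ^ 2 : ℝ) ^ m * (2 * ((D.card : ℝ) ^ k * Real.exp m))
        ≤ (4 * m ^ 2 : ℝ) ^ m * (2 ^ m * ((D.card : ℝ) ^ k * Real.exp m)) := by gcongr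
      _ = (D.card : ℝ) ^ k * (8 * Real.exp 1 * m ^ 2) ^ m := by
          rw [he, mul_pow, mul_pow, mul_pow]
          have : (8 : ℝ) ^ m = 4 ^ m * 2 ^ m := by rw [← mul_pow]; norm_num
          rw [this]; ring
      _ ≤ _ := by
          gcongr
          linarith [Real.exp_one_lt_d9]
  rw [div_le_iff₀ (by positivity)]
  refine hSb.trans (le_of_eq ?_)
  rw [pow_mul, mul_assoc ((D.card : ℝ) ^ k), ← mul_pow]
  congr 2
  field_simp

lemma croot_sisask {G : Type*} [AddCommGroup G] [Fintype G] [DecidableEq G] (D S DS : Finset G)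
    (hD : D.Nonempty) (hS : S.Nonempty) (hDS : ∀ d ∈ D, ∀ s ∈ S, d + s ∈ DS) (K : ℝ)
    (hK : (DS.card : ℝ) ≤ K * D.card) (φ f : G → ℝ) (k m : ℕ) (hm : 1 ≤ m) (E : ℝ)
    (hE : ∑ z, ∑ y ∈ Fintype.piFinset (fun _ : Fin k => D),
      ((∑ i, φ (z - y i)) / k - f z) ^ (2 * m) ≤ (D.card : ℝ) ^ k * E) :
    ∃ T ⊆ S, (S.card : ℝ) ≤ 2 * K ^ k * T.card ∧ ∀ t ∈ T, ∀ t' ∈ T,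
      ∑ z, (f (z - t) - f (z - t')) ^ (2 * m) ≤ 2 ^ (2 * m + 1) * E := by
  classical
  have hDc : (0 : ℝ) < D.card := by exact_mod_cast card_pos.2 hD
  have hDk : (0 : ℝ) < (D.card : ℝ) ^ k := by positivity
  have hE0 : 0 ≤ E := by
    have : 0 ≤ (D.card : ℝ) ^ k * E := by
      refine le_trans ?_ hE
      exact sum_nonneg fun z _ => sum_nonneg fun y _ => by rw [pow_mul]; positivity
    exact nonneg_of_mul_nonneg_right this hDk
  let e : (Fin k → G) → ℝ := fun y => ∑ z, ((∑ i, φ (z - y i)) / k - f z) ^ (2 * m)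
  have he0 : ∀ y, 0 ≤ e y := fun y => sum_nonneg fun z _ => by rw [pow_mul]; positivity
  let P := Fintype.piFinset (fun _ : Fin k => D)
  let good := P.filter fun y => e y ≤ 2 * E
  have hPc : (P.card : ℝ) = (D.card : ℝ) ^ k := by
    simp [P, Fintype.card_piFinset]
  have hsumE : ∑ y ∈ P, e y ≤ (D.card : ℝ) ^ k * E := by
    simp only [e]; rw [sum_comm]; exact hE
  have hgood : (D.card : ℝ) ^ k ≤ 2 * good.card := by
    rcases hE0.eq_or_lt with h0 | hpos
    · have : good = P := by
        apply filter_true_of_mem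
        intro y hy
        have h1 : ∑ y ∈ P, e y ≤ 0 := by simpa [← h0] using hsumE
        have h2 := single_le_sum (fun y _ => he0 y) hy
        rw [← h0]; linarith
      rw [this, hPc]; linarith
    · have hsplit := card_filter_add_card_filter_not (s := P) (fun y => e y ≤ 2 * E)
      have hbad : 2 * E * ((P.filter fun y => ¬ e y ≤ 2 * E).card : ℝ) ≤ (D.card : ℝ) ^ k * E := by
        calc 2 * E * ((P.filter fun y => ¬ e y ≤ 2 * E).card : ℝ)
            = ∑ y ∈ P.filter (fun y => ¬ e y ≤ 2 * E), 2 * E := by simp; ring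
          _ ≤ ∑ y ∈ P.filter (fun y => ¬ e y ≤ 2 * E), e y := by
              apply sum_le_sum; intro y hy
              simp only [mem_filter, not_le] at hy
              exact hy.2.le
          _ ≤ ∑ y ∈ P, e y := sum_le_sum_of_subset_of_nonneg (filter_subset _ _)
              fun y _ _ => he0 y
          _ ≤ _ := hsumE
      have h3 : 2 * ((P.filter fun y => ¬ e y ≤ 2 * E).card : ℝ) ≤ (D.card : ℝ) ^ k := by
        refine le_of_mul_le_mul_right ?_ hpos
        linarith
      have h4 : (good.card : ℝ) + ((P.filter fun y => ¬ e y ≤ 2 * E).card : ℝ) = P.card := by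
        exact_mod_cast hsplit
      rw [hPc] at h4
      linarith
  let Q := Fintype.piFinset (fun _ : Fin k => DS)
  have hQc : (Q.card : ℝ) = (DS.card : ℝ) ^ k := by
    simp [Q, Fintype.card_piFinset]
  let Tw : (Fin k → G) → Finset G := fun w => S.filter fun s => (fun i => w i - s) ∈ good
  have hcount : (S.card : ℝ) * good.card ≤ ∑ w ∈ Q, ((Tw w).card : ℝ) := by
    have h1 : ∑ w ∈ Q, (Tw w).card
        = ∑ s ∈ S, (Q.filter fun w => (fun i => w i - s) ∈ good).card := by
      simp only [Tw, card_filter]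
      rw [sum_comm]
    have h2 : S.card * good.card ≤ ∑ w ∈ Q, (Tw w).card := by
      rw [h1, ← smul_eq_mul, ← sum_const]
      apply sum_le_sum
      intro s hs
      apply card_le_card_of_injOn (fun y i => y i + s)
      · intro y hy
        have hy' : y ∈ good := hy
        have hyP : ∀ i, y i ∈ D := by
          have := (mem_filter.1 hy').1
          exact Fintype.mem_piFinset.1 this
        show (fun i => y i + s) ∈ Q.filter _
        rw [mem_filter]
        refine ⟨Fintype.mem_piFinset.2 fun i => hDS _ (hyP i) _ hs, ?_⟩
        simpa using hy'
      · intro y _ y' _ h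
        funext i
        have := congrFun h i
        simpa using this
    exact_mod_cast h2
  have hex : ∃ w ∈ Q, (S.card : ℝ) * good.card ≤ (DS.card : ℝ) ^ k * (Tw w).card := by
    by_contra hcon
    push Not at hcon
    have hSg : 0 < (S.card : ℝ) * good.card := by
      have : (0 : ℝ) < S.card := by exact_mod_cast card_pos.2 hS
      have : (0 : ℝ) < good.card := by linarith
      positivity
    have hQne : Q.Nonempty := by
      by_contra hne
      rw [not_nonempty_iff_eq_empty] at hne
      rw [hne] at hcount
      simp only [sum_empty] at hcount
      linarith
    have h5 : ∑ w ∈ Q, (DS.card : ℝ) ^ k * ((Tw w).card : ℝ)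
        < ∑ w ∈ Q, (S.card : ℝ) * good.card := sum_lt_sum_of_nonempty hQne hcon
    rw [← mul_sum, sum_const, nsmul_eq_mul, hQc] at h5
    have h6 : 0 ≤ (DS.card : ℝ) ^ k := by positivity
    nlinarith
  obtain ⟨w, hwQ, hw⟩ := hex
  refine ⟨Tw w, filter_subset _ _, ?_, ?_⟩
  · have h7 : (DS.card : ℝ) ^ k ≤ K ^ k * (D.card : ℝ) ^ k := by
      rw [← mul_pow]; gcongr
    have h8 : (S.card : ℝ) * (D.card : ℝ) ^ k ≤ 2 * K ^ k * (Tw w).card * (D.card : ℝ) ^ k := by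
      calc (S.card : ℝ) * (D.card : ℝ) ^ k ≤ S.card * (2 * good.card) := by gcongr
        _ = 2 * (S.card * good.card) := by ring
        _ ≤ 2 * ((DS.card : ℝ) ^ k * (Tw w).card) := by gcongr
        _ ≤ 2 * (K ^ k * (D.card : ℝ) ^ k * (Tw w).card) := by gcongr
        _ = _ := by ring
    exact le_of_mul_le_mul_right h8 hDk
  · have hkey : ∀ t ∈ Tw w, ∑ z, ((∑ i, φ (z - w i)) / k - f (z - t)) ^ (2 * m) ≤ 2 * E := by
      intro t ht
      have h9 := (mem_filter.1 (mem_filter.1 ht).2).2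
      refine le_trans (le_of_eq ?_) h9
      simp only [e]
      rw [← Equiv.sum_comp (Equiv.subRight t) (fun z => ((∑ i, φ (z - (w i - t))) / k - f z) ^ (2 * m))]
      apply sum_congr rfl
      intro z _
      simp
    intro t ht t' ht'
    have a1 := hkey t ht
    have a2 := hkey t' ht'
    have hpt : ∀ a b : ℝ, (a - b) ^ (2 * m) ≤ 2 ^ (2 * m - 1) * (a ^ (2 * m) + b ^ (2 * m)) := by
      intro a b
      have h10 := add_pow_le (abs_nonneg a) (abs_nonneg b) (2 * m)
      have h11 : (a - b) ^ (2 * m) ≤ (|a| + |b|) ^ (2 * m) := by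
        rw [← Even.pow_abs (even_two_mul m) (a - b)]
        gcongr
        exact abs_sub a b
      rw [Even.pow_abs (even_two_mul m), Even.pow_abs (even_two_mul m)] at h10
      exact h11.trans h10
    calc ∑ z, (f (z - t) - f (z - t')) ^ (2 * m)
        = ∑ z, (((∑ i, φ (z - w i)) / k - f (z - t')) - ((∑ i, φ (z - w i)) / k - f (z - t)))
          ^ (2 * m) := by
          apply sum_congr rfl; intro z _; congr 1; ring
      _ ≤ ∑ z, 2 ^ (2 * m - 1) * (((∑ i, φ (z - w i)) / k - f (z - t')) ^ (2 * m) +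
          ((∑ i, φ (z - w i)) / k - f (z - t)) ^ (2 * m)) := sum_le_sum fun z _ => hpt _ _
      _ = 2 ^ (2 * m - 1) * (∑ z, ((∑ i, φ (z - w i)) / k - f (z - t')) ^ (2 * m) +
          ∑ z, ((∑ i, φ (z - w i)) / k - f (z - t)) ^ (2 * m)) := by
          rw [← mul_sum, sum_add_distrib]
      _ ≤ 2 ^ (2 * m - 1) * (2 * E + 2 * E) := by gcongr
      _ ≤ 2 ^ (2 * m) * (2 * E) := by
          obtain ⟨j, hj⟩ : ∃ j, 2 * m = j + 1 := ⟨2 * m - 1, by omega⟩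
          rw [hj, Nat.add_sub_cancel, pow_succ]
          apply le_of_eq; ring
      _ = _ := by ring

end RothAP


namespace RothAP
open Finset

noncomputable def mh {p : ℕ} [Fact p.Prime] {ι : Type*} (I : Finset ι) (τ : ι → ZMod p)
    (r : ZMod p) : ℂ := (∑ i ∈ I, ch r (τ i)) / (I.card : ℂ)

noncomputable def av {p : ℕ} [Fact p.Prime] {ι : Type*} (I : Finset ι) (τ : ι → ZMod p)
    (g : ZMod p → ℝ) (z : ZMod p) : ℝ := (∑ i ∈ I, g (z - τ i)) / (I.card : ℝ)

section
variable {p : ℕ} [Fact p.Prime]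

lemma norm_mh_le {ι : Type*} (I : Finset ι) (τ : ι → ZMod p) (r : ZMod p) : ‖mh I τ r‖ ≤ 1 := by
  rw [mh, norm_div]
  have h : ‖∑ i ∈ I, ch r (τ i)‖ ≤ I.card := by
    refine (norm_sum_le _ _).trans ?_
    simp [norm_ch]
  have h2 : ‖(I.card : ℂ)‖ = (I.card : ℝ) := by simp
  rw [h2]
  exact div_le_one_of_le₀ h (by positivity)

/-- index set of signs -/
def sg (L : Finset (ZMod p)) : ZMod p → Finset ℤ := fun x => if x ∈ L then {-1, 0, 1} else {0}

def Diss (S' : Finset (ZMod p)) (L : Finset (ZMod p)) : Prop :=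
  ∀ ε ∈ Fintype.piFinset (sg L), ε ≠ 0 → ‖mh S' id (∑ x, ε x • x)‖ ≤ 1 / 2

lemma ch_sum_left {ι : Type*} (s : Finset ι) (a : ι → ZMod p) (z : ZMod p) :
    ch (∑ x ∈ s, a x) z = ∏ x ∈ s, ch (a x) z := by
  classical
  induction s using Finset.induction_on with
  | empty => simp [ch_zero_left]
  | insert a s ha ih => rw [sum_insert ha, prod_insert ha, ch_add_left, ih]

lemma ch_sum_right {ι : Type*} (s : Finset ι) (a : ι → ZMod p) (z : ZMod p) :
    ch z (∑ x ∈ s, a x) = ∏ x ∈ s, ch z (a x) := by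
  rw [ch_comm, ch_sum_left]; exact prod_congr rfl fun x _ => ch_comm _ _

lemma exp_le_one_add {y : ℝ} (hy : |y| ≤ 1 / 2) : Real.exp (y - y ^ 2) ≤ 1 + y := by
  have h1 := abs_le.1 hy
  have h2 : |y - y ^ 2| ≤ 1 := by rw [abs_le]; constructor <;> nlinarith
  have h4 : |-y| ≤ 1 := by rw [abs_neg]; linarith
  by_cases hy0 : 0 ≤ y
  · have := (abs_le.1 (Real.abs_exp_sub_one_sub_id_le h2)).2
    nlinarith [mul_nonneg hy0 hy0, mul_nonneg (mul_nonneg hy0 hy0) hy0]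
  · push Not at hy0
    have h6 := Real.quadratic_le_exp_of_nonneg (x := -(y - y ^ 2)) (by nlinarith)
    have h7 : Real.exp (y - y ^ 2) * Real.exp (-(y - y ^ 2)) = 1 := by
      rw [← Real.exp_add]; simp
    have h8 : 1 ≤ (1 + y) * (1 + -(y - y ^ 2) + (-(y - y ^ 2)) ^ 2 / 2) := by
      have e : (1 + y) * (1 + -(y - y ^ 2) + (-(y - y ^ 2)) ^ 2 / 2)
        = 1 + y ^ 2 * (y + (1 - y ^ 2) * (1 - y) / 2) := by ring
      rw [e]
      have : 0 ≤ y + (1 - y ^ 2) * (1 - y) / 2 := by nlinarith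
      have := mul_nonneg (sq_nonneg y) this
      linarith
    have h9 := Real.exp_pos (y - y ^ 2)
    by_contra hc
    push Not at hc
    nlinarith [Real.exp_pos (-(y - y ^ 2))]

/-- Riesz product -/
noncomputable def rz (L : Finset (ZMod p)) (a : ZMod p → ℂ) (z : ZMod p) : ℝ :=
  ∏ x ∈ L, (1 + ((a x) * ch x z).re)

noncomputable def cf (a : ZMod p → ℂ) (x : ZMod p) (e : ℤ) : ℂ :=
  if e = 0 then 1 else if e = 1 then a x / 2 else (starRingEnd ℂ) (a x) / 2

lemma rz_expand (L : Finset (ZMod p)) (a : ZMod p → ℂ) (z : ZMod p) :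
    (rz L a z : ℂ) = ∑ ε ∈ Fintype.piFinset (sg L), (∏ x, cf a x (ε x)) * ch (∑ x, ε x • x) z := by
  have h1 : (rz L a z : ℂ) = ∏ x, ∑ e ∈ sg L x, cf a x e * ch (e • x) z := by
    rw [rz, Complex.ofReal_prod, ← Finset.prod_subset (subset_univ L)]
    · apply prod_congr rfl
      intro x hx
      have h2 : (∑ e ∈ sg L x, cf a x e * ch (e • x) z)
        = cf a x (-1) * ch (-x) z + (cf a x 0 * ch 0 z + cf a x 1 * ch x z) := by
        simp [sg, hx]
      rw [h2]
      simp only [cf, ch_neg_left, ch_zero_left]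
      norm_num
      have h3 : (((a x * ch x z).re : ℝ) : ℂ) = (a x * ch x z + (starRingEnd ℂ) (a x * ch x z)) / 2 := by
        rw [Complex.add_conj]; push_cast; ring
      have h4 : ((a x).re * (ch x z).re - (a x).im * (ch x z).im : ℂ) = ((a x * ch x z).re : ℝ) := by
        rw [Complex.mul_re]; push_cast; ring
      rw [h4, h3, map_mul]; ring
    · intro x _ hx
      simp [sg, hx, cf, ch_zero_left]
  rw [h1, Finset.prod_univ_sum]
  apply sum_congr rfl
  intro ε _
  rw [prod_mul_distrib, ch_sum_left]

lemma rz_pos (L : Finset (ZMod p)) (a : ZMod p → ℂ) (ha : ∀ x, ‖a x‖ ≤ 1 / 8) (z : ZMod p) :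
    0 ≤ rz L a z := by
  apply prod_nonneg
  intro x _
  have h1 := Complex.abs_re_le_norm (a x * ch x z)
  rw [norm_mul, norm_ch, mul_one] at h1
  have := abs_le.1 (h1.trans (ha x))
  linarith

lemma rz_avg {ι : Type*} (I : Finset ι) (hI : I.Nonempty) (τ : ι → ZMod p) (L : Finset (ZMod p))
    (n : ℕ) (hn : L.card ≤ n) (a : ZMod p → ℂ) (ha : ∀ x, ‖a x‖ ≤ 1 / 8)
    (h : ∀ ε ∈ Fintype.piFinset (sg L), ε ≠ 0 → ‖mh I τ (∑ x, ε x • x)‖ ≤ (1 / 2) ^ n) :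
    (∑ i ∈ I, rz L a (τ i)) ≤ 2 * I.card := by
  have hIc : (0 : ℝ) < I.card := by exact_mod_cast card_pos.2 hI
  have h1 : (((∑ i ∈ I, rz L a (τ i)) / I.card : ℝ) : ℂ)
      = ∑ ε ∈ Fintype.piFinset (sg L), (∏ x, cf a x (ε x)) * mh I τ (∑ x, ε x • x) := by
    push_cast
    simp_rw [rz_expand]
    rw [sum_comm, sum_div]
    apply sum_congr rfl
    intro ε _
    rw [← mul_sum, mh, mul_div_assoc]
  have hz : (0 : ZMod p → ℤ) ∈ Fintype.piFinset (sg L) := by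
    rw [Fintype.mem_piFinset]
    intro x
    by_cases hx : x ∈ L <;> simp [sg, hx]
  have h2 : ‖(((∑ i ∈ I, rz L a (τ i)) / I.card : ℝ) : ℂ)‖ ≤ 2 := by
    rw [h1, ← add_sum_erase _ _ hz]
    refine (norm_add_le _ _).trans ?_
    have e1 : ‖(∏ x, cf a x ((0 : ZMod p → ℤ) x)) * mh I τ (∑ x, (0 : ZMod p → ℤ) x • x)‖ ≤ 1 := by
      have : ∏ x : ZMod p, cf a x ((0 : ZMod p → ℤ) x) = 1 := by
        apply prod_eq_one; intro x _; simp [cf]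
      rw [this, one_mul]
      exact norm_mh_le _ _ _
    have e2 : ‖∑ ε ∈ (Fintype.piFinset (sg L)).erase 0,
        (∏ x, cf a x (ε x)) * mh I τ (∑ x, ε x • x)‖ ≤ 1 := by
      refine (norm_sum_le _ _).trans ?_
      calc ∑ ε ∈ (Fintype.piFinset (sg L)).erase 0, ‖(∏ x, cf a x (ε x)) * mh I τ (∑ x, ε x • x)‖
          ≤ ∑ ε ∈ (Fintype.piFinset (sg L)).erase 0, (∏ x, ‖cf a x (ε x)‖) * (1 / 2) ^ n := by
            apply sum_le_sum
            intro ε hε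
            rw [mem_erase] at hε
            rw [norm_mul, norm_prod]
            apply mul_le_mul_of_nonneg_left (h ε hε.2 hε.1)
            exact prod_nonneg fun x _ => norm_nonneg _
        _ ≤ ∑ ε ∈ Fintype.piFinset (sg L), (∏ x, ‖cf a x (ε x)‖) * (1 / 2) ^ n := by
            apply sum_le_sum_of_subset_of_nonneg (erase_subset _ _)
            intro ε _ _
            have : 0 ≤ ∏ x, ‖cf a x (ε x)‖ := prod_nonneg fun x _ => norm_nonneg _
            positivity
        _ = (∏ x, ∑ e ∈ sg L x, ‖cf a x e‖) * (1 / 2) ^ n := by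
            rw [← sum_mul, Finset.prod_univ_sum]
        _ ≤ 2 ^ n * (1 / 2) ^ n := by
            gcongr
            rw [← Finset.prod_subset (subset_univ L)]
            · calc ∏ x ∈ L, ∑ e ∈ sg L x, ‖cf a x e‖ ≤ ∏ x ∈ L, (2 : ℝ) := by
                    apply prod_le_prod
                    · intro x _; exact sum_nonneg fun e _ => norm_nonneg _
                    · intro x hx
                      have h2 : (∑ e ∈ sg L x, ‖cf a x e‖)
                        = ‖cf a x (-1)‖ + (‖cf a x 0‖ + ‖cf a x 1‖) := by
                        simp [sg, hx]
                      rw [h2]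
                      have := ha x
                      simp only [cf]
                      norm_num
                      linarith
                _ = 2 ^ L.card := by simp
                _ ≤ 2 ^ n := pow_le_pow_right₀ (by norm_num) hn
            · intro x _ hx
              simp [sg, hx, cf]
        _ = 1 := by rw [← mul_pow]; norm_num
    linarith
  rw [Complex.norm_real] at h2
  have h3 := (le_abs_self _).trans h2
  rwa [div_le_iff₀ hIc] at h3

lemma rz_lower (T : Finset (ZMod p)) (hT : T.Nonempty) (L : Finset (ZMod p))
    (hL : ∀ x ∈ L, 1 / 2 ≤ ‖mh T id x‖) :
    T.card * Real.exp (L.card / 64) ≤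
      ∑ t ∈ T, rz L (fun x => (starRingEnd ℂ) (mh T id x) / 8) t := by
  have hTc : (0 : ℝ) < T.card := by exact_mod_cast card_pos.2 hT
  set y : ZMod p → ZMod p → ℝ := fun x t => ((starRingEnd ℂ) (mh T id x) / 8 * ch x t).re with hy
  have hyb : ∀ x t, |y x t| ≤ ‖mh T id x‖ / 8 := by
    intro x t
    refine (Complex.abs_re_le_norm _).trans ?_
    rw [norm_mul, norm_ch, norm_div, RCLike.norm_conj]; simp
  have hsum : ∀ x, ∑ t ∈ T, y x t = T.card * (‖mh T id x‖ ^ 2 / 8) := by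
    intro x
    have h1 : ∑ t ∈ T, ch x t = T.card * mh T id x := by
      have hne : (T.card : ℂ) ≠ 0 := by exact_mod_cast hTc.ne'
      rw [mh, mul_div_cancel₀ _ hne]; rfl
    simp only [hy]
    rw [← Complex.re_sum, ← mul_sum, h1]
    have : (starRingEnd ℂ) (mh T id x) / 8 * (T.card * mh T id x)
      = ((T.card * (‖mh T id x‖ ^ 2 / 8) : ℝ) : ℂ) := by
      have h2 := Complex.mul_conj (mh T id x)
      rw [Complex.normSq_eq_norm_sq] at h2
      push_cast at h2 ⊢
      rw [← h2]; ring
    rw [this, Complex.ofReal_re]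
  set u : ZMod p → ℝ := fun t => ∑ x ∈ L, (y x t - y x t ^ 2) with hu
  have hu1 : ∀ t, Real.exp (u t) ≤ rz L (fun x => (starRingEnd ℂ) (mh T id x) / 8) t := by
    intro t
    rw [hu, Real.exp_sum, rz]
    apply prod_le_prod
    · intro x _; exact (Real.exp_pos _).le
    · intro x _
      apply exp_le_one_add
      refine (hyb x t).trans ?_
      linarith [norm_mh_le T id x]
  have hu2 : T.card * ((L.card : ℝ) / 64) ≤ ∑ t ∈ T, u t := by
    rw [hu, sum_comm]
    have : ∀ x ∈ L, (T.card : ℝ) * (1 / 64) ≤ ∑ t ∈ T, (y x t - y x t ^ 2) := by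
      intro x hx
      rw [sum_sub_distrib, hsum]
      have h3 : ∑ t ∈ T, y x t ^ 2 ≤ T.card * (‖mh T id x‖ ^ 2 / 64) := by
        rw [← nsmul_eq_mul, ← sum_const]
        apply sum_le_sum
        intro t _
        have := hyb x t
        rw [← sq_abs]
        calc |y x t| ^ 2 ≤ (‖mh T id x‖ / 8) ^ 2 := by gcongr
          _ = _ := by ring
      have h4 : (1 / 2 : ℝ) ^ 2 ≤ ‖mh T id x‖ ^ 2 := by gcongr; exact hL x hx
      nlinarith
    calc (T.card : ℝ) * ((L.card : ℝ) / 64) = ∑ x ∈ L, (T.card : ℝ) * (1 / 64) := by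
          rw [sum_const, nsmul_eq_mul]; ring
      _ ≤ _ := sum_le_sum this
  set b : ℝ := (L.card : ℝ) / 64
  calc T.card * Real.exp b ≤ Real.exp b * (T.card + (∑ t ∈ T, u t - T.card * b)) := by
        have := Real.exp_pos b
        nlinarith
    _ = ∑ t ∈ T, Real.exp b * (1 + (u t - b)) := by
        rw [← mul_sum, sum_add_distrib, sum_sub_distrib]; simp
    _ ≤ ∑ t ∈ T, Real.exp (u t) := by
        apply sum_le_sum
        intro t _
        have h5 := Real.add_one_le_exp (u t - b)
        calc Real.exp b * (1 + (u t - b)) ≤ Real.exp b * Real.exp (u t - b) := by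
              gcongr; linarith
          _ = Real.exp (u t) := by rw [← Real.exp_add]; ring_nf
    _ ≤ _ := sum_le_sum fun t _ => hu1 t

end
end RothAP


namespace RothAP
open Finset

section
variable {p : ℕ} [Fact p.Prime]

lemma chang (T S Sp S' : Finset (ZMod p)) (n : ℕ) (hTS : T ⊆ S) (hT : T.Nonempty)
    (hS' : S'.Nonempty) (M : ℝ) (hM : 0 ≤ M)
    (hSM : (S.card : ℝ) ≤ M * T.card) (hSp : (Sp.card : ℝ) ≤ 2 * S.card)
    (hshift : ∀ s ∈ S, ∀ y : Fin n → ZMod p, (∀ i, y i ∈ S') → s - ∑ i, y i ∈ Sp)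
    (hn : 4 * M < Real.exp (n / 64)) (L : Finset (ZMod p)) (hLn : L.card ≤ n)
    (hL : ∀ x ∈ L, 1 / 2 ≤ ‖mh T id x‖) (hd : Diss S' L) : L.card < n := by
  classical
  by_contra hcon
  have hLc : L.card = n := by omega
  have hTc : (0 : ℝ) < T.card := by exact_mod_cast card_pos.2 hT
  have h1 := rz_lower T hT L hL
  set a : ZMod p → ℂ := fun x => (starRingEnd ℂ) (mh T id x) / 8 with ha
  have hab : ∀ x, ‖a x‖ ≤ 1 / 8 := by
    intro x
    rw [ha, norm_div, RCLike.norm_conj]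
    have := norm_mh_le T id x
    norm_num; linarith
  set Y := Fintype.piFinset (fun _ : Fin n => S') with hY
  have hYne : Y.Nonempty := by
    rw [hY, Fintype.piFinset_nonempty]; exact fun _ => hS'
  have hYc : (0 : ℝ) < Y.card := by exact_mod_cast card_pos.2 hYne
  have hYc' : (Y.card : ℂ) ≠ 0 := by exact_mod_cast hYc.ne'
  have hS0 : S.Nonempty := hT.mono hTS
  have hSpne : Sp.Nonempty := by
    obtain ⟨s, hs⟩ := hS0
    obtain ⟨s', hs'⟩ := hS'
    exact ⟨_, hshift s hs (fun _ => s') fun _ => hs'⟩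
  set τ : ZMod p × (Fin n → ZMod p) → ZMod p := fun q => q.1 + ∑ i, q.2 i with hτ
  have hmh : ∀ r, mh (Sp ×ˢ Y) τ r = mh Sp id r * mh S' id r ^ n := by
    intro r
    have e1 : ∑ y ∈ Y, ∏ i, ch r (y i) = (∑ s ∈ S', ch r s) ^ n := by
      have := Finset.prod_univ_sum (fun _ : Fin n => S') (fun _ s => ch r s)
      rw [← this]; simp
    have e2 : (Y.card : ℂ) = (S'.card : ℂ) ^ n := by
      simp [hY, Fintype.card_piFinset]
    simp only [mh, hτ, sum_product, card_product, ch_add, ch_sum_right]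
    simp_rw [← mul_sum]
    rw [e1, ← sum_mul]
    push_cast
    rw [e2, div_pow, mul_div_mul_comm]
    rfl
  have h2 : (∑ q ∈ Sp ×ˢ Y, rz L a (τ q)) ≤ 2 * (Sp ×ˢ Y).card := by
    apply rz_avg (Sp ×ˢ Y) (hSpne.product hYne) τ L n hLn a hab
    intro ε hε hne
    rw [hmh, norm_mul, norm_pow]
    calc ‖mh Sp id (∑ x, ε x • x)‖ * ‖mh S' id (∑ x, ε x • x)‖ ^ n ≤ 1 * (1 / 2) ^ n := by
          gcongr
          · exact norm_mh_le _ _ _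
          · exact hd ε hε hne
      _ = _ := one_mul _
  have h3 : (Y.card : ℝ) * ∑ s ∈ S, rz L a s ≤ ∑ q ∈ Sp ×ˢ Y, rz L a (τ q) := by
    rw [sum_product, sum_comm, ← nsmul_eq_mul, ← sum_const]
    apply sum_le_sum
    intro y hy
    have hy' : ∀ i, y i ∈ S' := Fintype.mem_piFinset.1 hy
    have e3 : ∑ s ∈ S, rz L a s = ∑ s ∈ S.image (fun s => s - ∑ i, y i), rz L a (τ (s, y)) := by
      rw [sum_image]
      · apply sum_congr rfl; intro s _; simp [hτ]
      · intro s _ s' _ h; simpa using h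
    rw [e3]
    apply sum_le_sum_of_subset_of_nonneg
    · intro s hs
      obtain ⟨s', hs', rfl⟩ := mem_image.1 hs
      exact hshift s' hs' y hy'
    · intro s _ _; exact rz_pos L a hab _
  have h4 : ∑ t ∈ T, rz L a t ≤ ∑ s ∈ S, rz L a s :=
    sum_le_sum_of_subset_of_nonneg hTS fun s _ _ => rz_pos L a hab _
  rw [card_product] at h2
  push_cast at h2
  have h5 : ∑ s ∈ S, rz L a s ≤ 2 * Sp.card := by
    have : (Y.card : ℝ) * ∑ s ∈ S, rz L a s ≤ Y.card * (2 * Sp.card) := by linarith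
    exact le_of_mul_le_mul_left this hYc
  rw [hLc] at h1
  have h6 : (T.card : ℝ) * Real.exp (n / 64) ≤ T.card * (4 * M) := by
    calc _ ≤ _ := h1
      _ ≤ _ := h4
      _ ≤ _ := h5
      _ ≤ 2 * (2 * S.card) := by gcongr
      _ ≤ 2 * (2 * (M * T.card)) := by gcongr
      _ = _ := by ring
  have := le_of_mul_le_mul_left h6 hTc
  linarith

lemma Diss_empty (S' : Finset (ZMod p)) : Diss S' (∅ : Finset (ZMod p)) := by
  intro ε hε hne
  exfalso; apply hne; funext x
  have := Fintype.mem_piFinset.1 hε x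
  simpa [sg] using this

lemma norm_ch_smul (e : ℤ) (he : e ∈ ({-1, 0, 1} : Finset ℤ)) (x v : ZMod p) :
    ‖ch (e • x) v - 1‖ ≤ ‖ch x v - 1‖ := by
  simp only [mem_insert, mem_singleton] at he
  rcases he with rfl | rfl | rfl
  · rw [neg_one_smul, ch_neg_left]
    have : (starRingEnd ℂ) (ch x v) - 1 = (starRingEnd ℂ) (ch x v - 1) := by simp
    rw [this, RCLike.norm_conj]
  · simp [ch_zero_left]
  · simp

lemma norm_ch_neg_left (x v : ZMod p) : ‖ch (-x) v - 1‖ = ‖ch x v - 1‖ := by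
  rw [ch_neg_left]
  have : (starRingEnd ℂ) (ch x v) - 1 = (starRingEnd ℂ) (ch x v - 1) := by simp
  rw [this, RCLike.norm_conj]

lemma norm_ch_add_left (x y v : ZMod p) :
    ‖ch (x + y) v - 1‖ ≤ ‖ch x v - 1‖ + ‖ch y v - 1‖ := by
  rw [ch_comm (x + y), ch_comm x, ch_comm y]; exact norm_ch_add_sub_one _ _ _

lemma norm_ch_sum_left {ι : Type*} (s : Finset ι) (a : ι → ZMod p) (v : ZMod p) :
    ‖ch (∑ x ∈ s, a x) v - 1‖ ≤ ∑ x ∈ s, ‖ch (a x) v - 1‖ := by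
  classical
  induction s using Finset.induction_on with
  | empty => simp [ch_zero_left]
  | insert a s ha ih =>
    rw [sum_insert ha, sum_insert ha]
    exact (norm_ch_add_left _ _ _).trans (by gcongr)

lemma chang_span (T S Sp S' : Finset (ZMod p)) (n : ℕ) (hTS : T ⊆ S) (hT : T.Nonempty)
    (hS' : S'.Nonempty) (M : ℝ) (hM : 0 ≤ M)
    (hSM : (S.card : ℝ) ≤ M * T.card) (hSp : (Sp.card : ℝ) ≤ 2 * S.card)
    (hshift : ∀ s ∈ S, ∀ y : Fin n → ZMod p, (∀ i, y i ∈ S') → s - ∑ i, y i ∈ Sp)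
    (hn : 4 * M < Real.exp (n / 64)) :
    ∃ L : Finset (ZMod p), L.card ≤ n ∧ ∀ (v : ZMod p) (η η' : ℝ), 0 ≤ η → 0 ≤ η' →
      (∀ x ∈ L, ‖ch x v - 1‖ ≤ η) → (∀ ν, 1 / 2 < ‖mh S' id ν‖ → ‖ch ν v - 1‖ ≤ η') →
      ∀ γ, 1 / 2 ≤ ‖mh T id γ‖ → ‖ch γ v - 1‖ ≤ η' + n * η := by
  classical
  let F : Finset (Finset (ZMod p)) := univ.filter fun L =>
    L.card ≤ n ∧ (∀ x ∈ L, 1 / 2 ≤ ‖mh T id x‖) ∧ Diss S' L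
  have hF : F.Nonempty := ⟨∅, by simp [F, Diss_empty]⟩
  obtain ⟨L, hLF, hmax⟩ := F.exists_max_image (fun L => L.card) hF
  simp only [F, mem_filter, mem_univ, true_and] at hLF hmax
  obtain ⟨hLn, hLs, hLd⟩ := hLF
  have hlt := chang T S Sp S' n hTS hT hS' M hM hSM hSp hshift hn L hLn hLs hLd
  refine ⟨L, hLn, ?_⟩
  intro v η η' hη hη' hv hν γ hγ
  have hn1 : (1 : ℝ) ≤ n := by exact_mod_cast (by omega : 1 ≤ n)
  by_cases hγL : γ ∈ L
  · have := hv γ hγL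
    nlinarith
  have hnd : ¬ Diss S' (insert γ L) := by
    intro hd
    have := hmax (insert γ L) ⟨by rw [card_insert_of_notMem hγL]; omega, by
      intro x hx
      rcases mem_insert.1 hx with rfl | h
      · exact hγ
      · exact hLs x h, hd⟩
    rw [card_insert_of_notMem hγL] at this
    omega
  unfold Diss at hnd
  push Not at hnd
  obtain ⟨ε, hε, hne, hbig⟩ := hnd
  have hεm := Fintype.mem_piFinset.1 hε
  have hεγ : ε γ ≠ 0 := by
    intro h0
    have : ε ∈ Fintype.piFinset (sg L) := by
      rw [Fintype.mem_piFinset]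
      intro x
      have hx := hεm x
      by_cases hxγ : x = γ
      · subst hxγ; rw [h0]; simp [sg, hγL]
      · by_cases hxL : x ∈ L <;> simpa [sg, hxγ, hxL] using hx
    have := hLd ε this hne
    linarith
  have hεγ' : ε γ = 1 ∨ ε γ = -1 := by
    have := hεm γ
    simp [sg] at this
    tauto
  set w := ∑ x ∈ L, ε x • x with hw
  have hsplit : ∑ x, ε x • x = ε γ • γ + w := by
    rw [hw, ← sum_insert hγL (f := fun x => ε x • x)]
    symm
    apply sum_subset (subset_univ _)
    intro x _ hx
    have := hεm x
    simp [sg, hx] at this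
    simp [this]
  have hwb : ‖ch w v - 1‖ ≤ n * η := by
    calc ‖ch w v - 1‖ ≤ ∑ x ∈ L, ‖ch (ε x • x) v - 1‖ := norm_ch_sum_left _ _ _
      _ ≤ ∑ x ∈ L, η := by
          apply sum_le_sum
          intro x hx
          refine (norm_ch_smul _ ?_ _ _).trans (hv x hx)
          have := hεm x
          simpa [sg, hx] using this
      _ = L.card * η := by simp
      _ ≤ n * η := by gcongr
  have hb := hν _ hbig
  rw [hsplit] at hb
  have key : ‖ch (ε γ • γ) v - 1‖ ≤ η' + n * η := by
    have : ε γ • γ = (ε γ • γ + w) + (-w) := by ring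
    rw [this]
    refine (norm_ch_add_left _ _ _).trans ?_
    rw [norm_ch_neg_left]
    exact add_le_add hb hwb
  rcases hεγ' with h | h <;> rw [h] at key
  · simpa using key
  · rw [neg_one_smul, norm_ch_neg_left] at key; exact key

lemma spec_shift (S' S'' : Finset (ZMod p)) (hS' : S'.Nonempty) (s : ℝ) (v : ZMod p)
    (hsub : S' ⊆ S'') (hsv : ∀ x ∈ S', x + v ∈ S'')
    (hc : (S''.card : ℝ) ≤ (1 + s) * S'.card) (ν : ZMod p) (hν : 1 / 2 < ‖mh S' id ν‖) :
    ‖ch ν v - 1‖ ≤ 4 * s := by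
  classical
  have hSc : (0 : ℝ) < S'.card := by exact_mod_cast card_pos.2 hS'
  have hd1 : ∀ X ⊆ S'', X.card = S'.card → ‖∑ x ∈ S'', ch ν x - ∑ x ∈ X, ch ν x‖ ≤ s * S'.card := by
    intro X hX hXc
    rw [← sum_sdiff hX, add_sub_cancel_right]
    refine (norm_sum_le _ _).trans ?_
    simp only [norm_ch, sum_const, nsmul_eq_mul, mul_one]
    rw [card_sdiff_of_subset hX, Nat.cast_sub (card_le_card hX), hXc]
    linarith
  have h1 := hd1 S' hsub rfl
  have hinj : Set.InjOn (fun x => x + v) (S' : Set (ZMod p)) := by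
    intro x _ y _ h; simpa using h
  have h2 := hd1 (S'.image fun x => x + v) (by
    intro x hx
    obtain ⟨y, hy, rfl⟩ := mem_image.1 hx
    exact hsv y hy) (card_image_of_injOn hinj)
  rw [sum_image hinj] at h2
  have h3 : ‖∑ x ∈ S', ch ν (x + v) - ∑ x ∈ S', ch ν x‖ ≤ 2 * s * S'.card := by
    calc _ = ‖(∑ x ∈ S'', ch ν x - ∑ x ∈ S', ch ν x)
          - (∑ x ∈ S'', ch ν x - ∑ x ∈ S', ch ν (x + v))‖ := by congr 1; ring
      _ ≤ _ := norm_sub_le _ _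
      _ ≤ _ := by linarith
  have h4 : ∑ x ∈ S', ch ν (x + v) - ∑ x ∈ S', ch ν x = (∑ x ∈ S', ch ν x) * (ch ν v - 1) := by
    simp_rw [ch_add]
    rw [← sum_mul]; ring
  rw [h4, norm_mul] at h3
  have h5 : S'.card * (1 / 2 : ℝ) < ‖∑ x ∈ S', ch ν x‖ := by
    rw [mh, norm_div] at hν
    simp only [Complex.norm_natCast] at hν
    rw [lt_div_iff₀ hSc] at hν
    simp only [id] at hν
    linarith
  have h6 : S'.card * (1 / 2 : ℝ) * ‖ch ν v - 1‖ ≤ 2 * s * S'.card := by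
    refine le_trans ?_ h3
    gcongr
  have h7 : S'.card * ((1 / 2 : ℝ) * ‖ch ν v - 1‖) ≤ S'.card * (2 * s) := by linarith
  have := le_of_mul_le_mul_left h7 hSc
  linarith

end
end RothAP


namespace RothAP
open Finset

section
variable {p : ℕ} [Fact p.Prime]

noncomputable def ft (g : ZMod p → ℝ) (r : ZMod p) : ℂ := ∑ z, (g z : ℂ) * ch r z

lemma ft_av {ι : Type*} (I : Finset ι) (τ : ι → ZMod p) (g : ZMod p → ℝ) (r : ZMod p) :
    ft (av I τ g) r = mh I τ r * ft g r := by
  simp only [ft, av, mh]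
  push_cast
  have h : ∀ i, ∑ z, (g (z - τ i) : ℂ) * ch r z = ch r (τ i) * ∑ z, (g z : ℂ) * ch r z := by
    intro i
    rw [← Equiv.sum_comp (Equiv.addRight (τ i)), mul_sum]
    apply sum_congr rfl
    intro z _
    simp [ch_add]; ring
  calc ∑ z, (∑ i ∈ I, (g (z - τ i) : ℂ)) / (I.card : ℂ) * ch r z
      = (∑ z, ∑ i ∈ I, (g (z - τ i) : ℂ) * ch r z) / I.card := by
        rw [sum_div]; apply sum_congr rfl; intro z _; rw [← sum_mul]; ring
    _ = _ := by
        rw [sum_comm, sum_congr rfl fun i _ => h i, ← sum_mul]; ring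

lemma ft_sub (g h : ZMod p → ℝ) (r : ZMod p) : ft (g - h) r = ft g r - ft h r := by
  simp [ft, sub_mul, sum_sub_distrib]

lemma parseval (g : ZMod p → ℝ) : ∑ r, ‖ft g r‖ ^ 2 = p * ∑ z, g z ^ 2 := by
  have h1 : ∀ r, ((‖ft g r‖ ^ 2 : ℝ) : ℂ) = ∑ z, ∑ w, (g z : ℂ) * g w * ch (z - w) r := by
    intro r
    have h2 := Complex.mul_conj (ft g r)
    rw [Complex.normSq_eq_norm_sq] at h2
    rw [← h2, ft, map_sum, sum_mul_sum]
    apply sum_congr rfl; intro z _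
    apply sum_congr rfl; intro w _
    rw [map_mul, Complex.conj_ofReal, sub_eq_add_neg, ch_add_left, ch_neg_left, ch_comm z, ch_comm w]
    ring
  have h3 : ((∑ r, ‖ft g r‖ ^ 2 : ℝ) : ℂ) = ((p * ∑ z, g z ^ 2 : ℝ) : ℂ) := by
    rw [Complex.ofReal_sum, sum_congr rfl fun r _ => h1 r, sum_comm]
    push_cast
    rw [mul_sum]
    apply sum_congr rfl; intro z _
    rw [sum_comm]
    simp_rw [← mul_sum, sum_ch, sub_eq_zero]
    simp
    ring
  exact_mod_cast h3

lemma mult_bound (F g : ZMod p → ℝ) (c : ZMod p → ℂ) (η : ℝ) (h : ∀ r, ft F r = c r * ft g r)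
    (hc : ∀ r, ‖c r‖ ≤ η) : ∑ z, F z ^ 2 ≤ η ^ 2 * ∑ z, g z ^ 2 := by
  have hp : (0 : ℝ) < p := by exact_mod_cast (Fact.out : p.Prime).pos
  have h1 := parseval F
  have h2 := parseval g
  have h3 : ∑ r, ‖ft F r‖ ^ 2 ≤ η ^ 2 * ∑ r, ‖ft g r‖ ^ 2 := by
    rw [mul_sum]
    apply sum_le_sum
    intro r _
    rw [h, norm_mul, mul_pow]
    have := hc r
    gcongr
  rw [h1, h2] at h3
  have : (p : ℝ) * ∑ z, F z ^ 2 ≤ p * (η ^ 2 * ∑ z, g z ^ 2) := by linarith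
  exact le_of_mul_le_mul_left this hp

lemma av_sub {ι : Type*} (I : Finset ι) (τ : ι → ZMod p) (g h : ZMod p → ℝ) :
    av I τ (g - h) = av I τ g - av I τ h := by
  funext z; simp [av, sum_sub_distrib, sub_div]

lemma av_comm {ι κ : Type*} (I : Finset ι) (τ : ι → ZMod p) (J : Finset κ) (σ : κ → ZMod p)
    (g : ZMod p → ℝ) : av I τ (av J σ g) = av J σ (av I τ g) := by
  funext z
  simp only [av, ← sum_div]
  rw [sum_comm, div_right_comm]
  congr 2
  apply sum_congr rfl; intro j _
  apply sum_congr rfl; intro i _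
  congr 1; ring

lemma av_le {ι : Type*} (I : Finset ι) (hI : I.Nonempty) (τ : ι → ZMod p) (g : ZMod p → ℝ) (H : ℝ)
    (h : ∀ z, g z ≤ H) (z : ZMod p) : av I τ g z ≤ H := by
  have : (0 : ℝ) < I.card := by exact_mod_cast card_pos.2 hI
  rw [av, div_le_iff₀ this, mul_comm, ← nsmul_eq_mul]
  exact sum_le_card_nsmul _ _ _ fun i _ => h _

lemma av_nonneg {ι : Type*} (I : Finset ι) (τ : ι → ZMod p) (g : ZMod p → ℝ)
    (h : ∀ z, 0 ≤ g z) (z : ZMod p) : 0 ≤ av I τ g z :=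
  div_nonneg (sum_nonneg fun i _ => h _) (by positivity)

lemma av_sum {ι : Type*} (I : Finset ι) (hI : I.Nonempty) (τ : ι → ZMod p) (g : ZMod p → ℝ) :
    ∑ z, av I τ g z = ∑ z, g z := by
  have : (0 : ℝ) < I.card := by exact_mod_cast card_pos.2 hI
  simp only [av, ← sum_div]
  rw [sum_comm, div_eq_iff this.ne', mul_comm, ← nsmul_eq_mul, ← sum_const]
  apply sum_congr rfl; intro i _
  exact Equiv.sum_comp (Equiv.subRight (τ i)) g

lemma av_supp {ι : Type*} (I : Finset ι) (τ : ι → ZMod p) (g : ZMod p → ℝ) (Γ : Finset (ZMod p))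
    (R r : ℝ) (h : ∀ z, g z ≠ 0 → z ∈ Bohr Γ R) (hτ : ∀ i ∈ I, τ i ∈ Bohr Γ r) (z : ZMod p)
    (hz : av I τ g z ≠ 0) : z ∈ Bohr Γ (R + r) := by
  have h1 : ∑ i ∈ I, g (z - τ i) ≠ 0 := by
    intro h0; apply hz; simp [av, h0]
  obtain ⟨i, hi, hne⟩ := exists_ne_zero_of_sum_ne_zero h1
  have := add_mem_Bohr (h _ hne) (hτ i hi)
  simpa using this

noncomputable def lq (m : ℕ) (g : ZMod p → ℝ) : ℝ :=
  (∑ z, g z ^ (2 * m)) ^ (1 / ((2 * m : ℕ) : ℝ))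

lemma sum_even_nonneg (m : ℕ) (g : ZMod p → ℝ) : 0 ≤ ∑ z, g z ^ (2 * m) :=
  sum_nonneg fun z _ => by rw [pow_mul]; positivity

lemma lq_nonneg (m : ℕ) (g : ZMod p → ℝ) : 0 ≤ lq m g := Real.rpow_nonneg (sum_even_nonneg m g) _

lemma lq_pow (m : ℕ) (hm : 1 ≤ m) (g : ZMod p → ℝ) : lq m g ^ (2 * m) = ∑ z, g z ^ (2 * m) := by
  rw [lq, one_div, Real.rpow_inv_natCast_pow (sum_even_nonneg m g) (by omega)]

lemma lq_le (m : ℕ) (hm : 1 ≤ m) (g : ZMod p → ℝ) (X : ℝ) (hX : 0 ≤ X)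
    (h : ∑ z, g z ^ (2 * m) ≤ X ^ (2 * m)) : lq m g ≤ X := by
  rw [← lq_pow m hm] at h
  exact le_of_pow_le_pow_left₀ (by omega) hX h

lemma lq_add (m : ℕ) (hm : 1 ≤ m) (g h : ZMod p → ℝ) : lq m (g + h) ≤ lq m g + lq m h := by
  have h1 : (1 : ℝ) ≤ ((2 * m : ℕ) : ℝ) := by exact_mod_cast (by omega : 1 ≤ 2 * m)
  have := Real.Lp_add_le univ g h h1
  simp only [Real.rpow_natCast, Even.pow_abs (even_two_mul m)] at this
  exact this

lemma lq_neg (m : ℕ) (g : ZMod p → ℝ) : lq m (-g) = lq m g := by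
  simp only [lq, Pi.neg_apply, Even.neg_pow (even_two_mul m)]

lemma lq_av {ι : Type*} (I : Finset ι) (hI : I.Nonempty) (m : ℕ) (hm : 1 ≤ m) (G : ι → ZMod p → ℝ)
    (e : ℝ) (he : 0 ≤ e) (h : ∀ i ∈ I, ∑ z, G i z ^ (2 * m) ≤ e ^ (2 * m)) :
    lq m (fun z => (∑ i ∈ I, G i z) / I.card) ≤ e := by
  have hI0 : (0 : ℝ) < I.card := by exact_mod_cast card_pos.2 hI
  apply lq_le m hm _ _ he
  have hj : ∀ z, ((∑ i ∈ I, G i z) / I.card) ^ (2 * m) ≤ (∑ i ∈ I, G i z ^ (2 * m)) / I.card := by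
    intro z
    have := Real.pow_arith_mean_le_arith_mean_pow_of_even I (fun _ => (I.card : ℝ)⁻¹)
      (fun i => G i z) (fun _ _ => by positivity) (by simp [hI0.ne']) (even_two_mul m)
    rw [← mul_sum, ← mul_sum] at this
    rw [div_eq_inv_mul, div_eq_inv_mul]
    exact this
  calc ∑ z, ((∑ i ∈ I, G i z) / I.card) ^ (2 * m) ≤ ∑ z, (∑ i ∈ I, G i z ^ (2 * m)) / I.card :=
        sum_le_sum fun z _ => hj z
    _ = (∑ i ∈ I, ∑ z, G i z ^ (2 * m)) / I.card := by rw [← sum_div, sum_comm]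
    _ ≤ (∑ i ∈ I, e ^ (2 * m)) / I.card := by
        apply div_le_div_of_nonneg_right (sum_le_sum h) hI0.le
    _ = e ^ (2 * m) := by simp; field_simp

lemma lq_contr {ι : Type*} (I : Finset ι) (hI : I.Nonempty) (τ : ι → ZMod p) (m : ℕ) (hm : 1 ≤ m)
    (g : ZMod p → ℝ) : lq m (av I τ g) ≤ lq m g := by
  apply lq_av I hI m hm (fun i z => g (z - τ i)) _ (lq_nonneg m g)
  intro i _
  rw [lq_pow m hm]
  exact (Equiv.sum_comp (Equiv.subRight (τ i)) (fun z => g z ^ (2 * m))).le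

noncomputable def Sm (T : Finset (ZMod p)) : (ZMod p → ℝ) → (ZMod p → ℝ) :=
  av (T ×ˢ T) (fun q => q.1 - q.2)

lemma norm_mh_Sm (T : Finset (ZMod p)) (r : ZMod p) :
    ‖mh (T ×ˢ T) (fun q => q.1 - q.2) r‖ = ‖mh T id r‖ ^ 2 := by
  have : mh (T ×ˢ T) (fun q => q.1 - q.2) r = mh T id r * (starRingEnd ℂ) (mh T id r) := by
    simp only [mh, sum_product, sub_eq_add_neg, ch_add, ch_neg, ← mul_sum, ← sum_mul, card_product,
      map_div₀, map_sum, id]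
    push_cast
    rw [mul_div_mul_comm]; simp
  rw [this, norm_mul, RCLike.norm_conj, sq]

lemma smooth_close (T : Finset (ZMod p)) (hT : T.Nonempty) (m : ℕ) (hm : 1 ≤ m) (f : ZMod p → ℝ)
    (e : ℝ) (he : 0 ≤ e)
    (h : ∀ t ∈ T, ∀ t' ∈ T, ∑ z, (f (z - t) - f (z - t')) ^ (2 * m) ≤ e ^ (2 * m)) (l : ℕ) :
    lq m (f - (Sm T)^[l] f) ≤ l * e := by
  have hTT : (T ×ˢ T).Nonempty := hT.product hT
  have hTc : ((T ×ˢ T).card : ℝ) ≠ 0 := by exact_mod_cast (card_pos.2 hTT).ne'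
  have h1 : lq m (f - Sm T f) ≤ e := by
    have e1 : f - Sm T f = fun z => (∑ q ∈ T ×ˢ T, (f z - f (z - (q.1 - q.2)))) / (T ×ˢ T).card := by
      funext z
      rw [sum_sub_distrib, sub_div, sum_const, nsmul_eq_mul, mul_div_cancel_left₀ _ hTc]
      rfl
    rw [e1]
    apply lq_av (T ×ˢ T) hTT m hm (fun q z => f z - f (z - (q.1 - q.2))) e he
    intro q hq
    rw [mem_product] at hq
    refine le_trans (le_of_eq ?_) (h q.2 hq.2 q.1 hq.1)
    rw [← Equiv.sum_comp (Equiv.subRight q.2)]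
    apply sum_congr rfl; intro z _
    simp
  have h2 : ∀ l, lq m ((Sm T)^[l] (f - Sm T f)) ≤ e := by
    intro l
    induction l with
    | zero => exact h1
    | succ l ih =>
      rw [Function.iterate_succ_apply']
      exact (lq_contr _ hTT _ m hm _).trans ih
  have h3 : ∀ l (g g' : ZMod p → ℝ), (Sm T)^[l] (g - g') = (Sm T)^[l] g - (Sm T)^[l] g' := by
    intro l
    induction l with
    | zero => intro g g'; rfl
    | succ l ih =>
      intro g g'
      rw [Function.iterate_succ_apply', ih, Function.iterate_succ_apply', Function.iterate_succ_apply']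
      exact av_sub _ _ _ _
  induction l with
  | zero =>
    simp only [Function.iterate_zero, id, sub_self, Nat.cast_zero, zero_mul]
    apply lq_le m hm _ _ le_rfl
    simp [show 2 * m ≠ 0 by omega]
  | succ l ih =>
    have : f - (Sm T)^[l + 1] f = (f - (Sm T)^[l] f) + (Sm T)^[l] (f - Sm T f) := by
      rw [h3, ← Function.iterate_succ_apply]; abel
    rw [this]
    refine (lq_add m hm _ _).trans ?_
    push_cast
    linarith [h2 l]

lemma ft_iter (T : Finset (ZMod p)) (l : ℕ) (g : ZMod p → ℝ) (r : ZMod p) :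
    ft ((Sm T)^[l] g) r = mh (T ×ˢ T) (fun q => q.1 - q.2) r ^ l * ft g r := by
  induction l with
  | zero => simp
  | succ l ih =>
    rw [Function.iterate_succ_apply', Sm, ft_av, ← Sm, ih, pow_succ]; ring

lemma iter_comm {ι : Type*} (I : Finset ι) (τ : ι → ZMod p) (T : Finset (ZMod p)) (l : ℕ)
    (g : ZMod p → ℝ) : av I τ ((Sm T)^[l] g) = (Sm T)^[l] (av I τ g) := by
  induction l with
  | zero => rfl
  | succ l ih =>
    rw [Function.iterate_succ_apply', Function.iterate_succ_apply', ← ih]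
    exact av_comm _ _ _ _ _

lemma iter_le (T : Finset (ZMod p)) (hT : T.Nonempty) (l : ℕ) (g : ZMod p → ℝ) (H : ℝ)
    (h : ∀ z, g z ≤ H) : ∀ z, (Sm T)^[l] g z ≤ H := by
  induction l with
  | zero => exact h
  | succ l ih =>
    intro z
    rw [Function.iterate_succ_apply']
    exact av_le _ (hT.product hT) _ _ _ ih z

lemma iter_nonneg (T : Finset (ZMod p)) (l : ℕ) (g : ZMod p → ℝ)
    (h : ∀ z, 0 ≤ g z) : ∀ z, 0 ≤ (Sm T)^[l] g z := by
  induction l with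
  | zero => exact h
  | succ l ih =>
    intro z
    rw [Function.iterate_succ_apply']
    exact av_nonneg _ _ _ ih z

lemma iter_sum (T : Finset (ZMod p)) (hT : T.Nonempty) (l : ℕ) (g : ZMod p → ℝ) :
    ∑ z, (Sm T)^[l] g z = ∑ z, g z := by
  induction l with
  | zero => rfl
  | succ l ih =>
    rw [Function.iterate_succ_apply', Sm, av_sum _ (hT.product hT), ← Sm, ih]

lemma iter_supp (T : Finset (ZMod p)) (Γ : Finset (ZMod p)) (r : ℝ) (hT : ∀ t ∈ T, t ∈ Bohr Γ r)
    (l : ℕ) (g : ZMod p → ℝ) (R : ℝ) (h : ∀ z, g z ≠ 0 → z ∈ Bohr Γ R) :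
    ∀ z, (Sm T)^[l] g z ≠ 0 → z ∈ Bohr Γ (R + l * (2 * r)) := by
  induction l with
  | zero => intro z hz; simpa using h z hz
  | succ l ih =>
    intro z hz
    rw [Function.iterate_succ_apply'] at hz
    have := av_supp _ _ _ Γ _ (r + r) ih (by
      intro q hq
      rw [mem_product] at hq
      exact sub_mem_Bohr (hT _ hq.1) (hT _ hq.2)) z hz
    convert this using 2
    push_cast; ring

lemma av_adj (V : Finset (ZMod p)) (hV : ∀ v ∈ V, -v ∈ V) (g h : ZMod p → ℝ) :
    ∑ z, av V id g z * h z = ∑ z, g z * av V id h z := by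
  simp only [av, id]
  have e1 : ∑ z, (∑ i ∈ V, g (z - i)) / (V.card : ℝ) * h z
      = (∑ i ∈ V, ∑ z, g (z - i) * h z) / V.card := by
    rw [sum_comm, sum_div]; apply sum_congr rfl; intro z _; rw [← sum_mul]; ring
  have e2 : ∑ z, g z * ((∑ i ∈ V, h (z - i)) / (V.card : ℝ))
      = (∑ i ∈ V, ∑ z, g z * h (z - i)) / V.card := by
    rw [sum_comm, sum_div]; apply sum_congr rfl; intro z _; rw [← mul_sum]; ring
  rw [e1, e2]
  congr 1
  refine sum_bij' (fun i _ => -i) (fun i _ => -i) (fun i hi => hV i hi) (fun i hi => hV i hi)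
    (by simp) (by simp) ?_
  intro i _
  rw [← Equiv.sum_comp (Equiv.addRight i)]
  apply sum_congr rfl; intro z _
  simp

end
end RothAP


namespace RothAP
open Finset

section
variable {p : ℕ} [Fact p.Prime]

noncomputable def ind (A : Finset (ZMod p)) (z : ZMod p) : ℝ := if z ∈ A then 1 else 0
noncomputable def indm (A : Finset (ZMod p)) (z : ZMod p) : ℝ := if -z ∈ A then 1 else 0

lemma indm_sum (A : Finset (ZMod p)) : ∑ z, indm A z = A.card := by
  rw [← Equiv.sum_comp (Equiv.neg (ZMod p))]
  simp [indm]

lemma ind_sum (A : Finset (ZMod p)) : ∑ z, ind A z = A.card := by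
  simp [ind]

lemma indm_nonneg (A : Finset (ZMod p)) (z : ZMod p) : 0 ≤ indm A z := by
  unfold indm; split_ifs <;> norm_num

lemma indm_le (A : Finset (ZMod p)) (z : ZMod p) : indm A z ≤ 1 := by
  unfold indm; split_ifs <;> norm_num

set_option maxHeartbeats 1000000 in
lemma core (A D T V W : Finset (ZMod p)) (hD : D.Nonempty) (hT : T.Nonempty) (hV : V.Nonempty)
    (hVs : ∀ v ∈ V, -v ∈ V) (m l : ℕ) (hm : 1 ≤ m) (α e s b b0 B : ℝ) (hα : 0 < α)
    (hα1 : α ≤ 1) (he : 0 ≤ e) (hB : 0 ≤ B) (hBb : B ^ (2 * m) = b)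
    (hT2 : ∀ t ∈ T, ∀ t' ∈ T, ∑ z, (av D id (indm A) (z - t) - av D id (indm A) (z - t')) ^ (2 * m)
      ≤ e ^ (2 * m))
    (hle : l * e ≤ 1 / 100 * (α * B + lq m (av D id (indm A))))
    (hspec : ∀ γ, 1 / 2 ≤ ‖mh T id γ‖ → ‖1 - mh V id γ‖ ≤ s)
    (hs : 2 * s ≤ (1 / 100 * α) ^ m) (hl : 2 * (1 / 4 : ℝ) ^ l ≤ (1 / 100 * α) ^ m)
    (hH1 : ∀ z, av V id (indm A) z ≤ 101 / 100 * α)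
    (hH2 : ∀ z, av V id (ind A) z ≤ 101 / 100 * α)
    (hA1 : (A.card : ℝ) ≤ 101 / 100 * α * b0) (hA2 : 97 / 100 * α * b0 ≤ A.card)
    (hAb : (A.card : ℝ) ≤ b0) (hb0 : 0 < b0) (hb1 : b0 ≤ b) (hb2 : b ≤ 101 / 100 * b0) (hWc : (W.card : ℝ) ≤ 101 / 100 * b0)
    (hW1 : ∀ z, av V id (ind A) z ≠ 0 → z ∈ W)
    (hW2 : ∀ z, av V id ((Sm T)^[l] (av D id (indm A))) z ≠ 0 → z ∈ W)
    (hm2 : 2 / α ≤ 2 ^ m) :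
    4 / 5 * α * A.card ≤ ∑ z ∈ A, av D id (indm A) z := by
  classical
  have hAc : (0 : ℝ) < A.card := lt_of_lt_of_le (by positivity) hA2
  set f := av D id (indm A) with hf
  set H := 101 / 100 * α with hH
  have hHpos : 0 < H := by positivity
  have hf0 : ∀ z, 0 ≤ f z := av_nonneg _ _ _ (indm_nonneg A)
  have hf1 : ∀ z, f z ≤ 1 := av_le _ hD _ _ _ (indm_le A)
  have hfs : ∑ z, f z = A.card := by rw [hf, av_sum _ hD, indm_sum]
  set G := (Sm T)^[l] f with hG
  have hG0 : ∀ z, 0 ≤ G z := iter_nonneg T l f hf0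
  have hG1 : ∀ z, G z ≤ 1 := iter_le T hT l f 1 hf1
  set P := av V id G with hP
  have hP' : P = (Sm T)^[l] (av D id (av V id (indm A))) := by
    rw [hP, hG, iter_comm, hf, av_comm]
  have hP0 : ∀ z, 0 ≤ P z := av_nonneg _ _ _ hG0
  have hPH : ∀ z, P z ≤ H := by
    rw [hP']
    exact iter_le T hT l _ H (av_le _ hD _ _ _ hH1)
  have hPs : ∑ z, P z = A.card := by
    rw [hP, av_sum _ hV, hG, iter_sum T hT, hfs]
  set F := av V id P with hF
  have hF0 : ∀ z, 0 ≤ F z := av_nonneg _ _ _ hP0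
  have hFH : ∀ z, F z ≤ H := av_le _ hV _ _ _ hPH
  have hF1 : ∀ z, F z ≤ 1 := av_le _ hV _ _ _ (av_le _ hV _ _ _ hG1)
  have hFs : ∑ z, F z = A.card := by rw [hF, av_sum _ hV, hPs]
  -- smoothing error
  have n1 : lq m (f - G) ≤ 1 / 100 * (α * B + lq m f) := by
    refine (smooth_close T hT m hm f e he hT2 l).trans hle
  -- fourier error
  set η := (1 / 100 * α) ^ m with hη
  have n2 : lq m (G - F) ≤ 1 / 100 * α * B := by
    apply lq_le m hm _ _ (by positivity)
    have h1 : ∑ z, (G - F) z ^ 2 ≤ η ^ 2 * ∑ z, f z ^ 2 := by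
      apply mult_bound (G - F) f
        (fun r => mh (T ×ˢ T) (fun q => q.1 - q.2) r ^ l * (1 - mh V id r ^ 2)) η
      · intro r
        rw [ft_sub, hF, ft_av, hP, ft_av, hG, ft_iter]; ring
      · intro r
        rw [norm_mul, norm_pow, norm_mh_Sm]
        have hv := norm_mh_le V id r
        by_cases hr : 1 / 2 ≤ ‖mh T id r‖
        · have h2 := hspec r hr
          have h3 : ‖mh T id r‖ ≤ 1 := norm_mh_le _ _ _
          have h4 : (‖mh T id r‖ ^ 2) ^ l ≤ 1 := pow_le_one₀ (by positivity) (pow_le_one₀ (by positivity) h3)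
          have h5 : ‖1 - mh V id r ^ 2‖ ≤ 2 * s := by
            have : 1 - mh V id r ^ 2 = (1 - mh V id r) * (1 + mh V id r) := by ring
            rw [this, norm_mul]
            have h6 : ‖1 + mh V id r‖ ≤ 2 := by
              refine (norm_add_le _ _).trans ?_
              rw [norm_one]; linarith
            nlinarith [norm_nonneg (1 - mh V id r), norm_nonneg (1 + mh V id r)]
          calc _ ≤ 1 * ‖1 - mh V id r ^ 2‖ := by gcongr
            _ ≤ _ := by linarith
        · push Not at hr
          have h4 : (‖mh T id r‖ ^ 2) ^ l ≤ (1 / 4) ^ l := by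
            gcongr
            nlinarith [norm_nonneg (mh T id r)]
          have h5 : ‖1 - mh V id r ^ 2‖ ≤ 2 := by
            refine (norm_sub_le _ _).trans ?_
            rw [norm_one, norm_pow]
            have : ‖mh V id r‖ ^ 2 ≤ 1 := pow_le_one₀ (norm_nonneg _) hv
            linarith
          calc (‖mh T id r‖ ^ 2) ^ l * ‖1 - mh V id r ^ 2‖ ≤ (1 / 4) ^ l * 2 := by gcongr
            _ ≤ η := by linarith
    have h7 : ∑ z, f z ^ 2 ≤ A.card := by
      rw [← hfs]; apply sum_le_sum; intro z _; nlinarith [hf0 z, hf1 z]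
    have h8 : ∑ z, (G - F) z ^ (2 * m) ≤ ∑ z, (G - F) z ^ 2 := by
      apply sum_le_sum
      intro z _
      rw [pow_mul]
      have h9 : (G - F) z ^ 2 ≤ 1 := by
        have a1 : (G - F) z = G z - F z := rfl
        rw [a1]
        nlinarith [hG0 z, hG1 z, hF0 z, hF1 z]
      exact pow_le_of_le_one (sq_nonneg _) h9 (by omega)
    have h10 : (A.card : ℝ) ≤ b := hAb.trans hb1
    calc _ ≤ _ := h8
      _ ≤ _ := h1
      _ ≤ η ^ 2 * b := by gcongr; linarith
      _ = (1 / 100 * α * B) ^ (2 * m) := by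
        rw [hη, mul_pow _ B, hBb, ← pow_mul, mul_comm m 2]
  have n3 : lq m F ≤ H * B := by
    apply lq_le m hm _ _ (by positivity)
    have h1 : ∀ z, F z ^ (2 * m) ≤ H ^ (2 * m - 1) * F z := by
      intro z
      obtain ⟨j, hj⟩ : ∃ j, 2 * m = j + 1 := ⟨2 * m - 1, by omega⟩
      rw [hj, Nat.add_sub_cancel, pow_succ]
      have := hF0 z
      have := hFH z
      gcongr
    calc _ ≤ ∑ z, H ^ (2 * m - 1) * F z := sum_le_sum fun z _ => h1 z
      _ = H ^ (2 * m - 1) * A.card := by rw [← mul_sum, hFs]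
      _ ≤ H ^ (2 * m - 1) * (H * b) := by
          gcongr
          exact hA1.trans (by gcongr)
      _ = (H * B) ^ (2 * m) := by
          rw [mul_pow H B, hBb]
          obtain ⟨j, hj⟩ : ∃ j, 2 * m = j + 1 := ⟨2 * m - 1, by omega⟩
          rw [hj, Nat.add_sub_cancel, pow_succ]; ring
  have n4 : lq m f ≤ lq m F + lq m (G - F) + lq m (f - G) := by
    have : f = (F + (G - F)) + (f - G) := by abel
    calc lq m f = lq m ((F + (G - F)) + (f - G)) := by rw [← this]
      _ ≤ lq m (F + (G - F)) + lq m (f - G) := lq_add m hm _ _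
      _ ≤ _ := by gcongr; exact lq_add m hm _ _
  have n5 : lq m (f - F) ≤ 4 / 100 * α * B := by
    have : f - F = (G - F) + (f - G) := by abel
    have h1 : lq m (f - F) ≤ lq m (G - F) + lq m (f - G) := by rw [this]; exact lq_add m hm _ _
    have h2 : 0 ≤ α * B := by positivity
    rw [hH] at n3
    linarith
  -- Hölder
  have n6 : |∑ z ∈ A, (f - F) z| ≤ 6 / 100 * α * A.card := by
    apply le_of_pow_le_pow_left₀ (n := 2 * m) (by omega) (by positivity)
    have h1 : (∑ z ∈ A, |(f - F) z|) ^ (2 * m) ≤ (A.card : ℝ) ^ (2 * m - 1) * ∑ z ∈ A, |(f - F) z| ^ (2 * m) := by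
      obtain ⟨j, hj⟩ : ∃ j, 2 * m = j + 1 := ⟨2 * m - 1, by omega⟩
      rw [hj, Nat.add_sub_cancel]
      exact pow_sum_le_card_mul_sum_pow (fun z _ => abs_nonneg _) j
    have h2 : ∑ z ∈ A, |(f - F) z| ^ (2 * m) ≤ (4 / 100 * α) ^ (2 * m) * b := by
      calc _ = ∑ z ∈ A, (f - F) z ^ (2 * m) := by simp_rw [Even.pow_abs (even_two_mul m)]
        _ ≤ ∑ z, (f - F) z ^ (2 * m) := by
          apply sum_le_sum_of_subset_of_nonneg (subset_univ _)
          intro z _ _; rw [pow_mul]; positivity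
        _ = lq m (f - F) ^ (2 * m) := (lq_pow m hm _).symm
        _ ≤ (4 / 100 * α * B) ^ (2 * m) := by
          gcongr
          exact lq_nonneg _ _
        _ = _ := by rw [mul_pow _ B, hBb]
    have h3 : b ≤ 2 ^ m * A.card := by
      calc b ≤ 2 / α * A.card := by
            rw [div_mul_eq_mul_div, le_div_iff₀ hα]
            nlinarith [mul_pos hα hb0]
        _ ≤ _ := by gcongr
    calc |∑ z ∈ A, (f - F) z| ^ (2 * m) ≤ (∑ z ∈ A, |(f - F) z|) ^ (2 * m) := by
          gcongr; exact abs_sum_le_sum_abs _ _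
      _ ≤ _ := h1
      _ ≤ (A.card : ℝ) ^ (2 * m - 1) * ((4 / 100 * α) ^ (2 * m) * (2 ^ m * A.card)) := by
          gcongr
          refine h2.trans ?_
          gcongr
      _ = (4 / 100 * α) ^ (2 * m) * 2 ^ m * (A.card : ℝ) ^ (2 * m) := by
          obtain ⟨j, hj⟩ : ∃ j, 2 * m = j + 1 := ⟨2 * m - 1, by omega⟩
          rw [hj, Nat.add_sub_cancel, pow_succ (A.card : ℝ)]; ring
      _ ≤ (4 / 100 * α) ^ (2 * m) * (3 / 2) ^ (2 * m) * (A.card : ℝ) ^ (2 * m) := by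
          gcongr
          rw [pow_mul]
          gcongr
          norm_num
      _ = (6 / 100 * α * A.card) ^ (2 * m) := by
          rw [← mul_pow, ← mul_pow]; congr 1; ring
  -- main term
  set h := av V id (ind A) with hh
  have hhs : ∑ z, h z = A.card := by rw [hh, av_sum _ hV, ind_sum]
  have n7 : ∑ z ∈ A, F z = ∑ z, P z * h z := by
    rw [← av_adj V hVs]
    simp only [ind, mul_ite, mul_one, mul_zero, sum_ite_mem, univ_inter]
    rfl
  have n8 : 0 ≤ ∑ z, (H - P z) * (H * ind W z - h z) := by
    apply sum_nonneg
    intro z _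
    apply mul_nonneg (by linarith [hPH z])
    unfold ind
    split_ifs with hz
    · linarith [hH2 z]
    · have : h z = 0 := by by_contra hne; exact hz (hW1 z hne)
      rw [this]; simp
  have n9 : ∑ z, P z * ind W z = A.card := by
    rw [← hPs]
    apply sum_congr rfl
    intro z _
    unfold ind
    split_ifs with hz
    · simp
    · have : P z = 0 := by by_contra hne; exact hz (hW2 z hne)
      rw [this]; simp
  have n10 : ∑ z, (H - P z) * (H * ind W z - h z)
      = H ^ 2 * W.card - H * A.card - H * A.card + ∑ z, P z * h z := by
    have : ∀ z, (H - P z) * (H * ind W z - h z)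
      = H ^ 2 * ind W z - H * h z - H * (P z * ind W z) + P z * h z := by intro z; ring
    simp_rw [this]
    rw [sum_add_distrib, sum_sub_distrib, sum_sub_distrib, ← mul_sum, ← mul_sum, ← mul_sum, n9, hhs,
      ind_sum]
  have n11 : H ^ 2 * W.card ≤ H * (1.06 * A.card) := by
    rw [sq, mul_assoc]
    apply mul_le_mul_of_nonneg_left _ hHpos.le
    calc H * W.card ≤ H * (101 / 100 * b0) := by gcongr
      _ ≤ 1.06 * A.card := by rw [hH]; nlinarith [mul_pos hα hb0]
  have n12 : 0.94 * H * A.card ≤ ∑ z ∈ A, F z := by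
    rw [n7]; rw [n10] at n8; linarith
  have n13 := (abs_le.1 n6).1
  have n14 : ∑ z ∈ A, (f - F) z = ∑ z ∈ A, f z - ∑ z ∈ A, F z := by
    rw [← sum_sub_distrib]; rfl
  rw [n14] at n13
  rw [hH] at n12
  have : 0 < α * A.card := by positivity
  linarith

end
end RothAP


namespace RothAP
open Finset

section
variable {p : ℕ} [Fact p.Prime]

lemma almost_periods (A D S DS W : Finset (ZMod p)) (hD : D.Nonempty) (hS : S.Nonempty)
    (hDS : ∀ d ∈ D, ∀ s ∈ S, d + s ∈ DS) (K : ℝ) (hK : (DS.card : ℝ) ≤ K * D.card) (k m : ℕ)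
    (hk : 1 ≤ k) (hm : 1 ≤ m) (α c1 B : ℝ) (hα : 0 < α) (hc1 : 0 < c1) (hc11 : c1 ≤ 1)
    (hkm : (m : ℝ) / k ≤ c1 ^ 2 * α) (hB : 0 ≤ B) (hBb : B ^ (2 * m) = W.card)
    (hW : ∀ z, av D id (indm A) z ≠ 0 → z ∈ W) :
    ∃ T ⊆ S, (S.card : ℝ) ≤ 2 * K ^ k * T.card ∧ ∀ t ∈ T, ∀ t' ∈ T,
      ∑ z, (av D id (indm A) (z - t) - av D id (indm A) (z - t')) ^ (2 * m)
        ≤ (20 * c1 * (α * B + lq m (av D id (indm A)))) ^ (2 * m) := by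
  classical
  have hDc : (0 : ℝ) < D.card := by exact_mod_cast card_pos.2 hD
  set f := av D id (indm A) with hf
  have hf0 : ∀ z, 0 ≤ f z := av_nonneg _ _ _ (indm_nonneg A)
  set Y := α * B + lq m f with hY
  have hY0 : 0 ≤ Y := by have := lq_nonneg m f; positivity
  have hg : ∑ z, (α * ind W z + f z) ^ (2 * m) ≤ Y ^ (2 * m) := by
    have h1 := lq_add m hm (fun z => α * ind W z) f
    have h2 : lq m (fun z => α * ind W z) ≤ α * B := by
      apply lq_le m hm _ _ (by positivity)
      rw [mul_pow, hBb, ← ind_sum, mul_sum]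
      apply sum_le_sum
      intro z _
      rw [mul_pow]
      unfold ind
      split_ifs
      · simp
      · simp [show m ≠ 0 by omega]
    have h3 : lq m ((fun z => α * ind W z) + f) ≤ Y := by linarith
    calc _ = ∑ z, ((fun z => α * ind W z) + f) z ^ (2 * m) := rfl
      _ = _ := (lq_pow m hm _).symm
      _ ≤ _ := by gcongr; exact lq_nonneg _ _
  have hpt : ∀ z, ∑ y ∈ Fintype.piFinset (fun _ : Fin k => D),
      ((∑ i, indm A (z - y i)) / k - f z) ^ (2 * m)
      ≤ (D.card : ℝ) ^ k * (5 * c1 * (α * ind W z + f z)) ^ (2 * m) := by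
    intro z
    by_cases hz : f z = 0
    · have h0 : ∀ y ∈ D, indm A (z - y) = 0 := by
        have h1 : ∑ y ∈ D, indm A (z - y) = 0 := by
          have : (∑ y ∈ D, indm A (z - id y)) / (D.card : ℝ) = 0 := hz
          rw [div_eq_zero_iff] at this
          rcases this with h | h
          · exact h
          · exact absurd h hDc.ne'
        exact (sum_eq_zero_iff_of_nonneg fun y _ => indm_nonneg A _).1 h1
      have h2 : ∑ y ∈ Fintype.piFinset (fun _ : Fin k => D),
          ((∑ i, indm A (z - y i)) / k - f z) ^ (2 * m) = 0 := by
        apply sum_eq_zero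
        intro y hy
        have hy' := Fintype.mem_piFinset.1 hy
        rw [sum_eq_zero fun i _ => h0 _ (hy' i), hz]
        simp [show m ≠ 0 by omega]
      rw [h2]
      rw [pow_mul]
      positivity
    · have hzW : ind W z = 1 := by simp [ind, hW z hz]
      have h3 := moment_bound D hD (fun y => indm A (z - y)) (fun y => indm_nonneg A _)
        (fun y => indm_le A _) k m hk hm (f z) rfl
      refine h3.trans ?_
      rw [pow_mul, hzW]
      have := hf0 z
      gcongr
      have hmk : (0 : ℝ) ≤ (m : ℝ) / k := by positivity
      have h5 : c1 ^ 2 * α ≤ α := by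
        have : c1 ^ 2 ≤ 1 := pow_le_one₀ hc1.le hc11
        nlinarith
      have h6 : 0 ≤ c1 ^ 2 * α := by positivity
      calc 22 * ((m : ℝ) / k) * (f z + m / k) ≤ 22 * (c1 ^ 2 * α) * (f z + α) := by
            gcongr; linarith
        _ ≤ 25 * c1 ^ 2 * ((α + f z) * (α + f z)) := by
            have : α * (f z + α) ≤ (α + f z) * (α + f z) := by nlinarith
            have h7 : 0 ≤ c1 ^ 2 := by positivity
            have h8 : 0 ≤ (α + f z) * (α + f z) := by positivity
            nlinarith [mul_le_mul_of_nonneg_left this h7, mul_nonneg h7 h8]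
        _ = _ := by ring
  have hE : ∑ z, ∑ y ∈ Fintype.piFinset (fun _ : Fin k => D),
      ((∑ i, indm A (z - y i)) / k - f z) ^ (2 * m) ≤ (D.card : ℝ) ^ k * (5 * c1 * Y) ^ (2 * m) := by
    calc _ ≤ ∑ z, (D.card : ℝ) ^ k * (5 * c1 * (α * ind W z + f z)) ^ (2 * m) :=
          sum_le_sum fun z _ => hpt z
      _ = (D.card : ℝ) ^ k * ((5 * c1) ^ (2 * m) * ∑ z, (α * ind W z + f z) ^ (2 * m)) := by
          rw [← mul_sum, mul_sum (a := (5 * c1) ^ (2 * m))]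
          congr 1
          apply sum_congr rfl; intro z _; rw [mul_pow]
      _ ≤ (D.card : ℝ) ^ k * ((5 * c1) ^ (2 * m) * Y ^ (2 * m)) := by gcongr
      _ = _ := by rw [← mul_pow]
  obtain ⟨T, hTS, hTc, hT⟩ := croot_sisask D S DS hD hS hDS K hK (indm A) f k m hm _ hE
  refine ⟨T, hTS, hTc, fun t ht t' ht' => (hT t ht t' ht').trans ?_⟩
  calc (2 : ℝ) ^ (2 * m + 1) * (5 * c1 * Y) ^ (2 * m) ≤ 4 ^ (2 * m) * (5 * c1 * Y) ^ (2 * m) := by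
        have : (2 : ℝ) ^ (2 * m + 1) ≤ 4 ^ (2 * m) := by
          rw [show (4 : ℝ) = 2 ^ 2 by norm_num, ← pow_mul]
          exact pow_le_pow_right₀ (by norm_num) (by omega)
        gcongr
    _ = _ := by rw [← mul_pow]; congr 1; ring

noncomputable def hfG (Γ : Finset (ZMod p)) : Finset (ZMod p) := Γ.image fun r => r * 2⁻¹

lemma two_ne (hp : Odd p) : (2 : ZMod p) ≠ 0 := by
  intro h
  have h1 : ((2 : ℕ) : ZMod p) = 0 := by exact_mod_cast h
  rw [ZMod.natCast_eq_zero_iff] at h1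
  have := (Nat.prime_dvd_prime_iff_eq (Fact.out : p.Prime) Nat.prime_two).1 h1
  subst this
  exact absurd hp (by decide)

lemma mem_Bohr_hf (Γ : Finset (ZMod p)) (ρ : ℝ) (x : ZMod p) :
    x ∈ Bohr (hfG Γ) ρ ↔ 2⁻¹ * x ∈ Bohr Γ ρ := by
  simp [mem_Bohr, hfG, ch_mul_half]

lemma card_Bohr_hf (hp : Odd p) (Γ : Finset (ZMod p)) (ρ : ℝ) :
    (Bohr (hfG Γ) ρ).card = (Bohr Γ ρ).card := by
  have h2 := two_ne hp
  apply card_bij' (fun x _ => 2⁻¹ * x) (fun x _ => 2 * x)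
  · intro x _; simp [h2]
  · intro x _; simp [h2]
  · intro x hx; exact (mem_Bohr_hf Γ ρ x).1 hx
  · intro x hx; rw [mem_Bohr_hf]; simpa [h2] using hx

lemma Bohr_hf_sub (hp : Odd p) (Γ : Finset (ZMod p)) (ρ : ℝ) : Bohr (hfG Γ) ρ ⊆ Bohr Γ (2 * ρ) := by
  intro x hx
  have h2 := two_ne hp
  rw [mem_Bohr_hf] at hx
  have := add_mem_Bohr hx hx
  have e : 2⁻¹ * x + 2⁻¹ * x = x := by field_simp; ring
  rw [e] at this
  rwa [two_mul]

lemma card_hf (Γ : Finset (ZMod p)) : (hfG Γ).card ≤ Γ.card := card_image_le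

noncomputable def cnt (A : Finset (ZMod p)) (x : ZMod p) (B : Finset (ZMod p)) : ℕ :=
  (B.filter fun y => x + y ∈ A).card

lemma cnt_avg (A B0 Bp B1 : Finset (ZMod p)) (x0 : ZMod p)
    (h : ∀ x ∈ B0, ∀ y ∈ B1, x - y ∈ Bp) :
    B1.card * cnt A x0 B0 ≤ ∑ x ∈ Bp, cnt A (x0 + x) B1 := by
  classical
  have h1 : ∑ x ∈ Bp, cnt A (x0 + x) B1 = ∑ y ∈ B1, (Bp.filter fun x => x0 + x + y ∈ A).card := by
    simp only [cnt, card_filter]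
    rw [sum_comm]
  rw [h1, ← smul_eq_mul, ← sum_const]
  apply sum_le_sum
  intro y hy
  apply card_le_card_of_injOn (fun x => x - y)
  · intro x hx
    have hx' := mem_filter.1 hx
    show x - y ∈ Bp.filter _
    rw [mem_filter]
    refine ⟨h x hx'.1 y hy, ?_⟩
    have : x0 + (x - y) + y = x0 + x := by ring
    rw [this]; exact hx'.2
  · intro x _ x' _ h; simpa using h

lemma exists_good_x (A B0 Bp B1 B2 : Finset (ZMod p)) (x0 : ZMod p) (α : ℝ)
    (h0 : B0.Nonempty) (hb1 : B1.Nonempty) (hb2 : B2.Nonempty)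
    (h1 : ∀ x ∈ B0, ∀ y ∈ B1, x - y ∈ Bp) (h2 : ∀ x ∈ B0, ∀ y ∈ B2, x - y ∈ Bp)
    (hc : (Bp.card : ℝ) ≤ 101 / 100 * B0.card) (hα : 0 < α) (hd : α * B0.card ≤ cnt A x0 B0)
    (u1 : ∀ x, (cnt A x B1 : ℝ) ≤ 101 / 100 * α * B1.card)
    (u2 : ∀ x, (cnt A x B2 : ℝ) ≤ 101 / 100 * α * B2.card) :
    ∃ x, 97 / 100 * α * B1.card ≤ cnt A x B1 ∧ 97 / 100 * α * B2.card ≤ cnt A x B2 := by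
  have c0 : (0 : ℝ) < B0.card := by exact_mod_cast card_pos.2 h0
  have c1 : (0 : ℝ) < B1.card := by exact_mod_cast card_pos.2 hb1
  have c2 : (0 : ℝ) < B2.card := by exact_mod_cast card_pos.2 hb2
  have a1 : (B1.card : ℝ) * cnt A x0 B0 ≤ ∑ x ∈ Bp, (cnt A (x0 + x) B1 : ℝ) := by
    exact_mod_cast cnt_avg A B0 Bp B1 x0 h1
  have a2 : (B2.card : ℝ) * cnt A x0 B0 ≤ ∑ x ∈ Bp, (cnt A (x0 + x) B2 : ℝ) := by
    exact_mod_cast cnt_avg A B0 Bp B2 x0 h2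
  have b1 : α * B0.card ≤ ∑ x ∈ Bp, (cnt A (x0 + x) B1 : ℝ) / B1.card := by
    rw [← sum_div, le_div_iff₀ c1]; nlinarith
  have b2 : α * B0.card ≤ ∑ x ∈ Bp, (cnt A (x0 + x) B2 : ℝ) / B2.card := by
    rw [← sum_div, le_div_iff₀ c2]; nlinarith
  have hex : ∃ x ∈ Bp, 198 / 100 * α ≤ (cnt A (x0 + x) B1 : ℝ) / B1.card
      + (cnt A (x0 + x) B2 : ℝ) / B2.card := by
    by_contra hcon
    push Not at hcon
    have : ∑ x ∈ Bp, ((cnt A (x0 + x) B1 : ℝ) / B1.card + (cnt A (x0 + x) B2 : ℝ) / B2.card)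
        ≤ ∑ x ∈ Bp, 198 / 100 * α := sum_le_sum fun x hx => (hcon x hx).le
    rw [sum_add_distrib, sum_const, nsmul_eq_mul] at this
    nlinarith [mul_pos hα c0]
  obtain ⟨x, _, hx⟩ := hex
  have v1 : (cnt A (x0 + x) B1 : ℝ) / B1.card ≤ 101 / 100 * α := by
    rw [div_le_iff₀ c1]; exact u1 _
  have v2 : (cnt A (x0 + x) B2 : ℝ) / B2.card ≤ 101 / 100 * α := by
    rw [div_le_iff₀ c2]; exact u2 _
  refine ⟨x0 + x, ?_, ?_⟩
  · rw [← le_div_iff₀ c1]; linarith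
  · rw [← le_div_iff₀ c2]; linarith

noncomputable def Nap (A : Finset (ZMod p)) : ℕ :=
  ((univ : Finset (ZMod p × ZMod p)).filter
    fun q => q.1 ∈ A ∧ q.1 + q.2 ∈ A ∧ q.1 + 2 * q.2 ∈ A).card

lemma count_lower (hp : Odd p) (A B1 B2 : Finset (ZMod p)) (x : ZMod p) :
    ((B2.filter fun y => x + y ∈ A).card : ℝ) * ∑ z ∈ B1.filter (fun y => x + y ∈ A),
      av ((B2.filter fun y => x + y ∈ A).image fun y => 2 * y) id
        (indm (B1.filter fun y => x + y ∈ A)) z ≤ Nap A := by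
  classical
  set A1 := B1.filter fun y => x + y ∈ A with hA1
  set A2 := B2.filter fun y => x + y ∈ A with hA2
  have hinj : Set.InjOn (fun y : ZMod p => 2 * y) (A2 : Set (ZMod p)) := by
    intro y _ y' _ h
    exact mul_left_cancel₀ (two_ne hp) h
  have h1 : (A2.card : ℝ) * ∑ z ∈ A1, av (A2.image fun y => 2 * y) id (indm A1) z
      = ∑ z ∈ A1, ∑ y ∈ A2, indm A1 (z - 2 * y) := by
    rw [mul_sum]
    apply sum_congr rfl
    intro z _
    rw [av, sum_image hinj, card_image_of_injOn hinj]
    rcases A2.eq_empty_or_nonempty with h | h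
    · simp [h]
    · have : (A2.card : ℝ) ≠ 0 := by exact_mod_cast (card_pos.2 h).ne'
      field_simp; rfl
  rw [h1]
  have h2 : ∑ z ∈ A1, ∑ y ∈ A2, indm A1 (z - 2 * y)
      = (((A1 ×ˢ A2).filter fun q => 2 * q.2 - q.1 ∈ A1).card : ℝ) := by
    rw [card_filter, ← sum_product']
    push_cast
    apply sum_congr rfl
    intro q _
    simp [indm]
  rw [h2, Nap]
  norm_cast
  apply card_le_card_of_injOn (fun q => (x + q.1, q.2 - q.1))
  · intro q hq
    have hq' := mem_filter.1 hq
    have hq1 := mem_product.1 hq'.1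
    show (x + q.1, q.2 - q.1) ∈ (univ : Finset (ZMod p × ZMod p)).filter _
    rw [mem_filter]
    refine ⟨mem_univ _, (mem_filter.1 hq1.1).2, ?_, ?_⟩
    · have : x + q.1 + (q.2 - q.1) = x + q.2 := by ring
      simp only [this]; exact (mem_filter.1 hq1.2).2
    · have : x + q.1 + 2 * (q.2 - q.1) = x + (2 * q.2 - q.1) := by ring
      simp only [this]; exact (mem_filter.1 hq'.2).2
  · intro q _ q' _ h
    simp only [Prod.mk.injEq] at h
    have e1 : q.1 = q'.1 := by simpa using h.1
    have e2 : q.2 = q'.2 := by have := h.2; rw [e1] at this; simpa using this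
    exact Prod.ext e1 e2

end
end RothAP


namespace RothAP
open Finset

section
variable {p : ℕ} [Fact p.Prime]

def Reg (dM : ℕ) (Γ : Finset (ZMod p)) (ρ : ℝ) : Prop :=
  ((Bohr Γ (ρ * (1 + (1 / 100) / (40 * dM)))).card : ℝ) ≤ (1 + 1 / 100) * (Bohr Γ ρ).card

lemma av_indm_le (A B1 V : Finset (ZMod p)) (hV : V.Nonempty) (x z : ZMod p) (H : ℝ)
    (h : ∀ y, (cnt A y V : ℝ) ≤ H * V.card) :
    av V id (indm (B1.filter fun y => x + y ∈ A)) z ≤ H := by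
  have c : (0 : ℝ) < V.card := by exact_mod_cast card_pos.2 hV
  rw [av, div_le_iff₀ c]
  refine le_trans ?_ (h (x - z))
  rw [cnt, card_filter]
  push_cast
  apply sum_le_sum
  intro v _
  unfold indm
  simp only [id, neg_sub, mem_filter]
  have e : x + (v - z) = x - z + v := by ring
  rw [e]
  split_ifs <;> simp_all

lemma av_ind_le (A B1 V : Finset (ZMod p)) (hV : V.Nonempty) (hVs : ∀ v ∈ V, -v ∈ V) (x z : ZMod p)
    (H : ℝ) (h : ∀ y, (cnt A y V : ℝ) ≤ H * V.card) :
    av V id (ind (B1.filter fun y => x + y ∈ A)) z ≤ H := by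
  have c : (0 : ℝ) < V.card := by exact_mod_cast card_pos.2 hV
  rw [av, div_le_iff₀ c]
  refine le_trans ?_ (h (x + z))
  have e0 : ∑ i ∈ V, ind (B1.filter fun y => x + y ∈ A) (z - id i)
      = ∑ i ∈ V, ind (B1.filter fun y => x + y ∈ A) (z + i) := by
    refine sum_bij' (fun i _ => -i) (fun i _ => -i) (fun i hi => hVs i hi) (fun i hi => hVs i hi)
      (by simp) (by simp) ?_
    intro i _
    simp [sub_eq_add_neg]
  rw [e0, cnt, card_filter]
  push_cast
  apply sum_le_sum
  intro v _
  unfold ind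
  simp only [mem_filter]
  have e : x + (z + v) = x + z + v := by ring
  rw [e]
  split_ifs <;> simp_all

lemma one_sub_mh (V : Finset (ZMod p)) (hV : V.Nonempty) (γ : ZMod p) (s : ℝ)
    (h : ∀ v ∈ V, ‖ch γ v - 1‖ ≤ s) : ‖1 - mh V id γ‖ ≤ s := by
  have c : (0 : ℝ) < V.card := by exact_mod_cast card_pos.2 hV
  have c' : (V.card : ℂ) ≠ 0 := by exact_mod_cast c.ne'
  have : 1 - mh V id γ = -((∑ v ∈ V, (ch γ v - 1)) / V.card) := by
    rw [mh, sum_sub_distrib, sub_div]; simp [c']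
  rw [this, norm_neg, norm_div, Complex.norm_natCast, div_le_iff₀ c]
  refine (norm_sum_le _ _).trans ?_
  rw [mul_comm, ← nsmul_eq_mul]
  exact sum_le_card_nsmul _ _ _ h

lemma sum_mem_Bohr {ι : Type*} (I : Finset ι) (y : ι → ZMod p) (Γ : Finset (ZMod p)) (r : ℝ)
    (h : ∀ i ∈ I, y i ∈ Bohr Γ r) : ∑ i ∈ I, y i ∈ Bohr Γ (I.card * r) := by
  rw [mem_Bohr]
  intro g hg
  have h1 := norm_ch_sum_left I y g
  rw [ch_comm] at h1
  refine h1.trans ?_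
  rw [← nsmul_eq_mul]
  apply sum_le_card_nsmul
  intro i hi
  rw [ch_comm]
  exact mem_Bohr.1 (h i hi) g hg

noncomputable def rr (s : ℝ) (l n dM : ℕ) : ℝ :=
  ((1 / 100) / (40 * dM) / 4) * ((1 / 100) / (40 * dM) / 16) * ((1 / 100) / (40 * dM) / (32 * l)) *
    ((1 / 100) / (40 * dM) / (2 * n)) * ((s / 8) / (40 * dM) * s / (4 * n))

set_option maxHeartbeats 2000000 in
lemma increment (hp : Odd p) (A : Finset (ZMod p)) (m l k n dM : ℕ) (hm : 1 ≤ m) (hl1 : 1 ≤ l)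
    (hk : 1 ≤ k) (hn1 : 1 ≤ n) (α : ℝ) (hα : 0 < α) (hα1 : α ≤ 1) (hm2 : 2 / α ≤ 2 ^ m)
    (hkm : (m : ℝ) / k ≤ (1 / (2000 * l)) ^ 2 * α) (hn : 8 * 2 ^ (m * k) < Real.exp (n / 64))
    (hl : 2 * (1 / 4 : ℝ) ^ l ≤ (1 / 100 * α) ^ m) (s : ℝ) (hs0 : 0 < s) (hs1 : s ≤ 1)
    (hs : 2 * s ≤ (1 / 100 * α) ^ m) (Γ : Finset (ZMod p)) (ρ0 : ℝ) (x0 : ZMod p) (hρ0 : 0 < ρ0)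
    (hρ01 : ρ0 ≤ 1) (hΓ : Γ.card + n ≤ dM) (hreg : Reg dM Γ ρ0)
    (hd : α * (Bohr Γ ρ0).card ≤ cnt A x0 (Bohr Γ ρ0))
    (NI : ∀ (Γ' : Finset (ZMod p)) (ρ' : ℝ) (x' : ZMod p), Γ'.card ≤ Γ.card + n →
      rr s l n dM * ρ0 ≤ ρ' → ρ' ≤ ρ0 → Reg dM Γ' ρ' →
      (cnt A x' (Bohr Γ' ρ') : ℝ) ≤ 101 / 100 * α * (Bohr Γ' ρ').card) :
    ∃ ρ1 ρ2 : ℝ, rr s l n dM * ρ0 ≤ ρ1 ∧ ρ1 ≤ 1 ∧ rr s l n dM * ρ0 ≤ ρ2 ∧ ρ2 ≤ 1 ∧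
      α ^ 3 / 2 * (Bohr Γ ρ1).card * (Bohr Γ ρ2).card ≤ Nap A := by
  classical
  have hdM1 : 1 ≤ dM := by omega
  have hdMr : (1 : ℝ) ≤ dM := by exact_mod_cast hdM1
  have hlr : (1 : ℝ) ≤ l := by exact_mod_cast hl1
  have hnr : (1 : ℝ) ≤ n := by exact_mod_cast hn1
  set κ : ℝ := (1 / 100) / (40 * dM) with hκ
  have hκ0 : 0 < κ := by positivity
  have hκ1 : κ ≤ 1 := by rw [hκ, div_le_one (by positivity)]; linarith
  set κ' : ℝ := (s / 8) / (40 * dM) with hκ'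
  have hκ'0 : 0 < κ' := by positivity
  have hκ'1 : κ' ≤ 1 := by rw [hκ', div_le_one (by positivity)]; linarith
  -- radii
  obtain ⟨ρ1, l1, g1, reg1⟩ := Bohr_regular Γ (κ * ρ0 / 2) (1 / 100) (by positivity) (by norm_num)
    (by norm_num) dM (by omega) hdM1
  have hρ1 : 0 < ρ1 := lt_of_lt_of_le (by positivity) l1
  obtain ⟨ρ2, l2, g2, reg2⟩ := Bohr_regular Γ (κ * ρ1 / 8) (1 / 100) (by positivity) (by norm_num)
    (by norm_num) dM (by omega) hdM1
  have hρ2 : 0 < ρ2 := lt_of_lt_of_le (by positivity) l2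
  have hhf : (hfG Γ).card ≤ Γ.card := card_hf Γ
  obtain ⟨σ, l3, g3, reg3⟩ := Bohr_regular (hfG Γ) (κ * ρ2 / (16 * l)) (1 / 100) (by positivity)
    (by norm_num) (by norm_num) dM (by omega) hdM1
  have hσ : 0 < σ := lt_of_lt_of_le (by positivity) l3
  obtain ⟨σ', l4, g4, reg4⟩ := Bohr_regular (hfG Γ) (κ * σ / n) (s / 8) (by positivity)
    (by positivity) (by linarith) dM (by omega) hdM1
  have hσ' : 0 < σ' := lt_of_lt_of_le (by positivity) l4
  rw [← hκ] at reg1 reg2 reg3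
  rw [← hκ'] at reg4
  -- numeric consequences
  have q1 : ρ1 ≤ κ * ρ0 := by linarith [mul_pos hκ0 hρ0]
  have q1' : ρ1 ≤ ρ0 := q1.trans (mul_le_of_le_one_left hρ0.le hκ1)
  have q2 : 8 * ρ2 ≤ κ * ρ1 := by linarith
  have q2' : ρ2 ≤ ρ1 := by linarith [mul_le_of_le_one_left hρ1.le hκ1]
  have q3 : l * (16 * σ) ≤ κ * ρ2 := by
    rw [le_div_iff₀ (by positivity)] at g3; linarith
  have q3a : l * (16 * σ) ≤ ρ2 := q3.trans (mul_le_of_le_one_left hρ2.le hκ1)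
  have q3b : 16 * σ ≤ κ * ρ2 := (le_mul_of_one_le_left (by linarith) hlr).trans q3
  have q3c : 16 * σ ≤ ρ2 := (le_mul_of_one_le_left (by linarith) hlr).trans q3a
  have q4 : n * σ' ≤ κ * σ := by rw [le_div_iff₀ (by positivity)] at g4; linarith
  have q4' : σ' ≤ σ :=
    ((le_mul_of_one_le_left hσ'.le hnr).trans q4).trans (mul_le_of_le_one_left hσ.le hκ1)
  have hks : 0 < κ' * σ' := mul_pos hκ'0 hσ'
  have hk1 : 0 < κ * ρ1 := mul_pos hκ0 hρ1
  have hk2 : 0 < κ * ρ2 := mul_pos hκ0 hρ2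
  -- good translate
  have f1 : rr s l n dM = (κ / 4) * (κ / 16) * (κ / (32 * l)) * (κ / (2 * n)) * (κ' * s / (4 * n)) := rfl
  have t1 : (κ / 4) ≤ 1 := by linarith
  have t2 : (κ / 16) ≤ 1 := by linarith
  have t3 : (κ / (32 * l)) ≤ 1 := by rw [div_le_one (by positivity)]; linarith
  have t4 : (κ / (2 * n)) ≤ 1 := by rw [div_le_one (by positivity)]; linarith
  have t5 : (κ' * s / (4 * n)) ≤ 1 := by rw [div_le_one (by positivity)]; linarith [mul_le_one₀ hκ'1 hs0.le hs1]
  have r1 : κ / 4 * ρ0 ≤ ρ1 := by linarith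
  have r2 : (κ / 4) * (κ / 16) * ρ0 ≤ ρ2 := by
    calc (κ / 4) * (κ / 16) * ρ0 = (κ / 16) * (κ / 4 * ρ0) := by ring
      _ ≤ κ / 16 * ρ1 := by gcongr
      _ ≤ ρ2 := by linarith
  have r3 : (κ / 4) * (κ / 16) * (κ / (32 * l)) * ρ0 ≤ σ := by
    calc (κ / 4) * (κ / 16) * (κ / (32 * l)) * ρ0 = (κ / (32 * l)) * ((κ / 4) * (κ / 16) * ρ0) := by ring
      _ ≤ κ / (32 * l) * ρ2 := by gcongr
      _ = κ * ρ2 / (16 * l) / 2 := by field_simp; norm_num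
      _ ≤ σ := l3
  have r4 : (κ / 4) * (κ / 16) * (κ / (32 * l)) * (κ / (2 * n)) * ρ0 ≤ σ' := by
    calc (κ / 4) * (κ / 16) * (κ / (32 * l)) * (κ / (2 * n)) * ρ0
        = (κ / (2 * n)) * ((κ / 4) * (κ / 16) * (κ / (32 * l)) * ρ0) := by ring
      _ ≤ κ / (2 * n) * σ := by gcongr
      _ = κ * σ / n / 2 := by field_simp
      _ ≤ σ' := l4
  have r5 : rr s l n dM * ρ0 ≤ κ' * σ' * s / (4 * n) := by
    rw [f1]
    calc (κ / 4) * (κ / 16) * (κ / (32 * l)) * (κ / (2 * n)) * (κ' * s / (4 * n)) * ρ0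
        = (κ' * s / (4 * n)) * ((κ / 4) * (κ / 16) * (κ / (32 * l)) * (κ / (2 * n)) * ρ0) := by ring
      _ ≤ (κ' * s / (4 * n)) * σ' := by gcongr
      _ = _ := by ring
  have rr2 : rr s l n dM ≤ (κ / 4) * (κ / 16) := by
    rw [f1]
    have : (κ / (32 * l)) * (κ / (2 * n)) * (κ' * s / (4 * n)) ≤ 1 :=
      mul_le_one₀ (mul_le_one₀ t3 (by positivity) t4) (by positivity) t5
    calc _ = (κ / 4) * (κ / 16) * ((κ / (32 * l)) * (κ / (2 * n)) * (κ' * s / (4 * n))) := by ring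
      _ ≤ (κ / 4) * (κ / 16) * 1 := by gcongr
      _ = _ := mul_one _
  have w2 : rr s l n dM * ρ0 ≤ ρ2 := le_trans (by gcongr) r2
  have w1 : rr s l n dM * ρ0 ≤ ρ1 := w2.trans q2'
  refine ⟨ρ1, ρ2, w1, by linarith, w2, by linarith, ?_⟩
  set B0 := Bohr Γ ρ0 with hB0
  set B1 := Bohr Γ ρ1 with hB1
  set B2 := Bohr Γ ρ2 with hB2
  have ne : ∀ {Γ' : Finset (ZMod p)} {ρ : ℝ}, 0 < ρ → (Bohr Γ' ρ).Nonempty :=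
    fun h => card_pos.1 (Bohr_card_pos h.le)
  obtain ⟨x, hx1, hx2⟩ := exists_good_x A B0 (Bohr Γ (ρ0 * (1 + κ))) B1 B2 x0 α (ne hρ0) (ne hρ1)
    (ne hρ2) (fun x hx y hy => Bohr_mono (by linarith) (sub_mem_Bohr hx hy))
    (fun x hx y hy => Bohr_mono (by linarith) (sub_mem_Bohr hx hy))
    (by have := hreg; unfold Reg at this; rw [← hκ] at this; linarith) hα hd
    (fun x => NI Γ ρ1 x (by omega) w1 q1' reg1)
    (fun x => NI Γ ρ2 x (by omega) w2 (by linarith) reg2)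
  have u1 := NI Γ ρ1 x (by omega) w1 q1' reg1
  set A1 := B1.filter fun y => x + y ∈ A with hA1
  set A2 := B2.filter fun y => x + y ∈ A with hA2
  set D := A2.image fun y => 2 * y with hD
  have c1pos : (0 : ℝ) < B1.card := by exact_mod_cast Bohr_card_pos hρ1.le
  have c2pos : (0 : ℝ) < B2.card := by exact_mod_cast Bohr_card_pos hρ2.le
  have hA1c : 97 / 100 * α * B1.card ≤ A1.card := hx1
  have hA2c : 97 / 100 * α * B2.card ≤ A2.card := hx2
  have hA1p : (0 : ℝ) < A1.card := lt_of_lt_of_le (by positivity) hA1c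
  have hA2p : (0 : ℝ) < A2.card := lt_of_lt_of_le (by positivity) hA2c
  have hinj : Set.InjOn (fun y : ZMod p => 2 * y) (A2 : Set (ZMod p)) := by
    intro y _ y' _ h
    exact mul_left_cancel₀ (two_ne hp) h
  have hDc : D.card = A2.card := card_image_of_injOn hinj
  have hDne : D.Nonempty := by
    apply card_pos.1; rw [hDc]; exact_mod_cast hA2p
  have hDsub : ∀ d ∈ D, d ∈ Bohr (hfG Γ) ρ2 := by
    intro d hd
    obtain ⟨y, hy, rfl⟩ := mem_image.1 hd
    rw [mem_Bohr_hf]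
    have h2 := two_ne hp
    simpa [h2] using (mem_filter.1 hy).1
  have hDsub2 : ∀ d ∈ D, d ∈ Bohr Γ (2 * ρ2) := fun d hd => Bohr_hf_sub hp _ _ (hDsub d hd)
  set S := Bohr (hfG Γ) σ with hS
  set W := Bohr Γ (ρ1 * (1 + κ)) with hW
  set B : ℝ := (W.card : ℝ) ^ (1 / ((2 * m : ℕ) : ℝ)) with hBdef
  have hBp : B ^ (2 * m) = W.card := by
    rw [hBdef, one_div, Real.rpow_inv_natCast_pow (by positivity) (by omega)]
  have hB0' : 0 ≤ B := by positivity
  have hindm1 : ∀ z, indm A1 z ≠ 0 → z ∈ Bohr Γ ρ1 := by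
    intro z hz
    unfold indm at hz
    split_ifs at hz with h
    · have := neg_mem_Bohr (mem_filter.1 h).1
      simpa using this
    · exact absurd rfl hz
  have hind1 : ∀ z, ind A1 z ≠ 0 → z ∈ Bohr Γ ρ1 := by
    intro z hz
    unfold ind at hz
    split_ifs at hz with h
    · exact (mem_filter.1 h).1
    · exact absurd rfl hz
  have hfsupp : ∀ z, av D id (indm A1) z ≠ 0 → z ∈ Bohr Γ (ρ1 + 2 * ρ2) :=
    av_supp D id (indm A1) Γ ρ1 (2 * ρ2) hindm1 hDsub2
  set c1 : ℝ := 1 / (2000 * l) with hc1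
  have hc1pos : 0 < c1 := by positivity
  have hc11 : c1 ≤ 1 := by rw [hc1, div_le_one (by positivity)]; linarith
  obtain ⟨T, hTS, hTc, hT⟩ := almost_periods A1 D S (Bohr (hfG Γ) (ρ2 * (1 + κ))) W hDne (ne hσ)
    (fun d hd s hs => Bohr_mono (by linarith) (add_mem_Bohr (hDsub d hd) hs)) (2 ^ m)
    (by
      rw [card_Bohr_hf hp, hDc]
      have h1 : (B2.card : ℝ) * (101 / 100) ≤ 2 / α * A2.card := by
        rw [div_mul_eq_mul_div, le_div_iff₀ hα]; have h0 : 0 < α * B2.card := mul_pos hα c2pos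
        linarith
      calc ((Bohr Γ (ρ2 * (1 + κ))).card : ℝ) ≤ (1 + 1 / 100) * B2.card := reg2
        _ ≤ 2 / α * A2.card := by linarith
        _ ≤ _ := by gcongr)
    k m hk hm α c1 B hα hc1pos hc11 hkm hB0' hBp
    (fun z hz => Bohr_mono (by linarith) (hfsupp z hz))
  have hTne : T.Nonempty := by
    rw [nonempty_iff_ne_empty]
    rintro rfl
    have : (0 : ℝ) < S.card := by exact_mod_cast Bohr_card_pos hσ.le
    simp at hTc
    have h3 : S.Nonempty := ne hσ
    rw [hTc] at h3
    simp at h3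
  obtain ⟨Λ, hΛc, hΛ⟩ := chang_span T S (Bohr (hfG Γ) (σ * (1 + κ))) (Bohr (hfG Γ) σ') n hTS hTne
    (ne hσ') (2 * 2 ^ (m * k)) (by positivity) (by rw [pow_mul]; exact hTc)
    (by
      have : (0 : ℝ) < S.card := by exact_mod_cast Bohr_card_pos hσ.le
      linarith [reg3])
    (by
      intro s hs y hy
      have h1 := sum_mem_Bohr univ y (hfG Γ) σ' (fun i _ => hy i)
      rw [card_univ, Fintype.card_fin] at h1
      exact Bohr_mono (by linarith) (sub_mem_Bohr hs h1))
    (by linarith)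
  have hcard' : (hfG Γ ∪ Λ).card ≤ Γ.card + n := (card_union_le _ _).trans (by omega)
  obtain ⟨ρV, l5, g5, reg5⟩ := Bohr_regular (hfG Γ ∪ Λ) (κ' * σ' * s / (2 * n)) (1 / 100)
    (by positivity) (by norm_num) (by norm_num) dM (by omega) hdM1
  have hρV : 0 < ρV := lt_of_lt_of_le (by positivity) l5
  have q5 : n * (2 * ρV) ≤ κ' * σ' * s := by rw [le_div_iff₀ (by positivity)] at g5; linarith
  have hσ'1 : σ' ≤ 1 := by linarith
  have q5a : ρV ≤ κ' * σ' := by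
    have : κ' * σ' * s ≤ κ' * σ' := mul_le_of_le_one_right hks.le hs1
    have h6 : 1 * ρV ≤ n * ρV := mul_le_mul_of_nonneg_right hnr hρV.le
    linarith
  have q5b : n * ρV ≤ s / 2 := by
    have : κ' * σ' ≤ 1 := mul_le_one₀ hκ'1 hσ'.le hσ'1
    have h6 : κ' * σ' * s ≤ 1 * s := mul_le_mul_of_nonneg_right this hs0.le
    linarith
  have q5c : ρV ≤ σ := by
    have h6 : κ' * σ' ≤ 1 * σ' := mul_le_mul_of_nonneg_right hκ'1 hσ'.le
    linarith
  set V := Bohr (hfG Γ ∪ Λ) ρV with hV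
  have hVne : V.Nonempty := ne hρV
  have hVs : ∀ v ∈ V, -v ∈ V := fun v hv => neg_mem_Bohr hv
  have hVhf : ∀ v ∈ V, v ∈ Bohr (hfG Γ) ρV := fun v hv => Bohr_anti subset_union_left hv
  have hVΓ : ∀ v ∈ V, v ∈ Bohr Γ (2 * ρV) := fun v hv => Bohr_hf_sub hp _ _ (hVhf v hv)
  have hTΓ : ∀ t ∈ T, t ∈ Bohr Γ (2 * σ) := fun t ht => Bohr_hf_sub hp _ _ (hTS ht)
  have NV : ∀ y, (cnt A y V : ℝ) ≤ 101 / 100 * α * V.card := fun y =>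
    NI _ ρV y hcard' (r5.trans (le_trans (le_of_eq (by field_simp; norm_num)) l5)) (by linarith) reg5
  have hWc : (W.card : ℝ) ≤ 101 / 100 * B1.card := by linarith [reg1]
  have main := core A1 D T V W hDne hTne hVne hVs m l hm α
    (20 * c1 * (α * B + lq m (av D id (indm A1)))) s W.card B1.card B hα hα1
    (by have := lq_nonneg m (av D id (indm A1)); positivity) hB0' hBp hT
    (by
      apply le_of_eq
      rw [hc1]; field_simp; ring)
    (by
      intro γ hγ
      apply one_sub_mh V hVne
      intro v hv
      have hv2 : ∀ x ∈ Λ, ‖ch x v - 1‖ ≤ ρV := fun x hx =>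
        mem_Bohr.1 hv x (mem_union_right _ hx)
      have h4 := hΛ v ρV (4 * (s / 8)) hρV.le (by positivity) hv2
        (fun ν hν => spec_shift (Bohr (hfG Γ) σ') (Bohr (hfG Γ) (σ' * (1 + κ'))) (ne hσ') (s / 8) v
          (Bohr_mono (by linarith))
          (fun x hx => Bohr_mono (by linarith) (add_mem_Bohr hx (hVhf v hv))) reg4 ν hν) γ hγ
      linarith)
    hs hl (fun z => av_indm_le A B1 V hVne x z _ NV) (fun z => av_ind_le A B1 V hVne hVs x z _ NV)
    u1 hA1c (by exact_mod_cast card_filter_le _ _) c1pos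
    (by exact_mod_cast card_le_card (Bohr_mono (by linarith))) hWc hWc
    (by
      intro z hz
      have := av_supp V id (ind A1) Γ ρ1 (2 * ρV) hind1 hVΓ z hz
      exact Bohr_mono (by linarith) this)
    (by
      intro z hz
      have h5 := iter_supp T Γ (2 * σ) hTΓ l (av D id (indm A1)) _ hfsupp
      have := av_supp V id _ Γ _ (2 * ρV) h5 hVΓ z hz
      exact Bohr_mono (by linarith) this)
    hm2
  have cl := count_lower hp A B1 B2 x
  refine le_trans ?_ cl
  calc α ^ 3 / 2 * B1.card * B2.card
      ≤ (97 / 100 * α * B2.card) * (4 / 5 * α * (97 / 100 * α * B1.card)) := by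
        have : 0 < α ^ 3 * B1.card * B2.card := by positivity
        linarith
    _ ≤ A2.card * (4 / 5 * α * A1.card) := by gcongr
    _ ≤ _ := by gcongr

end
end RothAP


namespace RothAP
open Finset

section
variable {p : ℕ} [Fact p.Prime]

lemma rr_pos (s : ℝ) (l n dM : ℕ) (hs : 0 < s) (hl : 1 ≤ l) (hn : 1 ≤ n) (hd : 1 ≤ dM) :
    0 < rr s l n dM := by
  have h1 : (0 : ℝ) < l := by exact_mod_cast hl
  have h2 : (0 : ℝ) < n := by exact_mod_cast hn
  have h3 : (0 : ℝ) < dM := by exact_mod_cast hd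
  unfold rr
  positivity

lemma rr_eq (s : ℝ) (l n dM : ℕ) (hl : 1 ≤ l) (hn : 1 ≤ n) (hd : 1 ≤ dM) :
    rr s l n dM = s ^ 2 / (4000 ^ 4 * 320 * 16384 * (dM : ℝ) ^ 5 * l * n ^ 2) := by
  have h1 : (0 : ℝ) < l := by exact_mod_cast hl
  have h2 : (0 : ℝ) < n := by exact_mod_cast hn
  have h3 : (0 : ℝ) < dM := by exact_mod_cast hd
  unfold rr
  field_simp
  ring

lemma rr_le_one (s : ℝ) (l n dM : ℕ) (hs : 0 < s) (hs1 : s ≤ 1) (hl : 1 ≤ l) (hn : 1 ≤ n)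
    (hd : 1 ≤ dM) : rr s l n dM ≤ 1 := by
  have h1 : (1 : ℝ) ≤ l := by exact_mod_cast hl
  have h2 : (1 : ℝ) ≤ n := by exact_mod_cast hn
  have h3 : (1 : ℝ) ≤ dM := by exact_mod_cast hd
  rw [rr_eq s l n dM hl hn hd, div_le_one (by positivity)]
  have a1 : s ^ 2 ≤ 1 := pow_le_one₀ hs.le hs1
  have a2 : (1 : ℝ) ≤ (dM : ℝ) ^ 5 := one_le_pow₀ h3
  have a3 : (1 : ℝ) ≤ (n : ℝ) ^ 2 := one_le_pow₀ h2
  calc s ^ 2 ≤ 1 * 1 * 1 * 1 := by linarith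
    _ ≤ 4000 ^ 4 * 320 * 16384 * (dM : ℝ) ^ 5 * l * n ^ 2 := by
      gcongr
      norm_num

lemma iteration (hp : Odd p) (A : Finset (ZMod p)) (m l k n dM : ℕ) (hm : 1 ≤ m) (hl1 : 1 ≤ l)
    (hk : 1 ≤ k) (hn1 : 1 ≤ n) (hdM : 1 ≤ dM) (α0 : ℝ) (hα0 : 0 < α0) (hm2 : 2 / α0 ≤ 2 ^ m)
    (hkm : (m : ℝ) / k ≤ (1 / (2000 * l)) ^ 2 * α0) (hn : 8 * 2 ^ (m * k) < Real.exp (n / 64))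
    (hl : 2 * (1 / 4 : ℝ) ^ l ≤ (1 / 100 * α0) ^ m) (s : ℝ) (hs0 : 0 < s) (hs1 : s ≤ 1)
    (hs : 2 * s ≤ (1 / 100 * α0) ^ m) (j : ℕ) :
    ∀ (α : ℝ) (Γ : Finset (ZMod p)) (ρ0 : ℝ) (x0 : ZMod p), α0 ≤ α → α ≤ 1 →
      1 < (101 / 100) ^ (j + 1) * α → 0 < ρ0 → ρ0 ≤ 1 → Γ.card + (j + 1) * n ≤ dM → Reg dM Γ ρ0 →
      α * (Bohr Γ ρ0).card ≤ cnt A x0 (Bohr Γ ρ0) →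
      ∃ (Γ' : Finset (ZMod p)) (ρ1 ρ2 : ℝ), Γ'.card ≤ dM ∧ rr s l n dM ^ (j + 1) * ρ0 ≤ ρ1 ∧ ρ1 ≤ 1 ∧
        rr s l n dM ^ (j + 1) * ρ0 ≤ ρ2 ∧ ρ2 ≤ 1 ∧
        α0 ^ 3 / 2 * (Bohr Γ' ρ1).card * (Bohr Γ' ρ2).card ≤ Nap A := by
  have rp := rr_pos s l n dM hs0 hl1 hn1 hdM
  have r1 := rr_le_one s l n dM hs0 hs1 hl1 hn1 hdM
  induction j with
  | zero =>
    intro α Γ ρ0 x0 ha ha1 hj hρ hρ1 hc hreg hd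
    have hα : 0 < α := hα0.trans_le ha
    obtain ⟨ρ1, ρ2, e1, e2, e3, e4, e5⟩ := increment hp A m l k n dM hm hl1 hk hn1 α hα ha1
      (le_trans (by gcongr) hm2) (hkm.trans (by gcongr)) hn (hl.trans (by gcongr)) s hs0 hs1
      (hs.trans (by gcongr)) Γ ρ0 x0 hρ hρ1 (by omega) hreg hd (by
        intro Γ' ρ' x' h1 h2 h3 h4
        have h5 : (cnt A x' (Bohr Γ' ρ') : ℝ) ≤ (Bohr Γ' ρ').card := by
          exact_mod_cast card_filter_le _ _
        have h6 : (1 : ℝ) ≤ 101 / 100 * α := by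
          have := hj.le
          simpa using this
        refine h5.trans ?_
        exact le_mul_of_one_le_left (by positivity) h6)
    refine ⟨Γ, ρ1, ρ2, by omega, by simpa using e1, e2, by simpa using e3, e4, le_trans ?_ e5⟩
    gcongr
  | succ j ih =>
    intro α Γ ρ0 x0 ha ha1 hj hρ hρ1 hc hreg hd
    have hα : 0 < α := hα0.trans_le ha
    by_cases NI : ∀ (Γ' : Finset (ZMod p)) (ρ' : ℝ) (x' : ZMod p), Γ'.card ≤ Γ.card + n →
      rr s l n dM * ρ0 ≤ ρ' → ρ' ≤ ρ0 → Reg dM Γ' ρ' →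
      (cnt A x' (Bohr Γ' ρ') : ℝ) ≤ 101 / 100 * α * (Bohr Γ' ρ').card
    · have hc' : Γ.card + n ≤ dM := by
        refine le_trans ?_ hc
        have : 1 * n ≤ (j + 1 + 1) * n := Nat.mul_le_mul_right _ (by omega)
        omega
      obtain ⟨ρ1, ρ2, e1, e2, e3, e4, e5⟩ := increment hp A m l k n dM hm hl1 hk hn1 α hα ha1
        (le_trans (by gcongr) hm2) (hkm.trans (by gcongr)) hn (hl.trans (by gcongr)) s hs0 hs1
        (hs.trans (by gcongr)) Γ ρ0 x0 hρ hρ1 hc' hreg hd NI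
      have h7 : rr s l n dM ^ (j + 1 + 1) * ρ0 ≤ rr s l n dM * ρ0 := by
        apply mul_le_mul_of_nonneg_right _ hρ.le
        exact pow_le_of_le_one rp.le r1 (by omega)
      refine ⟨Γ, ρ1, ρ2, by omega, h7.trans e1, e2, h7.trans e3, e4, le_trans ?_ e5⟩
      gcongr
    · push Not at NI
      obtain ⟨Γ', ρ', x', h1, h2, h3, h4, h5⟩ := NI
      have hρ' : 0 < ρ' := lt_of_lt_of_le (by positivity) h2
      have hB : (0 : ℝ) < (Bohr Γ' ρ').card := by exact_mod_cast Bohr_card_pos hρ'.le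
      have h6 : (cnt A x' (Bohr Γ' ρ') : ℝ) ≤ (Bohr Γ' ρ').card := by
        exact_mod_cast card_filter_le _ _
      have h8 : 101 / 100 * α ≤ 1 := by
        by_contra h
        push Not at h
        have : 1 * ((Bohr Γ' ρ').card : ℝ) ≤ 101 / 100 * α * (Bohr Γ' ρ').card :=
          mul_le_mul_of_nonneg_right h.le hB.le
        linarith
      obtain ⟨Γ'', ρ1, ρ2, e0, e1, e2, e3, e4, e5⟩ := ih (101 / 100 * α) Γ' ρ' x' (by linarith) h8
        (by rw [pow_succ] at hj; linarith) hρ' (h3.trans hρ1) (by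
          have : (j + 1 + 1) * n = (j + 1) * n + n := by ring
          omega) h4 h5.le
      have h9 : rr s l n dM ^ (j + 1 + 1) * ρ0 ≤ rr s l n dM ^ (j + 1) * ρ' := by
        rw [pow_succ, mul_assoc]
        gcongr
      exact ⟨Γ'', ρ1, ρ2, e0, h9.trans e1, e2, h9.trans e3, e4, e5⟩

lemma roth_param (hp : Odd p) (A : Finset (ZMod p)) (m l k n dM : ℕ) (hm : 1 ≤ m) (hl1 : 1 ≤ l)
    (hk : 1 ≤ k) (hn1 : 1 ≤ n) (hdM : 1 ≤ dM) (α0 : ℝ) (hα0 : 0 < α0) (hα1 : α0 ≤ 1)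
    (hm2 : 2 / α0 ≤ 2 ^ m)
    (hkm : (m : ℝ) / k ≤ (1 / (2000 * l)) ^ 2 * α0) (hn : 8 * 2 ^ (m * k) < Real.exp (n / 64))
    (hl : 2 * (1 / 4 : ℝ) ^ l ≤ (1 / 100 * α0) ^ m) (s : ℝ) (hs0 : 0 < s) (hs1 : s ≤ 1)
    (hs : 2 * s ≤ (1 / 100 * α0) ^ m) (j : ℕ) (hj : 1 < (101 / 100) ^ (j + 1) * α0)
    (hd : (j + 1) * n ≤ dM) (hA : α0 * p ≤ A.card) :
    α0 ^ 3 / 2 * (p * (((rr s l n dM) ^ (j + 1)) ^ 2 / 121) ^ dM) ^ 2 ≤ Nap A := by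
  have rp := rr_pos s l n dM hs0 hl1 hn1 hdM
  have r1 := rr_le_one s l n dM hs0 hs1 hl1 hn1 hdM
  have hU : ∀ ρ : ℝ, Bohr (∅ : Finset (ZMod p)) ρ = univ := by
    intro ρ
    ext x
    simp [mem_Bohr]
  have hUc : ((univ : Finset (ZMod p)).card : ℝ) = p := by rw [card_univ, ZMod.card]
  obtain ⟨Γ, ρ1, ρ2, e0, e1, e2, e3, e4, e5⟩ := iteration hp A m l k n dM hm hl1 hk hn1 hdM α0 hα0
    hm2 hkm hn hl s hs0 hs1 hs j α0 ∅ 1 0 le_rfl hα1 hj one_pos le_rfl (by simpa using hd)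
    (by
      unfold Reg
      rw [hU, hU]
      have : (0 : ℝ) ≤ ((univ : Finset (ZMod p)).card : ℝ) := by positivity
      linarith)
    (by
      rw [hU, hUc]
      refine hA.trans ?_
      unfold cnt
      apply le_of_eq
      congr 2
      ext x
      simp)
  rw [mul_one] at e1 e3
  set R := rr s l n dM ^ (j + 1) with hR
  have hR0 : 0 < R := by positivity
  have b1 := Bohr_size Γ ρ1 (hR0.trans_le e1) e2 dM e0
  have b2 := Bohr_size Γ ρ2 (hR0.trans_le e3) e4 dM e0
  refine le_trans ?_ e5
  rw [pow_two, ← mul_assoc]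
  gcongr
  · refine le_trans ?_ b1
    gcongr
  · refine le_trans ?_ b2
    gcongr

end

lemma poly_exp : ∃ C : ℝ, 0 < C ∧ ∀ L : ℕ, (L : ℝ) ^ 10 * 2 ^ L ≤ C * ((2 : ℝ) ^ L) ^ (3 / 2 : ℝ) := by
  have h2 : 0 < Real.log 2 := Real.log_pos (by norm_num)
  refine ⟨(Nat.factorial 10 : ℝ) / (Real.log 2 / 2) ^ 10, by positivity, fun L => ?_⟩
  have h := Real.pow_div_factorial_le_exp (L * (Real.log 2 / 2)) (by positivity) 10
  have e : ((2 : ℝ) ^ L) ^ (3 / 2 : ℝ) = Real.exp (L * (Real.log 2 / 2)) * 2 ^ L := by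
    have : (2 : ℝ) ^ L = Real.exp (L * Real.log 2) := by
      rw [← Real.log_pow, Real.exp_log (by positivity)]
    rw [this, ← Real.exp_mul, ← Real.exp_add]
    congr 1
    ring
  rw [e, ← mul_assoc]
  apply mul_le_mul_of_nonneg_right _ (by positivity)
  rw [mul_pow, div_le_iff₀ (by positivity)] at h
  rw [div_mul_eq_mul_div, le_div_iff₀ (by positivity)]
  linarith

lemma roth_final_L : ∀ (p : ℕ) [Fact p.Prime], Odd p → ∀ (A : Finset (ZMod p)) (α : ℝ) (L : ℕ), 1 ≤ L →
    0 < α → α ≤ 1 → 1 / α < 2 ^ L → α * p ≤ A.card →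
    (p : ℝ) ^ 2 * (1 / 2) ^ (2 ^ 64 * L ^ 10 * 2 ^ L) ≤ Nap A := by
  intro p _ hp A α L hL hα hα1 hαL hA
  have hLr : (1 : ℝ) ≤ L := by exact_mod_cast hL
  obtain ⟨m, hm⟩ : ∃ m, m = L + 1 := ⟨_, rfl⟩
  obtain ⟨l, hl⟩ : ∃ l, l = (L + 7) * (L + 1) := ⟨_, rfl⟩
  obtain ⟨k, hk⟩ : ∃ k, k = m * (2000 * l) ^ 2 * 2 ^ L := ⟨_, rfl⟩
  obtain ⟨n, hn⟩ : ∃ n, n = 64 * (3 + m * k) := ⟨_, rfl⟩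
  obtain ⟨dM, hdM⟩ : ∃ dM, dM = (100 * L + 1) * n := ⟨_, rfl⟩
  have hm1 : 1 ≤ m := by omega
  have hl1 : 1 ≤ l := by rw [hl]; exact Nat.mul_pos (by omega) (by omega)
  have hk1 : 1 ≤ k := by rw [hk]; exact Nat.pos_of_ne_zero (by positivity)
  have hn1 : 1 ≤ n := by omega
  have hnd : n ≤ dM := by rw [hdM]; exact Nat.le_mul_of_pos_left _ (by omega)
  have hdM1 : 1 ≤ dM := hn1.trans hnd
  have hαl : (1 / 2 : ℝ) ^ L ≤ α := by
    rw [div_lt_iff₀ hα] at hαL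
    rw [one_div, inv_pow, inv_le_iff_one_le_mul₀ (by positivity)]
    linarith
  have hpow : (1 / 2 : ℝ) ^ l ≤ (1 / 100 * α) ^ m := by
    rw [hl, hm, pow_mul]
    gcongr
    rw [pow_add, mul_comm]
    gcongr
    norm_num
  have hlk : l ≤ k := by
    rw [hk]
    have h1 : l ≤ (2000 * l) ^ 2 := by nlinarith
    calc l = 1 * l * 1 := by ring
      _ ≤ m * (2000 * l) ^ 2 * 2 ^ L :=
        Nat.mul_le_mul (Nat.mul_le_mul hm1 h1) Nat.one_le_two_pow
  have hln : l ≤ n := by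
    have : 1 * k ≤ m * k := Nat.mul_le_mul_right _ hm1
    omega
  have main := roth_param hp A m l k n dM hm1 hl1 hk1 hn1 hdM1 α hα hα1
    (by
      rw [hm, pow_succ]
      have : 2 / α = 2 * (1 / α) := by ring
      rw [this]; linarith)
    (by
      have hk0 : (0 : ℝ) < k := by exact_mod_cast hk1
      have hl0 : (0 : ℝ) < l := by exact_mod_cast hl1
      have hm0 : (0 : ℝ) < m := by exact_mod_cast hm1
      have : (m : ℝ) / k = (1 / (2000 * l)) ^ 2 * (1 / 2) ^ L := by
        rw [hk]; push_cast; rw [one_div_pow (2 : ℝ)]; field_simp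
      rw [this]; gcongr)
    (by
      have : (n : ℝ) / 64 = ((3 + m * k : ℕ) : ℝ) := by
        rw [hn]; push_cast; ring
      rw [this, ← Real.exp_one_pow, show (8 : ℝ) = 2 ^ 3 by norm_num, ← pow_add]
      apply pow_lt_pow_left₀ _ (by norm_num) (by omega)
      have := Real.exp_one_gt_d9
      linarith)
    (by
      refine le_trans ?_ hpow
      obtain ⟨l', rfl⟩ : ∃ l', l = l' + 1 := ⟨l - 1, by omega⟩
      have h1 : (1 / 4 : ℝ) ^ (l' + 1) = (1 / 2) ^ (l' + 1) * (1 / 2) ^ (l' + 1) := by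
        rw [← mul_pow]; norm_num
      have h2 : (1 / 2 : ℝ) ^ (l' + 1) ≤ 1 / 2 := pow_le_of_le_one (by norm_num) (by norm_num) (by omega)
      have h3 : (0 : ℝ) < (1 / 2 : ℝ) ^ (l' + 1) := by positivity
      rw [h1]
      nlinarith)
    ((1 / 2) ^ (l + 1)) (by positivity) (pow_le_one₀ (by norm_num) (by norm_num))
    (by
      refine le_trans (le_of_eq ?_) hpow
      rw [pow_succ]; ring)
    (100 * L)
    (by
      have h1 : (2 : ℝ) ≤ (101 / 100) ^ 100 := by
        have := one_add_mul_le_pow (a := (1 / 100 : ℝ)) (by norm_num) 100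
        norm_num at this ⊢
      have h2 : (2 : ℝ) ^ L ≤ (101 / 100) ^ (100 * L + 1) := by
        calc (2 : ℝ) ^ L ≤ ((101 / 100) ^ 100) ^ L := by gcongr
          _ = (101 / 100) ^ (100 * L) := by rw [pow_mul]
          _ ≤ _ := pow_le_pow_right₀ (by norm_num) (by omega)
      rw [div_lt_iff₀ hα] at hαL
      refine hαL.trans_le ?_
      gcongr)
    (by rw [hdM]) hA
  refine le_trans ?_ main
  -- numeric bounds
  have hL2 : L ≤ 2 ^ L := Nat.lt_two_pow_self.le
  have hl16 : l ≤ 16 * L ^ 2 := by rw [hl]; nlinarith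
  have hm2 : m ≤ 2 * L := by omega
  have hdMle : dM ≤ 2 ^ 45 * L ^ 7 * 2 ^ L := by
    have h1 : m * k ≤ 4096000000 * (L ^ 6 * 2 ^ L) := by
      rw [hk]
      calc m * (m * (2000 * l) ^ 2 * 2 ^ L) ≤ (2 * L) * ((2 * L) * (2000 * (16 * L ^ 2)) ^ 2 * 2 ^ L) := by
            gcongr
        _ = _ := by ring
    have h2 : 1 ≤ L ^ 6 * 2 ^ L := Nat.pos_of_ne_zero (by positivity)
    have h3 : n ≤ 2 ^ 38 * (L ^ 6 * 2 ^ L) := by omega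
    rw [hdM]
    calc (100 * L + 1) * n ≤ (2 ^ 7 * L) * (2 ^ 38 * (L ^ 6 * 2 ^ L)) := by
          gcongr; omega
      _ = _ := by ring
  have hdM2 : dM ≤ 2 ^ (45 + 8 * L) := by
    calc dM ≤ 2 ^ 45 * L ^ 7 * 2 ^ L := hdMle
      _ ≤ 2 ^ 45 * (2 ^ L) ^ 7 * 2 ^ L := by gcongr
      _ = _ := by rw [← pow_mul, ← pow_add, ← pow_add]; congr 1; ring
  have hrr : (1 / 2 : ℝ) ^ (530 * L ^ 2) ≤ rr ((1 / 2) ^ (l + 1)) l n dM := by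
    rw [rr_eq _ _ _ _ hl1 hn1 hdM1]
    have hl0 : (0 : ℝ) < l := by exact_mod_cast hl1
    have hn0 : (0 : ℝ) < n := by exact_mod_cast hn1
    have hd0 : (0 : ℝ) < dM := by exact_mod_cast hdM1
    have c1 : (4000 ^ 4 * 320 * 16384 * (dM : ℝ) ^ 5 * l * n ^ 2) ≤ 2 ^ 71 * (2 ^ (45 + 8 * L)) ^ 8 := by
      have d1 : (l : ℝ) ≤ dM := by exact_mod_cast hln.trans hnd
      have d2 : (n : ℝ) ≤ dM := by exact_mod_cast hnd
      have d3 : (dM : ℝ) ≤ 2 ^ (45 + 8 * L) := by exact_mod_cast hdM2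
      calc (4000 ^ 4 * 320 * 16384 * (dM : ℝ) ^ 5 * l * n ^ 2)
          ≤ 2 ^ 71 * (dM : ℝ) ^ 5 * dM * dM ^ 2 := by gcongr; norm_num
        _ = 2 ^ 71 * (dM : ℝ) ^ 8 := by ring
        _ ≤ _ := by gcongr
    calc (1 / 2 : ℝ) ^ (530 * L ^ 2) ≤ (1 / 2) ^ ((l + 1) * 2 + (71 + (45 + 8 * L) * 8)) := by
          apply pow_le_pow_of_le_one (by norm_num) (by norm_num)
          nlinarith
      _ = ((1 / 2 : ℝ) ^ (l + 1)) ^ 2 / (2 ^ 71 * (2 ^ (45 + 8 * L)) ^ 8) := by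
          rw [← pow_mul, ← pow_mul, ← pow_add, pow_add, one_div, inv_pow, inv_pow, div_eq_mul_inv]
      _ ≤ _ := by gcongr
  have hR : (1 / 2 : ℝ) ^ (107100 * L ^ 3) ≤
      (rr ((1 / 2) ^ (l + 1)) l n dM ^ (100 * L + 1)) ^ 2 / 121 := by
    calc (1 / 2 : ℝ) ^ (107100 * L ^ 3) ≤ (1 / 2 : ℝ) ^ (530 * L ^ 2 * (100 * L + 1) * 2 + 7) := by
          apply pow_le_pow_of_le_one (by norm_num) (by norm_num)
          have h1 : L ^ 2 ≤ L ^ 3 := Nat.pow_le_pow_right hL (by norm_num)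
          have h2 : 1 ≤ L ^ 3 := Nat.one_le_pow _ _ hL
          have h3 : 530 * L ^ 2 * (100 * L + 1) * 2 + 7 = 106000 * L ^ 3 + 1060 * L ^ 2 + 7 := by ring
          omega
      _ = (((1 / 2 : ℝ) ^ (530 * L ^ 2)) ^ (100 * L + 1)) ^ 2 * (1 / 2) ^ 7 := by
          rw [pow_add, pow_mul, pow_mul]
      _ ≤ (rr ((1 / 2) ^ (l + 1)) l n dM ^ (100 * L + 1)) ^ 2 * (1 / 121) := by
          gcongr
          norm_num
      _ = _ := by ring
  set Q := (rr ((1 / 2) ^ (l + 1)) l n dM ^ (100 * L + 1)) ^ 2 / 121 with hQ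
  calc (p : ℝ) ^ 2 * (1 / 2 : ℝ) ^ (2 ^ 64 * L ^ 10 * 2 ^ L)
      ≤ (p : ℝ) ^ 2 * (1 / 2 : ℝ) ^ (L * 3 + 1 + 107100 * L ^ 3 * dM * 2) := by
        apply mul_le_mul_of_nonneg_left _ (by positivity)
        apply pow_le_pow_of_le_one (by norm_num) (by norm_num)
        have h1 : L ≤ L ^ 10 := Nat.le_self_pow (by norm_num) L
        have h2 : L ^ 10 ≤ L ^ 10 * 2 ^ L := Nat.le_mul_of_pos_right _ (by positivity)
        have h3 : 107100 * L ^ 3 * dM * 2 ≤ 214200 * 2 ^ 45 * (L ^ 10 * 2 ^ L) := by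
          calc 107100 * L ^ 3 * dM * 2 ≤ 107100 * L ^ 3 * (2 ^ 45 * L ^ 7 * 2 ^ L) * 2 := by gcongr
            _ = _ := by ring
        rw [mul_assoc (2 ^ 64)]
        generalize L ^ 10 * 2 ^ L = X at *
        generalize L ^ 10 = Y at *
        omega
    _ = ((1 / 2 : ℝ) ^ L) ^ 3 / 2 * ((p : ℝ) * ((1 / 2 : ℝ) ^ (107100 * L ^ 3)) ^ dM) ^ 2 := by
        rw [pow_add, pow_add, pow_mul, pow_mul, pow_mul]; ring
    _ ≤ α ^ 3 / 2 * (p * Q ^ dM) ^ 2 := by gcongr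

theorem roth_final : ∃ C : ℝ, 0 < C ∧ ∀ (p : ℕ) [Fact p.Prime], Odd p →
    ∀ (A : Finset (ZMod p)) (α : ℝ), 0 < α → α ≤ 1 → α * p ≤ A.card →
    (p : ℝ) ^ 2 * Real.exp (-(C * (1 / α) ^ (3 / 2 : ℝ))) ≤ Nap A := by
  obtain ⟨C, hC, h⟩ := poly_exp
  refine ⟨2 ^ 64 * C * 2 ^ (3 / 2 : ℝ), by positivity, ?_⟩
  intro p _ hp A α hα hα1 hA
  obtain ⟨L0, hL0, hL1⟩ := exists_nat_pow_near (x := 1 / α) (y := (2 : ℝ))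
    (by rw [le_div_iff₀ hα]; linarith) (by norm_num)
  have h1 := roth_final_L p hp A α (L0 + 1) (by omega) hα hα1 hL1 hA
  refine le_trans ?_ h1
  apply mul_le_mul_of_nonneg_left _ (by positivity)
  have h2 : (1 / 2 : ℝ) ^ (2 ^ 64 * (L0 + 1) ^ 10 * 2 ^ (L0 + 1)) =
      Real.exp (-((2 ^ 64 * (L0 + 1) ^ 10 * 2 ^ (L0 + 1) : ℕ) * Real.log 2)) := by
    rw [one_div, inv_pow, Real.exp_neg, ← Real.log_pow, Real.exp_log (by positivity)]
  rw [h2]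
  apply Real.exp_le_exp.2
  apply neg_le_neg
  have hl2 : Real.log 2 ≤ 1 := by have := Real.log_two_lt_d9; linarith
  have h3 := h (L0 + 1)
  have h4 : ((2 : ℝ) ^ (L0 + 1)) ^ (3 / 2 : ℝ) ≤ 2 ^ (3 / 2 : ℝ) * (1 / α) ^ (3 / 2 : ℝ) := by
    rw [← Real.mul_rpow (by norm_num) (by positivity)]
    apply Real.rpow_le_rpow (by positivity) _ (by norm_num)
    rw [pow_succ]; linarith
  have h5 : ((2 ^ 64 * (L0 + 1) ^ 10 * 2 ^ (L0 + 1) : ℕ) : ℝ) =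
      2 ^ 64 * (((L0 + 1 : ℕ) : ℝ) ^ 10 * 2 ^ (L0 + 1)) := by push_cast; ring
  rw [h5]
  have h6 : ((L0 + 1 : ℕ) : ℝ) ^ 10 * 2 ^ (L0 + 1) ≤ C * (2 ^ (3 / 2 : ℝ) * (1 / α) ^ (3 / 2 : ℝ)) :=
    h3.trans (mul_le_mul_of_nonneg_left h4 hC.le)
  calc 2 ^ 64 * (((L0 + 1 : ℕ) : ℝ) ^ 10 * 2 ^ (L0 + 1)) * Real.log 2
      ≤ 2 ^ 64 * (((L0 + 1 : ℕ) : ℝ) ^ 10 * 2 ^ (L0 + 1)) * 1 :=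
        mul_le_mul_of_nonneg_left hl2 (by positivity)
    _ ≤ 2 ^ 64 * (C * (2 ^ (3 / 2 : ℝ) * (1 / α) ^ (3 / 2 : ℝ))) := by
        rw [mul_one]
        exact mul_le_mul_of_nonneg_left h6 (by positivity)
    _ = _ := by ring

end RothAP


namespace RothAP
open Finset

section
variable {p : ℕ} [Fact p.Prime]

noncomputable def TT (f : ZMod p → ℝ) : ℝ := ∑ n, ∑ d, f n * f (n + d) * f (n + 2 * d)

lemma sum_shift (F : ZMod p → ℝ) (a : ZMod p) : ∑ x, F (x + a) = ∑ x, F x :=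
  Equiv.sum_comp (Equiv.addRight a) F

lemma sum_shift' (F : ZMod p → ℝ) (a : ZMod p) : ∑ x, F (a + x) = ∑ x, F x :=
  Equiv.sum_comp (Equiv.addLeft a) F

lemma sum_dil (F : ZMod p → ℝ) (a : ZMod p) (ha : a ≠ 0) : ∑ x, F (a * x) = ∑ x, F x :=
  Equiv.sum_comp (Equiv.mulLeft₀ a ha) F

lemma sum_aff (G : ZMod p → ZMod p → ℝ) (n d : ZMod p) (hd : d ≠ 0) :
    ∑ t, ∑ s, G (t * n + s) (t * d) = ∑ x, ∑ y, G x y := by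
  rw [sum_comm (f := fun x y => G x y)]
  rw [← sum_dil (fun y => ∑ x, G x y) d hd]
  apply sum_congr rfl
  intro t _
  rw [sum_shift' (fun x => G x (t * d)), mul_comm t d]

lemma expand (hp : Odd p) (Φ : ZMod p → ℝ) (h0 : ∑ x, Φ x = 0) (a1 a2 a3 b1 b2 b3 : ℝ) :
    ∑ x, ∑ y, (a1 + b1 * Φ x) * (a2 + b2 * Φ (x + y)) * (a3 + b3 * Φ (x + 2 * y)) =
      (p : ℝ) ^ 2 * (a1 * a2 * a3) + b1 * b2 * b3 * TT Φ := by
  have z1 : ∀ x, ∑ y, Φ (x + y) = 0 := fun x => by rw [sum_shift', h0]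
  have z2 : ∀ x, ∑ y, Φ (x + 2 * y) = 0 := fun x => by
    rw [sum_dil (fun y => Φ (x + y)) 2 (two_ne hp), z1]
  have S1 : ∑ x, ∑ y : ZMod p, Φ x = 0 := by
    rw [sum_comm]; simp [h0]
  have S2 : ∑ x, ∑ y : ZMod p, Φ (x + y) = 0 := by simp [z1]
  have S3 : ∑ x, ∑ y : ZMod p, Φ (x + 2 * y) = 0 := by simp [z2]
  have S12 : ∑ x, ∑ y : ZMod p, Φ x * Φ (x + y) = 0 := by simp [← mul_sum, z1]
  have S13 : ∑ x, ∑ y : ZMod p, Φ x * Φ (x + 2 * y) = 0 := by simp [← mul_sum, z2]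
  have S23 : ∑ x, ∑ y : ZMod p, Φ (x + y) * Φ (x + 2 * y) = 0 := by
    rw [sum_comm, ← S12, sum_comm (f := fun x y => Φ x * Φ (x + y))]
    apply sum_congr rfl
    intro y _
    rw [← sum_shift (fun x => Φ x * Φ (x + y)) y]
    apply sum_congr rfl
    intro x _
    rw [add_assoc, two_mul]
  have e : ∀ x y : ZMod p, (a1 + b1 * Φ x) * (a2 + b2 * Φ (x + y)) * (a3 + b3 * Φ (x + 2 * y)) =
      a1 * a2 * a3 + (b1 * a2 * a3) * Φ x + (a1 * b2 * a3) * Φ (x + y) +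
      (a1 * a2 * b3) * Φ (x + 2 * y) + (b1 * b2 * a3) * (Φ x * Φ (x + y)) +
      (b1 * a2 * b3) * (Φ x * Φ (x + 2 * y)) + (a1 * b2 * b3) * (Φ (x + y) * Φ (x + 2 * y)) +
      (b1 * b2 * b3) * (Φ x * Φ (x + y) * Φ (x + 2 * y)) := by
    intro x y; ring
  simp_rw [e, sum_add_distrib, ← mul_sum]
  simp_rw [← mul_sum] at S12 S13
  rw [S1, S2, S3, S12, S13, S23, TT]
  simp only [sum_const, card_univ, ZMod.card, nsmul_eq_mul, ← mul_sum]
  ring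

lemma TT_const_add (hp : Odd p) (Φ : ZMod p → ℝ) (h0 : ∑ x, Φ x = 0) (a b : ℝ) :
    TT (fun x => a + b * Φ x) = (p : ℝ) ^ 2 * a ^ 3 + b ^ 3 * TT Φ := by
  rw [TT, expand hp Φ h0]
  ring

lemma exists_Phi (hp : Odd p) (h54 : 54 ≤ p) : ∃ Φ : ZMod p → ℝ, ∑ x, Φ x = 0 ∧ (∀ x, |Φ x| ≤ 1) ∧
    TT Φ ≤ -((p : ℝ) ^ 2 / 23328) := by
  classical
  obtain ⟨M, hM⟩ : ∃ M, M = p / 54 := ⟨_, rfl⟩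
  have hM1 : 54 * M ≤ p := by omega
  have hM2 : p ≤ 108 * M := by omega
  have hM1r : 54 * (M : ℝ) ≤ p := by exact_mod_cast hM1
  have hM2r : (p : ℝ) ≤ 108 * M := by exact_mod_cast hM2
  have hp0 : (0 : ℝ) < p := by exact_mod_cast (by omega : 0 < p)
  have card_im : ∀ N, N ≤ p → ((range N).image (fun i : ℕ => (i : ZMod p))).card = N := by
    intro N hN
    rw [card_image_of_injOn, card_range]
    intro i hi j hj hij
    simp only [coe_range, Set.mem_Iio] at hi hj
    have := (ZMod.natCast_eq_natCast_iff' i j p).1 hij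
    rwa [Nat.mod_eq_of_lt (by omega), Nat.mod_eq_of_lt (by omega)] at this
  set J := (range (3 * M)).image (fun i : ℕ => (i : ZMod p)) with hJ
  set I := (range M).image (fun i : ℕ => (i : ZMod p)) with hI
  have hJc : J.card = 3 * M := card_im _ (by omega)
  have hIc : I.card = M := card_im _ (by omega)
  set b : ℝ := 3 * M / p with hb
  have hb0 : 0 ≤ b := by positivity
  have hb1 : b ≤ 1 := by rw [hb, div_le_one hp0]; linarith
  set j : ZMod p → ℝ := fun x => if x ∈ J then 1 else 0 with hj
  have hj0 : ∀ x, 0 ≤ j x := fun x => by simp only [hj]; split_ifs <;> norm_num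
  have hj1 : ∀ x, j x ≤ 1 := fun x => by simp only [hj]; split_ifs <;> norm_num
  have h0 : ∑ x, (b - j x) = 0 := by
    rw [sum_sub_distrib]
    simp only [hj, sum_boole, sum_const, card_univ, ZMod.card, nsmul_eq_mul, filter_mem_eq_inter,
      univ_inter, hJc, hb]
    push_cast
    field_simp
    ring
  refine ⟨fun x => b - j x, h0, ?_, ?_⟩
  · intro x
    rw [abs_le]
    constructor <;> linarith [hj0 x, hj1 x]
  · have h1 := TT_const_add hp _ h0 b (-1)
    have h2 : TT (fun x => b + -1 * (b - j x)) = TT j := by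
      congr 1; ext x; ring
    rw [h2] at h1
    have h3 : (M : ℝ) ^ 2 ≤ TT j := by
      calc (M : ℝ) ^ 2 = ∑ n ∈ I, ∑ d ∈ I, (1 : ℝ) := by
            simp [hIc]; ring
        _ = ∑ n ∈ I, ∑ d ∈ I, j n * j (n + d) * j (n + 2 * d) := by
            apply sum_congr rfl
            intro n hn
            apply sum_congr rfl
            intro d hd
            obtain ⟨n', hn', rfl⟩ := mem_image.1 hn
            obtain ⟨d', hd', rfl⟩ := mem_image.1 hd
            rw [mem_range] at hn' hd'
            have k : ∀ e : ℕ, e < 3 * M → j (e : ZMod p) = 1 := by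
              intro e he
              simp only [hj]
              rw [if_pos]
              exact mem_image.2 ⟨e, mem_range.2 he, rfl⟩
            have k1 := k n' (by omega)
            have k2 := k (n' + d') (by omega)
            have k3 := k (n' + 2 * d') (by omega)
            push_cast at k2 k3
            rw [k1, k2, k3]; norm_num
        _ ≤ ∑ n ∈ I, ∑ d, j n * j (n + d) * j (n + 2 * d) := by
            apply sum_le_sum
            intro n _
            apply sum_le_sum_of_subset_of_nonneg (subset_univ _)
            intro d _ _
            have := hj0 n; have := hj0 (n + d); have := hj0 (n + 2 * d)
            positivity
        _ ≤ TT j := by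
            apply sum_le_sum_of_subset_of_nonneg (subset_univ _)
            intro n _ _
            apply sum_nonneg
            intro d _
            have := hj0 n; have := hj0 (n + d); have := hj0 (n + 2 * d)
            positivity
    have h4 : (p : ℝ) ^ 2 * b ^ 3 ≤ (M : ℝ) ^ 2 / 2 := by
      have : (p : ℝ) ^ 2 * b ^ 3 = (M : ℝ) ^ 2 * (27 * M / p) := by
        rw [hb]; field_simp; ring
      rw [this, div_eq_mul_one_div ((M : ℝ) ^ 2)]
      apply mul_le_mul_of_nonneg_left _ (by positivity)
      rw [div_le_iff₀ hp0]; linarith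
    have h5 : (p : ℝ) ^ 2 ≤ 11664 * (M : ℝ) ^ 2 := by
      calc (p : ℝ) ^ 2 ≤ (108 * M) ^ 2 := by gcongr
        _ = _ := by ring
    linarith

lemma TT_close (f g : ZMod p → ℝ) (ε : ℝ) (hf : ∀ n, |f n| ≤ 1) (hg : ∀ n, |g n| ≤ 1)
    (hε : ∀ n, |f n - g n| ≤ ε) : TT f ≤ TT g + (p : ℝ) ^ 2 * (3 * ε) := by
  have h : ∀ n d : ZMod p, f n * f (n + d) * f (n + 2 * d) ≤ g n * g (n + d) * g (n + 2 * d) + 3 * ε := by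
    intro n d
    have e0 : 0 ≤ ε := (abs_nonneg _).trans (hε n)
    have b1 : (f n - g n) * f (n + d) * f (n + 2 * d) ≤ ε := by
      refine (le_abs_self _).trans ?_
      rw [abs_mul, abs_mul]
      calc _ ≤ ε * 1 * 1 := by
            gcongr
            · exact hε _
            · exact hf _
            · exact hf _
        _ = ε := by ring
    have b2 : g n * (f (n + d) - g (n + d)) * f (n + 2 * d) ≤ ε := by
      refine (le_abs_self _).trans ?_
      rw [abs_mul, abs_mul]
      calc _ ≤ 1 * ε * 1 := by
            gcongr
            · exact hg _
            · exact hε _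
            · exact hf _
        _ = ε := by ring
    have b3 : g n * g (n + d) * (f (n + 2 * d) - g (n + 2 * d)) ≤ ε := by
      refine (le_abs_self _).trans ?_
      rw [abs_mul, abs_mul]
      calc _ ≤ 1 * 1 * ε := by
            gcongr
            · exact hg _
            · exact hg _
            · exact hε _
        _ = ε := by ring
    linarith
  calc TT f ≤ ∑ n : ZMod p, ∑ d : ZMod p, (g n * g (n + d) * g (n + 2 * d) + 3 * ε) :=
        sum_le_sum fun n _ => sum_le_sum fun d _ => h n d
    _ = _ := by
        simp only [sum_add_distrib, sum_const, card_univ, ZMod.card, nsmul_eq_mul, TT]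
        ring

end
end RothAP


namespace RothAP
open Finset

section
variable {p : ℕ} [Fact p.Prime]

lemma psi_pair (hp : Odd p) (Φ : ZMod p → ℝ) (h0 : ∑ x, Φ x = 0) (n m : ZMod p) (h : n ≠ m) :
    ∑ t, ∑ s, Φ (t * n + s) * Φ (t * m + s) = 0 := by
  have h1 := sum_aff (fun x y => Φ x * Φ (x + y)) n (m - n) (sub_ne_zero.2 (Ne.symm h))
  have h2 : ∑ x, ∑ y, Φ x * Φ (x + y) = 0 := by
    simp only [← mul_sum]
    apply sum_eq_zero
    intro x _
    rw [sum_shift', h0, mul_zero]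
  rw [h2] at h1
  rw [← h1]
  apply sum_congr rfl
  intro t _
  apply sum_congr rfl
  intro s _
  congr 2
  ring

lemma psi_sq (hp : Odd p) (Φ : ZMod p → ℝ) (h0 : ∑ x, Φ x = 0) (h1 : ∀ x, |Φ x| ≤ 1)
    (w : ZMod p → ℝ) (hw0 : ∀ n, 0 ≤ w n) (hw1 : ∀ n, w n ≤ 1) :
    ∑ t, ∑ s, (∑ n, w n * Φ (t * n + s)) ^ 2 ≤ (p : ℝ) ^ 2 * ∑ n, w n := by
  have e : ∑ t, ∑ s, (∑ n, w n * Φ (t * n + s)) ^ 2 =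
      ∑ n, ∑ m, w n * w m * ∑ t, ∑ s, Φ (t * n + s) * Φ (t * m + s) := by
    simp_rw [pow_two, sum_mul_sum, mul_sum]
    calc _ = ∑ t, ∑ n, ∑ s, ∑ m, w n * Φ (t * n + s) * (w m * Φ (t * m + s)) := by
          apply sum_congr rfl; intro t _; rw [sum_comm]
      _ = ∑ t, ∑ n, ∑ m, ∑ s, w n * Φ (t * n + s) * (w m * Φ (t * m + s)) := by
          apply sum_congr rfl; intro t _; apply sum_congr rfl; intro n _; rw [sum_comm]
      _ = ∑ n, ∑ t, ∑ m, ∑ s, w n * Φ (t * n + s) * (w m * Φ (t * m + s)) := by rw [sum_comm]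
      _ = ∑ n, ∑ m, ∑ t, ∑ s, w n * Φ (t * n + s) * (w m * Φ (t * m + s)) := by
          apply sum_congr rfl; intro n _; rw [sum_comm]
      _ = _ := by
          apply sum_congr rfl; intro n _; apply sum_congr rfl; intro m _
          apply sum_congr rfl; intro t _; apply sum_congr rfl; intro s _; ring
  rw [e, mul_sum]
  apply sum_le_sum
  intro n _
  rw [sum_eq_single n]
  · have b : ∑ t, ∑ s, Φ (t * n + s) * Φ (t * n + s) ≤ (p : ℝ) ^ 2 := by
      calc ∑ t, ∑ s, Φ (t * n + s) * Φ (t * n + s) ≤ ∑ t : ZMod p, ∑ s : ZMod p, (1 : ℝ) := by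
            apply sum_le_sum; intro t _; apply sum_le_sum; intro s _
            have := h1 (t * n + s)
            rw [← pow_two, ← sq_abs]
            exact pow_le_one₀ (abs_nonneg _) this
        _ = _ := by simp [ZMod.card, pow_two]
    calc w n * w n * ∑ t, ∑ s, Φ (t * n + s) * Φ (t * n + s) ≤ w n * w n * (p : ℝ) ^ 2 :=
          mul_le_mul_of_nonneg_left b (mul_nonneg (hw0 n) (hw0 n))
      _ ≤ w n * 1 * (p : ℝ) ^ 2 := by
          have := hw0 n; have := hw1 n
          gcongr
      _ = _ := by ring
  · intro m _ hm
    rw [psi_pair hp Φ h0 n m (Ne.symm hm), mul_zero]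
  · simp

lemma avg_TT (hp : Odd p) (Φ : ZMod p → ℝ) (h0 : ∑ x, Φ x = 0) (h1 : ∀ x, |Φ x| ≤ 1)
    (f w : ZMod p → ℝ) (hw0 : ∀ n, 0 ≤ w n) (hwf : ∀ n, w n ≤ f n) (hwf1 : ∀ n, w n ≤ 1 - f n) :
    ∑ t, ∑ s, TT (fun n => f n + w n / 2 * Φ (t * n + s)) ≤
      (p : ℝ) ^ 2 * TT f + TT Φ / 8 * TT w + 2 * (p : ℝ) ^ 3 := by
  have hp0 : (0 : ℝ) < p := by exact_mod_cast (Fact.out : p.Prime).pos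
  have hTΦ : -(p : ℝ) ^ 2 ≤ TT Φ := by
    have : ∑ n : ZMod p, ∑ d : ZMod p, (-1 : ℝ) ≤ TT Φ := by
      apply sum_le_sum; intro n _; apply sum_le_sum; intro d _
      have : |Φ n * Φ (n + d) * Φ (n + 2 * d)| ≤ 1 := by
        rw [abs_mul, abs_mul]
        exact mul_le_one₀ (mul_le_one₀ (h1 _) (abs_nonneg _) (h1 _)) (abs_nonneg _) (h1 _)
      exact (abs_le.1 this).1
    refine le_trans (le_of_eq ?_) this
    simp [ZMod.card, pow_two]
  have e : ∑ t, ∑ s, TT (fun n => f n + w n / 2 * Φ (t * n + s)) =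
      ∑ n, ∑ d, ∑ t, ∑ s, (f n + w n / 2 * Φ (t * n + s)) *
        (f (n + d) + w (n + d) / 2 * Φ (t * (n + d) + s)) *
        (f (n + 2 * d) + w (n + 2 * d) / 2 * Φ (t * (n + 2 * d) + s)) := by
    unfold TT
    calc _ = ∑ t, ∑ n, ∑ s, ∑ d, (f n + w n / 2 * Φ (t * n + s)) *
        (f (n + d) + w (n + d) / 2 * Φ (t * (n + d) + s)) *
        (f (n + 2 * d) + w (n + 2 * d) / 2 * Φ (t * (n + 2 * d) + s)) := by
          apply sum_congr rfl; intro t _; rw [sum_comm]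
      _ = ∑ t, ∑ n, ∑ d, ∑ s, (f n + w n / 2 * Φ (t * n + s)) *
        (f (n + d) + w (n + d) / 2 * Φ (t * (n + d) + s)) *
        (f (n + 2 * d) + w (n + 2 * d) / 2 * Φ (t * (n + 2 * d) + s)) := by
          apply sum_congr rfl; intro t _; apply sum_congr rfl; intro n _; rw [sum_comm]
      _ = ∑ n, ∑ t, ∑ d, ∑ s, (f n + w n / 2 * Φ (t * n + s)) *
        (f (n + d) + w (n + d) / 2 * Φ (t * (n + d) + s)) *
        (f (n + 2 * d) + w (n + 2 * d) / 2 * Φ (t * (n + 2 * d) + s)) := by rw [sum_comm]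
      _ = _ := by
          apply sum_congr rfl; intro n _; rw [sum_comm]
  have key : ∀ n d : ZMod p, ∑ t, ∑ s, (f n + w n / 2 * Φ (t * n + s)) *
        (f (n + d) + w (n + d) / 2 * Φ (t * (n + d) + s)) *
        (f (n + 2 * d) + w (n + 2 * d) / 2 * Φ (t * (n + 2 * d) + s)) ≤
      (p : ℝ) ^ 2 * (f n * f (n + d) * f (n + 2 * d)) +
        TT Φ / 8 * (w n * w (n + d) * w (n + 2 * d)) + (if d = 0 then 2 * (p : ℝ) ^ 2 else 0) := by
    intro n d
    have hf0 : ∀ n, 0 ≤ f n := fun n => (hw0 n).trans (hwf n)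
    have hw1 : ∀ n, w n ≤ 1 := fun n => by linarith [hwf n, hwf1 n]
    split_ifs with hd
    · have b : ∀ n t s, 0 ≤ f n + w n / 2 * Φ (t * n + s) ∧ f n + w n / 2 * Φ (t * n + s) ≤ 1 := by
        intro n t s
        have a1 := abs_le.1 (h1 (t * n + s))
        have a2 : |w n / 2 * Φ (t * n + s)| ≤ w n := by
          rw [abs_mul, abs_of_nonneg (by linarith [hw0 n])]
          calc w n / 2 * |Φ (t * n + s)| ≤ w n / 2 * 1 :=
                mul_le_mul_of_nonneg_left (h1 _) (by linarith [hw0 n])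
            _ ≤ w n := by linarith [hw0 n]
        have a3 := abs_le.1 a2
        constructor <;> linarith [hwf n, hwf1 n]
      have u : ∑ t, ∑ s, (f n + w n / 2 * Φ (t * n + s)) *
        (f (n + d) + w (n + d) / 2 * Φ (t * (n + d) + s)) *
        (f (n + 2 * d) + w (n + 2 * d) / 2 * Φ (t * (n + 2 * d) + s)) ≤ (p : ℝ) ^ 2 := by
        calc _ ≤ ∑ t : ZMod p, ∑ s : ZMod p, (1 : ℝ) := by
              apply sum_le_sum; intro t _; apply sum_le_sum; intro s _
              exact mul_le_one₀ (mul_le_one₀ (b _ _ _).2 (b _ _ _).1 (b _ _ _).2) (b _ _ _).1 (b _ _ _).2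
          _ = _ := by simp [ZMod.card, pow_two]
      have v1 : 0 ≤ f n * f (n + d) * f (n + 2 * d) :=
        mul_nonneg (mul_nonneg (hf0 _) (hf0 _)) (hf0 _)
      have v2 : 0 ≤ w n * w (n + d) * w (n + 2 * d) :=
        mul_nonneg (mul_nonneg (hw0 _) (hw0 _)) (hw0 _)
      have v3 : w n * w (n + d) * w (n + 2 * d) ≤ 1 :=
        mul_le_one₀ (mul_le_one₀ (hw1 _) (hw0 _) (hw1 _)) (hw0 _) (hw1 _)
      have v4 : -(p : ℝ) ^ 2 * (w n * w (n + d) * w (n + 2 * d)) ≤ TT Φ * (w n * w (n + d) * w (n + 2 * d)) :=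
        mul_le_mul_of_nonneg_right hTΦ v2
      have v5 : (p : ℝ) ^ 2 * (w n * w (n + d) * w (n + 2 * d)) ≤ (p : ℝ) ^ 2 * 1 :=
        mul_le_mul_of_nonneg_left v3 (by positivity)
      have v6 : 0 ≤ (p : ℝ) ^ 2 * (f n * f (n + d) * f (n + 2 * d)) := by positivity
      have v7 : 0 < (p : ℝ) ^ 2 := by positivity
      linarith
    · apply le_of_eq
      have h3 := sum_aff (fun x y => (f n + w n / 2 * Φ x) * (f (n + d) + w (n + d) / 2 * Φ (x + y)) *
        (f (n + 2 * d) + w (n + 2 * d) / 2 * Φ (x + 2 * y))) n d hd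
      rw [expand hp Φ h0] at h3
      calc _ = _ := by
            apply sum_congr rfl; intro t _; apply sum_congr rfl; intro s _
            have e1 : t * (n + d) + s = t * n + s + t * d := by ring
            have e2 : t * (n + 2 * d) + s = t * n + s + 2 * (t * d) := by ring
            rw [e1, e2]
        _ = _ := h3
        _ = _ := by ring
  rw [e]
  calc _ ≤ _ := sum_le_sum fun n _ => sum_le_sum fun d _ => key n d
    _ = _ := by
      simp only [sum_add_distrib, ← mul_sum, sum_ite_eq', mem_univ, if_true, sum_const, card_univ,
        ZMod.card, nsmul_eq_mul, TT]
      ring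

lemma variation (hp : Odd p) (h54 : 54 ≤ p) (C₀ : ℝ) (f w : ZMod p → ℝ) (hw0 : ∀ n, 0 ≤ w n)
    (hwf : ∀ n, w n ≤ f n) (hwf1 : ∀ n, w n ≤ 1 - f n) (hW : 0 < ∑ n, w n)
    (H : ∀ g : ZMod p → ℝ, (∀ n, 0 ≤ g n) → (∀ n, g n ≤ 1) → ∑ n, g n = ∑ n, f n →
      TT f - C₀ * p ≤ TT g) :
    TT w ≤ 186624 * ((2 + C₀) * p + 2 * ((p : ℝ) ^ 2 / Real.sqrt (∑ n, w n))) := by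
  obtain ⟨Φ, h0, h1, hT⟩ := exists_Phi hp h54
  have hp0 : (0 : ℝ) < p := by exact_mod_cast (Fact.out : p.Prime).pos
  have hw1 : ∀ n, w n ≤ 1 := fun n => by linarith [hwf n, hwf1 n]
  set W := ∑ n, w n with hWdef
  set c : ZMod p → ZMod p → ℝ := fun t s => (∑ n, w n * Φ (t * n + s)) / W with hc
  have hc1 : ∀ t s, |c t s| ≤ 1 := by
    intro t s
    rw [hc]
    simp only
    rw [abs_div, abs_of_pos hW, div_le_one hW]
    refine (abs_sum_le_sum_abs _ _).trans ?_
    apply sum_le_sum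
    intro n _
    rw [abs_mul, abs_of_nonneg (hw0 n)]
    exact mul_le_of_le_one_right (hw0 n) (h1 _)
  have b : ∀ (c : ℝ) (n t s : ZMod p), |c| ≤ 1 →
      0 ≤ f n + w n / 2 * (Φ (t * n + s) - c) ∧ f n + w n / 2 * (Φ (t * n + s) - c) ≤ 1 := by
    intro c n t s hc
    have a2 : |w n / 2 * (Φ (t * n + s) - c)| ≤ w n := by
      rw [abs_mul, abs_of_nonneg (by linarith [hw0 n])]
      have a1 : |Φ (t * n + s) - c| ≤ 2 := by
        have := abs_sub (Φ (t * n + s)) c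
        linarith [h1 (t * n + s)]
      calc w n / 2 * |Φ (t * n + s) - c| ≤ w n / 2 * 2 :=
            mul_le_mul_of_nonneg_left a1 (by linarith [hw0 n])
        _ = w n := by ring
    have a3 := abs_le.1 a2
    constructor <;> linarith [hwf n, hwf1 n]
  have step : ∀ t s, TT f - C₀ * p ≤ TT (fun n => f n + w n / 2 * Φ (t * n + s)) +
      (p : ℝ) ^ 2 * (3 * (|c t s| / 2)) := by
    intro t s
    have e1 := H (fun n => f n + w n / 2 * (Φ (t * n + s) - c t s)) (fun n => (b _ n t s (hc1 t s)).1)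
      (fun n => (b _ n t s (hc1 t s)).2) (by
        rw [sum_add_distrib, add_eq_left]
        have : ∑ n, w n / 2 * (Φ (t * n + s) - c t s) = (∑ n, w n * Φ (t * n + s)) / 2 - c t s * W / 2 := by
          rw [hWdef, mul_sum, sum_div, sum_div, ← sum_sub_distrib]
          apply sum_congr rfl
          intro n _
          ring
        rw [this]
        have : c t s * W = ∑ n, w n * Φ (t * n + s) := div_mul_cancel₀ _ hW.ne'
        rw [this, sub_self])
    refine e1.trans ?_
    apply TT_close
    · intro n
      have := b _ n t s (hc1 t s)
      rw [abs_le]; constructor <;> linarith [this.1, this.2]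
    · intro n
      have := b 0 n t s (by simp)
      rw [sub_zero] at this
      rw [abs_le]; constructor <;> linarith [this.1, this.2]
    · intro n
      have : f n + w n / 2 * (Φ (t * n + s) - c t s) - (f n + w n / 2 * Φ (t * n + s)) =
          -(w n * (c t s / 2)) := by ring
      rw [this, abs_neg, abs_mul, abs_of_nonneg (hw0 n), abs_div, abs_of_pos (two_pos : (0 : ℝ) < 2)]
      exact mul_le_of_le_one_left (by positivity) (hw1 n)
  have hsum : ∑ t : ZMod p, ∑ s : ZMod p, (TT f - C₀ * p) ≤
      ∑ t, ∑ s, (TT (fun n => f n + w n / 2 * Φ (t * n + s)) + (p : ℝ) ^ 2 * (3 * (|c t s| / 2))) :=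
    sum_le_sum fun t _ => sum_le_sum fun s _ => step t s
  have hA := avg_TT hp Φ h0 h1 f w hw0 hwf hwf1
  have hcs : ∑ t, ∑ s, |c t s| ≤ (p : ℝ) ^ 2 / Real.sqrt W := by
    have q1 := psi_sq hp Φ h0 h1 w hw0 hw1
    have q2 : ∑ t, ∑ s, c t s ^ 2 ≤ (p : ℝ) ^ 2 / W := by
      have : ∑ t, ∑ s, c t s ^ 2 = (∑ t, ∑ s, (∑ n, w n * Φ (t * n + s)) ^ 2) / W ^ 2 := by
        rw [sum_div]
        apply sum_congr rfl; intro t _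
        rw [sum_div]
        apply sum_congr rfl; intro s _
        rw [hc, div_pow]
      rw [this, div_le_div_iff₀ (by positivity) hW]
      calc _ ≤ (p : ℝ) ^ 2 * W * W := mul_le_mul_of_nonneg_right q1 hW.le
        _ = _ := by ring
    have q3 : (∑ q : ZMod p × ZMod p, |c q.1 q.2|) ^ 2 ≤
        (univ : Finset (ZMod p × ZMod p)).card * ∑ q : ZMod p × ZMod p, |c q.1 q.2| ^ 2 :=
      sq_sum_le_card_mul_sum_sq
    simp only [sq_abs] at q3
    rw [Fintype.sum_prod_type, Fintype.sum_prod_type, card_univ, Fintype.card_prod, ZMod.card] at q3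
    have q4 : (∑ t, ∑ s, |c t s|) ^ 2 ≤ ((p : ℝ) ^ 2 / Real.sqrt W) ^ 2 := by
      refine q3.trans ?_
      rw [div_pow, Real.sq_sqrt hW.le]
      push_cast
      calc (p : ℝ) * p * ∑ t, ∑ s, c t s ^ 2 ≤ (p : ℝ) * p * ((p : ℝ) ^ 2 / W) :=
            mul_le_mul_of_nonneg_left q2 (by positivity)
        _ = _ := by ring
    exact le_of_sq_le_sq q4 (by positivity)
  have hTw : 0 ≤ TT w := sum_nonneg fun n _ => sum_nonneg fun d _ =>
    mul_nonneg (mul_nonneg (hw0 _) (hw0 _)) (hw0 _)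
  simp only [sum_add_distrib, ← mul_sum, sum_const, card_univ, ZMod.card, nsmul_eq_mul] at hsum
  simp only [← sum_div] at hsum
  set S := ∑ t, ∑ s, |c t s| with hS
  set Z := (p : ℝ) ^ 2 / Real.sqrt W with hZ
  have hTT : TT Φ * TT w ≤ -((p : ℝ) ^ 2 / 23328) * TT w := mul_le_mul_of_nonneg_right hT hTw
  have f1 : (p : ℝ) ^ 2 * S ≤ (p : ℝ) ^ 2 * Z := mul_le_mul_of_nonneg_left hcs (by positivity)
  have hZ0 : 0 ≤ (p : ℝ) ^ 2 * Z := by positivity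
  have f2 : (p : ℝ) ^ 2 * TT w ≤ (p : ℝ) ^ 2 * (186624 * ((2 + C₀) * p + 2 * Z)) := by
    nlinarith
  exact le_of_mul_le_mul_left f2 (by positivity)

end
end RothAP


namespace RothAP
open Finset

section
variable {p : ℕ} [Fact p.Prime]

lemma TT_ge_Nap (w : ZMod p → ℝ) (hw0 : ∀ n, 0 ≤ w n) (A : Finset (ZMod p)) (α : ℝ) (hα : 0 ≤ α)
    (hA : ∀ n ∈ A, α ≤ w n) : α ^ 3 * Nap A ≤ TT w := by
  classical
  rw [Nap, card_filter, TT, ← Fintype.sum_prod_type']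
  push_cast
  rw [mul_sum]
  apply sum_le_sum
  intro q _
  split_ifs with h
  · obtain ⟨a1, a2, a3⟩ := h
    calc α ^ 3 * 1 = α * α * α := by ring
      _ ≤ w q.1 * w (q.1 + q.2) * w (q.1 + 2 * q.2) := by
        have b1 := hA _ a1
        have b2 := hA _ a2
        have b3 := hA _ a3
        have := hw0 q.1
        have := hw0 (q.1 + q.2)
        gcongr
  · rw [mul_zero]
    exact mul_nonneg (mul_nonneg (hw0 _) (hw0 _)) (hw0 _)

lemma big_set (w : ZMod p → ℝ) (hw1 : ∀ n, w n ≤ 1) (α : ℝ) (hα0 : 0 ≤ α)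
    (hα : ∑ n, w n = 2 * α * p) :
    α * p ≤ (univ.filter fun n => α ≤ w n).card := by
  classical
  have h : ∀ n, w n ≤ (if α ≤ w n then (1 : ℝ) else 0) + α := by
    intro n
    split_ifs with h
    · linarith [hw1 n]
    · push Not at h; linarith
  have h2 : ∑ n, w n ≤ ∑ n : ZMod p, ((if α ≤ w n then (1 : ℝ) else 0) + α) := sum_le_sum fun n _ => h n
  rw [sum_add_distrib, sum_boole, sum_const, card_univ, ZMod.card, nsmul_eq_mul, hα] at h2
  linarith

end

lemma final_num : ∀ C₀ : ℝ, 0 < C₀ → ∃ K : ℝ, 0 < K ∧ ∀ (p : ℕ) [Fact p.Prime], Odd p →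
    ∀ f w : ZMod p → ℝ, (∀ n, 0 ≤ w n) → (∀ n, w n ≤ f n) → (∀ n, w n ≤ 1 - f n) →
    (∀ g : ZMod p → ℝ, (∀ n, 0 ≤ g n) → (∀ n, g n ≤ 1) → ∑ n, g n = ∑ n, f n →
      TT f - C₀ * p ≤ TT g) →
    ∑ n, w n ≤ K * p * (Real.log p) ^ (-(2 : ℝ) / 3) := by
  intro C₀ hC₀
  obtain ⟨C, hC, roth⟩ := roth_final
  set B : ℝ := 2 * 186624 * (4 + C₀) with hB
  have hB0 : 0 < B := by positivity
  set ℓ0 : ℝ := max (Real.log 54) (5 * Real.log B) with hℓ0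
  have hℓpos : 0 < ℓ0 := lt_of_lt_of_le (Real.log_pos (by norm_num)) (le_max_left _ _)
  set K1 : ℝ := 2 * (20 * (C + 1)) ^ (2 / 3 : ℝ) with hK1
  have hK1p : 0 < K1 := by positivity
  set K : ℝ := max K1 (ℓ0 ^ (2 / 3 : ℝ)) with hK
  have hKp : 0 < K := lt_of_lt_of_le hK1p (le_max_left _ _)
  refine ⟨K, hKp, ?_⟩
  intro p _ hp f w hw0 hwf hwf1 H
  have hp3 : 3 ≤ p := by
    have h2 := (Fact.out : p.Prime).two_le
    obtain ⟨r, hr⟩ := hp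
    omega
  have hp3r : (3 : ℝ) ≤ p := by exact_mod_cast hp3
  have hp0 : (0 : ℝ) < p := by linarith
  set ℓ := Real.log p with hℓ
  have hℓp : 0 < ℓ := Real.log_pos (by linarith)
  have hpe : (p : ℝ) = Real.exp ℓ := (Real.exp_log hp0).symm
  have hw1 : ∀ n, w n ≤ 1 := fun n => by linarith [hwf n, hwf1 n]
  have hWp : ∑ n, w n ≤ p := by
    calc ∑ n, w n ≤ ∑ n : ZMod p, (1 : ℝ) := sum_le_sum fun n _ => hw1 n
      _ = p := by simp [ZMod.card]
  have hneg : ∀ x : ℝ, 0 < x → x ^ (-(2 : ℝ) / 3) = (x ^ (2 / 3 : ℝ))⁻¹ := by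
    intro x hx
    rw [neg_div, Real.rpow_neg hx.le]
  rw [hneg ℓ hℓp]
  have hℓr : 0 < ℓ ^ (2 / 3 : ℝ) := by positivity
  by_contra hcon
  push Not at hcon
  set W := ∑ n, w n with hW
  rw [← div_eq_mul_inv, div_lt_iff₀ hℓr] at hcon
  have hWpos : 0 < W := by
    by_contra h
    push Not at h
    have h1 : W * ℓ ^ (2 / 3 : ℝ) ≤ 0 := mul_nonpos_of_nonpos_of_nonneg h hℓr.le
    have h2 : 0 < K * p := by positivity
    linarith
  -- threshold
  have hKl : K < ℓ ^ (2 / 3 : ℝ) := by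
    have h1 : W * ℓ ^ (2 / 3 : ℝ) ≤ p * ℓ ^ (2 / 3 : ℝ) := mul_le_mul_of_nonneg_right hWp hℓr.le
    have h2 : p * K < p * ℓ ^ (2 / 3 : ℝ) := by linarith
    exact lt_of_mul_lt_mul_left h2 hp0.le
  have hℓℓ : ℓ0 < ℓ := by
    have h1 : ℓ0 ^ (2 / 3 : ℝ) < ℓ ^ (2 / 3 : ℝ) := lt_of_le_of_lt (le_max_right _ _) hKl
    exact (Real.rpow_lt_rpow_iff hℓpos.le hℓp.le (by norm_num)).1 h1
  have h54 : 54 ≤ p := by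
    have h1 : Real.log 54 < Real.log p := lt_of_le_of_lt (le_max_left _ _) hℓℓ
    have h2 := (Real.log_lt_log_iff (by norm_num) hp0).1 h1
    exact_mod_cast h2.le
  have hBl : B < Real.exp (ℓ / 5) := by
    have h1 : 5 * Real.log B < ℓ := lt_of_le_of_lt (le_max_right _ _) hℓℓ
    rw [← Real.log_lt_iff_lt_exp hB0]
    linarith
  -- density
  set α : ℝ := W / (2 * p) with hα
  have hα0 : 0 < α := by positivity
  have hα1 : α ≤ 1 := by rw [hα, div_le_one (by positivity)]; linarith
  have hWα : W = 2 * α * p := by rw [hα]; field_simp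
  set y : ℝ := (1 / α) ^ (3 / 2 : ℝ) with hy
  have h1α : 1 ≤ 1 / α := by rw [le_div_iff₀ hα0]; linarith
  have hy1 : 1 / α ≤ y := by
    calc 1 / α = (1 / α) ^ (1 : ℝ) := (Real.rpow_one _).symm
      _ ≤ y := Real.rpow_le_rpow_of_exponent_le h1α (by norm_num)
  have hy2 : (1 / α) ^ 3 = y ^ 2 := by
    rw [hy, ← Real.rpow_natCast, ← Real.rpow_natCast, ← Real.rpow_mul (by positivity)]
    norm_num
  have hyℓ : 20 * (C + 1) * y ≤ ℓ := by
    have a1 : 1 / α * (K1 / 2) ≤ ℓ ^ (2 / 3 : ℝ) := by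
      have b1 : K1 * p ≤ W * ℓ ^ (2 / 3 : ℝ) :=
        le_trans (mul_le_mul_of_nonneg_right (le_max_left _ _) hp0.le) hcon.le
      rw [hWα] at b1
      have b2 : K1 / 2 ≤ α * ℓ ^ (2 / 3 : ℝ) := by
        have : p * K1 ≤ p * (2 * (α * ℓ ^ (2 / 3 : ℝ))) := by linarith
        have := le_of_mul_le_mul_left this hp0
        linarith
      rw [div_mul_eq_mul_div, one_mul, div_le_iff₀ hα0]
      linarith
    have a2 : (1 / α * (K1 / 2)) ^ (3 / 2 : ℝ) ≤ (ℓ ^ (2 / 3 : ℝ)) ^ (3 / 2 : ℝ) :=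
      Real.rpow_le_rpow (by positivity) a1 (by norm_num)
    have a3 : K1 / 2 = (20 * (C + 1)) ^ (2 / 3 : ℝ) := by rw [hK1]; ring
    have a4 : (2 / 3 : ℝ) * (3 / 2) = 1 := by norm_num
    rw [a3, Real.mul_rpow (by positivity) (by positivity), ← Real.rpow_mul (by positivity),
      ← Real.rpow_mul hℓp.le, a4, Real.rpow_one, Real.rpow_one] at a2
    linarith
  have hy0 : 0 < y := by positivity
  have hα3 : Real.exp (-y) / 2 ≤ α ^ 3 := by
    have a1 := Real.pow_div_factorial_le_exp y hy0.le 2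
    have a2 : (1 / α) ^ 3 ≤ 2 * Real.exp y := by
      rw [hy2]
      norm_num [Nat.factorial] at a1
      linarith
    rw [one_div, inv_pow, inv_le_iff_one_le_mul₀ (by positivity)] at a2
    rw [Real.exp_neg, div_le_iff₀ (by norm_num), inv_le_iff_one_le_mul₀ (Real.exp_pos _)]
    linarith
  -- lower bound
  have low : (p : ℝ) ^ 2 * (Real.exp (-(ℓ / 20)) / 2) ≤ TT w := by
    have l1 := TT_ge_Nap w hw0 (univ.filter fun n => α ≤ w n) α hα0.le
      (fun n hn => (mem_filter.1 hn).2)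
    have l2 := roth p hp (univ.filter fun n => α ≤ w n) α hα0 hα1 (big_set w hw1 α hα0.le hWα)
    refine le_trans ?_ l1
    rw [← hy] at l2
    calc (p : ℝ) ^ 2 * (Real.exp (-(ℓ / 20)) / 2)
        ≤ (p : ℝ) ^ 2 * (Real.exp (-y + -(C * y)) / 2) := by
          gcongr
          linarith
      _ = (Real.exp (-y) / 2) * ((p : ℝ) ^ 2 * Real.exp (-(C * y))) := by
          rw [Real.exp_add]; ring
      _ ≤ _ := by gcongr
  -- upper bound
  have hWe : Real.exp (ℓ / 4) ≤ Real.sqrt W := by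
    have c1 : Real.exp (ℓ / 2) ≤ W := by
      have d1 : y ≤ Real.exp (ℓ / 2) := by
        have e1 := Real.add_one_le_exp (ℓ / 2)
        have e2 : 20 * y ≤ 20 * (C + 1) * y := by
          have : 0 < C * y := by positivity
          linarith
        linarith
      have d2 : 1 / y ≤ α := by
        rw [div_le_iff₀ hy0]
        rw [div_le_iff₀ hα0] at hy1
        linarith
      have d3 : (p : ℝ) = Real.exp (ℓ / 2) * Real.exp (ℓ / 2) := by
        rw [hpe, ← Real.exp_add]; congr 1; ring
      have d4 : Real.exp (-(ℓ / 2)) ≤ α := by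
        refine le_trans ?_ d2
        rw [Real.exp_neg, one_div]
        gcongr
      have d5 : Real.exp (ℓ / 2) = Real.exp (-(ℓ / 2)) * p := by
        rw [hpe, ← Real.exp_add]; congr 1; ring
      rw [hWα, d5]
      have : Real.exp (-(ℓ / 2)) * p ≤ α * p := mul_le_mul_of_nonneg_right d4 hp0.le
      have : 0 ≤ α * p := by positivity
      linarith
    apply Real.le_sqrt_of_sq_le
    rw [pow_two, ← Real.exp_add]
    convert c1 using 2
    ring
  have up := variation hp h54 C₀ f w hw0 hwf hwf1 hWpos H
  have u1 : (p : ℝ) ^ 2 / Real.sqrt W ≤ (p : ℝ) ^ 2 * Real.exp (-(ℓ / 4)) := by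
    rw [Real.exp_neg, ← div_eq_mul_inv]
    gcongr
  have u2 : (p : ℝ) ≤ (p : ℝ) ^ 2 * Real.exp (-(ℓ / 4)) := by
    have e1 : Real.exp (ℓ / 4) ≤ p := by
      rw [hpe]; apply Real.exp_le_exp.2; linarith
    rw [Real.exp_neg, ← div_eq_mul_inv, le_div_iff₀ (Real.exp_pos _), pow_two]
    gcongr
  have u3 : TT w ≤ (p : ℝ) ^ 2 * (B / 2 * Real.exp (-(ℓ / 4))) := by
    have : (2 + C₀) * p ≤ (2 + C₀) * ((p : ℝ) ^ 2 * Real.exp (-(ℓ / 4))) := by gcongr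
    rw [hB]
    linarith
  have u4 := le_of_mul_le_mul_left (low.trans u3) (by positivity)
  have u5 : Real.exp (-(ℓ / 20)) = Real.exp (ℓ / 5) * Real.exp (-(ℓ / 4)) := by
    rw [← Real.exp_add]; congr 1; ring
  have u6 : B * Real.exp (-(ℓ / 4)) < Real.exp (ℓ / 5) * Real.exp (-(ℓ / 4)) :=
    mul_lt_mul_of_pos_right hBl (Real.exp_pos _)
  rw [u5] at u4
  linarith

end RothAP

theorem stmt_1 :
    ∀ C₀ : ℝ, 0 < C₀ →
      ∃ K : ℝ, 0 < K ∧
        ∀ (p : ℕ) [Fact p.Prime], Odd p →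
          ∀ θ : ℝ, θ ∈ Set.Ioc (0 : ℝ) 1 →
            ∀ f : ZMod p → ℝ, (∀ n, f n ∈ Set.Icc (0 : ℝ) 1) →
              Ex p f ≥ θ →
              Lam p f ≤
                sInf {y : ℝ | ∃ g : ZMod p → ℝ,
                  (∀ n, g n ∈ Set.Icc (0 : ℝ) 1) ∧ Ex p g ≥ θ ∧ Lam p g = y} + C₀ / p →
              ∑ n : ZMod p, |f n - (if f n ≥ 1/2 then (1 : ℝ) else 0)| ≤
                K * p * (Real.log p) ^ (-(2 : ℝ)/3) := by
  intro C₀ hC₀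
  obtain ⟨K, hK, h⟩ := RothAP.final_num C₀ hC₀
  refine ⟨K, hK, ?_⟩
  intro p _ hp θ hθ f hf hE hL
  have hp0 : (0 : ℝ) < p := by exact_mod_cast (Fact.out : p.Prime).pos
  have hw : ∀ n, |f n - (if f n ≥ 1/2 then (1 : ℝ) else 0)| ≤ f n ∧
      |f n - (if f n ≥ 1/2 then (1 : ℝ) else 0)| ≤ 1 - f n := by
    intro n
    obtain ⟨h0, h1⟩ := hf n
    split_ifs with h2
    · rw [abs_of_nonpos (by linarith)]
      constructor <;> linarith
    · push Not at h2
      rw [sub_zero, abs_of_nonneg h0]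
      constructor <;> linarith
  apply h p hp f _ (fun n => abs_nonneg _) (fun n => (hw n).1) (fun n => (hw n).2)
  intro g hg0 hg1 hgs
  have hb : sInf {y : ℝ | ∃ g : ZMod p → ℝ,
      (∀ n, g n ∈ Set.Icc (0 : ℝ) 1) ∧ Ex p g ≥ θ ∧ Lam p g = y} ≤ Lam p g := by
    apply csInf_le
    · refine ⟨0, ?_⟩
      rintro y ⟨g', hg', _, rfl⟩
      unfold Lam
      apply mul_nonneg (by positivity)
      apply Finset.sum_nonneg
      intro n _
      apply Finset.sum_nonneg
      intro d _
      exact mul_nonneg (mul_nonneg (hg' _).1 (hg' _).1) (hg' _).1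
    · refine ⟨g, fun n => ⟨hg0 n, hg1 n⟩, ?_, rfl⟩
      have : Ex p g = Ex p f := by unfold Ex; rw [hgs]
      rw [this]
      exact hE
  have h1 : Lam p f ≤ Lam p g + C₀ / p := hL.trans (by linarith)
  have e1 : RothAP.TT f = (p : ℝ) ^ 2 * Lam p f := by
    unfold Lam RothAP.TT
    rw [← mul_assoc, mul_inv_cancel₀ (by positivity), one_mul]
  have e2 : RothAP.TT g = (p : ℝ) ^ 2 * Lam p g := by
    unfold Lam RothAP.TT
    rw [← mul_assoc, mul_inv_cancel₀ (by positivity), one_mul]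
  have e3 : (p : ℝ) ^ 2 * (C₀ / p) = C₀ * p := by field_simp
  have h2 : (p : ℝ) ^ 2 * Lam p f ≤ (p : ℝ) ^ 2 * (Lam p g + C₀ / p) :=
    mul_le_mul_of_nonneg_left h1 (by positivity)
  rw [mul_add, e3] at h2
  rw [e1, e2]
  linarith
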